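/- arXiv:math/0701158 — 2 statements merged into one kernel-verified Lean document; each statement's English description precedes it below -/
import Mathlib

section
/- Let p ∈ [1,∞) and let Q be a Dirac-form potential with real-valued q₁, q₂ ∈ L_p(0,1). Then the eigenvalues of the Dirac operators A₁ and A₂ form two discrete, doubly infinite subsets of ℝ that can be enumerated as strictly increasing sequences (λ_n)_{n∈ℤ} and (μ_n)_{n∈ℤ} satisfying the interlacing condition λ_{n−1} < μ_n < λ_n for every n ∈ ℤ, and such that there exist g₁, g₂ ∈ L_p(0,1) with λ_n = π(n + 1/2) + e_n(g₁) and μ_n = πn + e_n(g₂) for all n ∈ ℤ. -/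
open MeasureTheory Complex Filter Set
open scoped Matrix.Norms.L2Operator ENNReal

noncomputable section

abbrev M2 := Matrix (Fin 2) (Fin 2) ℂ

def Bmat : M2 := !![0, 1; -1, 0]

def Jmat : M2 := !![1, 0; 0, -1]

/-- `expB τ = e^{-τ B} = [[cos τ, -sin τ],[sin τ, cos τ]]`. -/
def expB (τ : ℂ) : M2 := !![Complex.cos τ, -Complex.sin τ; Complex.sin τ, Complex.cos τ]

/-- Lebesgue measure restricted to `(0,1)`. -/
def μ01 : Measure ℝ := volume.restrict (Set.Ioo 0 1)

/-- Lebesgue measure restricted to `(-1,1)`. -/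
def μ11 : Measure ℝ := volume.restrict (Set.Ioo (-1) 1)

/-- A Dirac-form potential `Q = [[q₁,q₂],[q₂,-q₁]]`. -/
def IsDiracForm (Q : ℝ → M2) : Prop :=
  ∃ q1 q2 : ℝ → ℂ, ∀ x, Q x = !![q1 x, q2 x; q2 x, -q1 x]

/-- A Dirac-form potential with real-valued entries. -/
def IsRealDiracForm (Q : ℝ → M2) : Prop :=
  ∃ q1 q2 : ℝ → ℝ, ∀ x, Q x = !![(q1 x : ℂ), (q2 x : ℂ); (q2 x : ℂ), -(q1 x : ℂ)]

/-- `U` is an absolutely continuous matrix solution of `B U' + Q U = λ U` a.e. on `(0,1)`. -/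
def IsMatSolution (Q : ℝ → M2) (l : ℂ) (U : ℝ → M2) : Prop :=
  ∃ U' : ℝ → M2, IntegrableOn U' (Set.Ioo 0 1) ∧
    (∀ x ∈ Set.Icc (0:ℝ) 1, U x = U 0 + ∫ t in (0:ℝ)..x, U' t) ∧
    (∀ᵐ x ∂μ01, Bmat * U' x + Q x * U x = l • U x)

/-- `u` is an absolutely continuous `ℂ²`-valued solution of `B u' + Q u = λ u` a.e. on `(0,1)`. -/
def IsVecSolution (Q : ℝ → M2) (l : ℂ) (u : ℝ → Fin 2 → ℂ) : Prop :=
  ∃ u' : ℝ → Fin 2 → ℂ, IntegrableOn u' (Set.Ioo 0 1) ∧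
    (∀ x ∈ Set.Icc (0:ℝ) 1, u x = u 0 + ∫ t in (0:ℝ)..x, u' t) ∧
    (∀ᵐ x ∂μ01, Bmat.mulVec (u' x) + (Q x).mulVec (u x) = l • u x)

/-- `λ` is an eigenvalue of the Dirac operator `A_j` (`j = 0` for `A₁`, `j = 1` for `A₂`):
there is a nonzero AC solution with `u₂(0) = 0` and `u_j(1) = 0`. -/
def IsEigenvalue (Q : ℝ → M2) (j : Fin 2) (l : ℝ) : Prop :=
  ∃ u : ℝ → Fin 2 → ℂ, IsVecSolution Q (l : ℂ) u ∧
    (∃ x ∈ Set.Icc (0:ℝ) 1, u x ≠ 0) ∧ u 0 1 = 0 ∧ u 1 j = 0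

/-- `c₀(·,λ) = (cos λx, sin λx)ᵗ`. -/
def c0 (l : ℂ) (x : ℝ) : Fin 2 → ℂ := ![Complex.cos (l * x), Complex.sin (l * x)]

/-- n-th Fourier coefficient `e_n(g) = ∫₀¹ e^{-2πinx} g(x) dx`. -/
def fc (g : ℝ → ℂ) (n : ℤ) : ℂ :=
  ∫ x in (0:ℝ)..1, Complex.exp (-2 * Real.pi * Complex.I * n * x) * g x

/-- The square of the `ℍ = L₂((0,1),ℂ²)` norm of `u`. -/
def hnormSq (u : ℝ → Fin 2 → ℂ) : ℝ :=
  ∫ x in Set.Ioo (0:ℝ) 1, (‖u x 0‖ ^ 2 + ‖u x 1‖ ^ 2)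

/-- The `ℂ²` inner product `⟨v,w⟩ = v₁ w̄₁ + v₂ w̄₂`. -/
def ip2 (v w : Fin 2 → ℂ) : ℂ := v 0 * star (w 0) + v 1 * star (w 1)

/-- The eigenvalue asymptotics `λ_n = π(n+1/2) + e_n(g)` for some `g ∈ L_p(0,1)`. -/
def LamAsymp (p : ℝ≥0∞) (lam : ℤ → ℝ) : Prop :=
  ∃ g : ℝ → ℂ, MemLp g p μ01 ∧
    ∀ n : ℤ, (lam n : ℂ) = Real.pi * (n + 1/2) + fc g n

/-- The eigenvalue asymptotics `μ_n = πn + e_n(g)` for some `g ∈ L_p(0,1)`. -/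
def MuAsymp (p : ℝ≥0∞) (mu : ℤ → ℝ) : Prop :=
  ∃ g : ℝ → ℂ, MemLp g p μ01 ∧
    ∀ n : ℤ, (mu n : ℂ) = Real.pi * n + fc g n

/-- The norming-constant asymptotics `α_n = 1 + e_n(g)` for some `g ∈ L_p(0,1)`. -/
def AlAsymp (p : ℝ≥0∞) (al : ℤ → ℝ) : Prop :=
  ∃ g : ℝ → ℂ, MemLp g p μ01 ∧ ∀ n : ℤ, (al n : ℂ) = 1 + fc g n

/-- Membership in the class `SD_p` of spectral data. -/
def MemSD (p : ℝ≥0∞) (lam mu : ℤ → ℝ) : Prop :=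
  (∀ n : ℤ, lam (n - 1) < mu n ∧ mu n < lam n) ∧ LamAsymp p lam ∧ MuAsymp p mu

/-- Membership in the kernel space `G_p(M₂)`: all slices lie in `L_p` and the slice maps are
continuous from `[0,1]` to `L_p((0,1),M₂)`. -/
def MemGp (p : ℝ≥0∞) (K : ℝ → ℝ → M2) : Prop :=
  (∀ x ∈ Set.Icc (0:ℝ) 1, MemLp (K x) p μ01) ∧
  (∀ t ∈ Set.Icc (0:ℝ) 1, MemLp (fun x => K x t) p μ01) ∧
  (∀ x₀ ∈ Set.Icc (0:ℝ) 1, ∀ ε > (0:ℝ), ∃ δ > (0:ℝ), ∀ x ∈ Set.Icc (0:ℝ) 1,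
    |x - x₀| < δ → eLpNorm (fun t => K x t - K x₀ t) p μ01 < ENNReal.ofReal ε) ∧
  (∀ t₀ ∈ Set.Icc (0:ℝ) 1, ∀ ε > (0:ℝ), ∃ δ > (0:ℝ), ∀ t ∈ Set.Icc (0:ℝ) 1,
    |t - t₀| < δ → eLpNorm (fun x => K x t - K x t₀) p μ01 < ENNReal.ofReal ε)

/-- The norm of the space `G_p(M₂)` (as an extended real number). -/
def gpNorm (p : ℝ≥0∞) (K : ℝ → ℝ → M2) : ℝ≥0∞ :=
  max (⨆ x ∈ Set.Icc (0:ℝ) 1, eLpNorm (K x) p μ01)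
      (⨆ t ∈ Set.Icc (0:ℝ) 1, eLpNorm (fun x => K x t) p μ01)


namespace DP

lemma ac_of_dist_le {X Y : Type*} [PseudoMetricSpace X] [PseudoMetricSpace Y] {f : ℝ → X}
    {g : ℝ → Y} {a b L : ℝ}
    (hL : 0 ≤ L) (hf : AbsolutelyContinuousOnInterval f a b)
    (h : ∀ x ∈ uIcc a b, ∀ y ∈ uIcc a b, dist (g x) (g y) ≤ L * dist (f x) (f y)) :
    AbsolutelyContinuousOnInterval g a b := by
  rw [absolutelyContinuousOnInterval_iff] at hf ⊢
  intro ε hε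
  obtain ⟨δ, hδ, H⟩ := hf (ε / (L + 1)) (by positivity)
  refine ⟨δ, hδ, fun E hE hs => ?_⟩
  have h1 := H E hE hs
  calc _ ≤ ∑ i ∈ Finset.range E.1, L * dist (f (E.2 i).1) (f (E.2 i).2) := by
        apply Finset.sum_le_sum
        intro i hi
        exact h _ (hE.1 i hi).1 _ (hE.1 i hi).2
    _ = L * ∑ i ∈ Finset.range E.1, dist (f (E.2 i).1) (f (E.2 i).2) := by rw [Finset.mul_sum]
    _ ≤ L * (ε / (L + 1)) := by gcongr
    _ < (L + 1) * (ε / (L + 1)) := by gcongr; linarith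
    _ = ε := by field_simp

lemma cont_prim {E : Type*} [NormedAddCommGroup E] [NormedSpace ℝ E] {w : ℝ → E}
    (hw : Integrable w) : Continuous (fun x => ∫ t in (0:ℝ)..x, w t) :=
  intervalIntegral.continuous_primitive (fun _ _ => hw.intervalIntegrable) 0

lemma ac_prim {E : Type*} [NormedAddCommGroup E] [NormedSpace ℝ E] {w : ℝ → E} {b : ℝ}
    (hw : IntervalIntegrable w volume 0 b) :
    AbsolutelyContinuousOnInterval (fun x => ∫ t in (0:ℝ)..x, w t) 0 b := by
  have h1 := hw.norm.absolutelyContinuousOnInterval_intervalIntegral (c := 0) (by simp)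
  refine ac_of_dist_le zero_le_one h1 fun x hx y hy => ?_
  have hsub : ∀ z ∈ uIcc 0 b, IntervalIntegrable w volume 0 z := fun z hz =>
    hw.mono_set (uIcc_subset_uIcc_left hz)
  rw [dist_eq_norm, dist_eq_norm, intervalIntegral.integral_interval_sub_left (hsub x hx)
    (hsub y hy), intervalIntegral.integral_interval_sub_left (hsub x hx).norm
    (hsub y hy).norm, one_mul, Real.norm_eq_abs]
  exact intervalIntegral.norm_integral_le_abs_integral_norm

/-- Integration of the logarithmic derivative. -/
lemma exp_prim {w : ℝ → ℂ} (hw : ∀ a b : ℝ, IntervalIntegrable w volume a b) {b : ℝ} :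
    Complex.exp (∫ t in (0:ℝ)..b, w t) =
      1 + ∫ t in (0:ℝ)..b, w t * Complex.exp (∫ s in (0:ℝ)..t, w s) := by
  set W : ℝ → ℂ := fun x => ∫ t in (0:ℝ)..x, w t with hW
  have hWc : Continuous W := intervalIntegral.continuous_primitive hw 0
  have hwi : IntervalIntegrable w volume 0 b := hw 0 b
  have hWac : AbsolutelyContinuousOnInterval W 0 b :=
    ac_prim hwi
  have hEc : Continuous (fun x => Complex.exp (W x)) := Complex.continuous_exp.comp hWc
  have hintg : ∀ a b : ℝ, IntervalIntegrable (fun t => w t * Complex.exp (W t)) volume a b :=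
    fun a b => (hw a b).mul_continuousOn hEc.continuousOn
  obtain ⟨C, hC⟩ := hWac.exists_bound
  have hCD : ContDiffOn ℝ 1 Complex.exp (Metric.closedBall (0:ℂ) C) :=
    (Complex.contDiff_exp (𝕜 := ℝ)).contDiffOn
  obtain ⟨K, hK⟩ := hCD.exists_lipschitzOnWith (by decide) (convex_closedBall _ _)
    (isCompact_closedBall _ _)
  have hEac : AbsolutelyContinuousOnInterval (fun x => Complex.exp (W x)) 0 b := by
    refine ac_of_dist_le (L := K) K.2 hWac fun x hx y hy => ?_
    exact hK.dist_le_mul _ (by simpa using hC x hx) _ (by simpa using hC y hy)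
  have hIac : AbsolutelyContinuousOnInterval
      (fun x => ∫ t in (0:ℝ)..x, w t * Complex.exp (W t)) 0 b :=
    ac_prim (hintg 0 b)
  obtain ⟨D, hD⟩ := (hEac.sub hIac).const_of_ae_hasDerivAt_zero (by
    filter_upwards [(hintg 0 b).ae_hasDerivAt_integral,
      (hw 0 b).ae_hasDerivAt_integral] with x h1 h2 hx
    have e1 := h1 hx 0 (by simp)
    have e2 := (h2 hx 0 (by simp)).cexp
    have := e2.sub e1
    convert! this using 1
    simp only [hW]; ring)
  have h0 := hD 0 (by simp)
  have hb := hD b (by simp)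
  simp [hW] at h0 hb
  rw [← h0] at hb
  rw [← hb]; ring

lemma exp_prim_real {w : ℝ → ℝ} (hw : Integrable w) {b : ℝ} :
    Real.exp (∫ t in (0:ℝ)..b, w t) =
      1 + ∫ t in (0:ℝ)..b, w t * Real.exp (∫ s in (0:ℝ)..t, w s) := by
  have h := exp_prim (w := fun t => (w t : ℂ))
    (fun _ _ => hw.ofReal.intervalIntegrable) (b := b)
  have : ∀ x : ℝ, ∫ t in (0:ℝ)..x, (w t : ℂ) = ((∫ t in (0:ℝ)..x, w t : ℝ) : ℂ) :=
    fun x => intervalIntegral.integral_ofReal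
  simp only [this] at h
  apply Complex.ofReal_injective
  push_cast
  rw [h, ← intervalIntegral.integral_ofReal]
  push_cast
  rfl

/-- Product rule for primitives. -/
lemma mul_prim {f g : ℝ → ℝ} (hf : Integrable f) (hg : Integrable g) (α β : ℝ) {b : ℝ} :
    (α + ∫ t in (0:ℝ)..b, f t) * (β + ∫ t in (0:ℝ)..b, g t) =
      α * β + ∫ t in (0:ℝ)..b, (f t * (β + ∫ s in (0:ℝ)..t, g s) +
        (α + ∫ s in (0:ℝ)..t, f s) * g t) := by
  set F : ℝ → ℝ := fun x => α + ∫ t in (0:ℝ)..x, f t with hF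
  set G : ℝ → ℝ := fun x => β + ∫ t in (0:ℝ)..x, g t with hG
  have hFc : Continuous F := continuous_const.add (cont_prim hf)
  have hGc : Continuous G := continuous_const.add (cont_prim hg)
  have hcst : ∀ c : ℝ, AbsolutelyContinuousOnInterval (fun _ : ℝ => c) 0 b := fun c =>
    ((LipschitzWith.const' c (K := 0)).lipschitzOnWith (s := uIcc 0 b)).absolutelyContinuousOnInterval
  have hFac : AbsolutelyContinuousOnInterval F 0 b :=
    (hcst α).add (hf.intervalIntegrable.absolutelyContinuousOnInterval_intervalIntegral (by simp))
  have hGac : AbsolutelyContinuousOnInterval G 0 b :=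
    (hcst β).add (hg.intervalIntegrable.absolutelyContinuousOnInterval_intervalIntegral (by simp))
  have hintg : IntervalIntegrable (fun t => f t * G t + F t * g t) volume 0 b :=
    (hf.intervalIntegrable.mul_continuousOn hGc.continuousOn).add
      (hg.intervalIntegrable.continuousOn_mul hFc.continuousOn)
  have hIac : AbsolutelyContinuousOnInterval
      (fun x => ∫ t in (0:ℝ)..x, (f t * G t + F t * g t)) 0 b :=
    hintg.absolutelyContinuousOnInterval_intervalIntegral (by simp)
  obtain ⟨D, hD⟩ := ((hFac.mul hGac).sub hIac).const_of_ae_hasDerivAt_zero (by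
    filter_upwards [hintg.ae_hasDerivAt_integral,
      (hf.intervalIntegrable (a := 0) (b := b)).ae_hasDerivAt_integral,
      (hg.intervalIntegrable (a := 0) (b := b)).ae_hasDerivAt_integral] with x h1 h2 h3 hx
    have e1 := h1 hx 0 (by simp)
    have e2 := (h2 hx 0 (by simp)).const_add α
    have e3 := (h3 hx 0 (by simp)).const_add β
    have := (e2.mul e3).sub e1
    convert! this using 1
    simp only [hF, hG]; ring)
  have h0 := hD 0 (by simp)
  have hb := hD b (by simp)
  simp [hF, hG] at h0 hb
  rw [← h0] at hb
  linarith

end DP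

namespace DP

lemma two_k_exp {k : ℝ → ℝ} (hk : Integrable k) (x : ℝ) :
    ∫ t in (0:ℝ)..x, k t * Real.exp (∫ s in (0:ℝ)..t, 2 * k s) =
      (Real.exp (∫ s in (0:ℝ)..x, 2 * k s) - 1) / 2 := by
  have h := exp_prim_real (w := fun t => 2 * k t) (hk.const_mul 2) (b := x)
  have h2 : ∫ t in (0:ℝ)..x, 2 * k t * Real.exp (∫ s in (0:ℝ)..t, 2 * k s) =
      2 * ∫ t in (0:ℝ)..x, k t * Real.exp (∫ s in (0:ℝ)..t, 2 * k s) := by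
    rw [← intervalIntegral.integral_const_mul]
    congr 1; ext t; ring
  rw [h2] at h
  linarith

lemma gronwall_zero {E : Type*} [NormedAddCommGroup E] {k : ℝ → ℝ} (hk : Integrable k)
    (hk0 : ∀ t, 0 ≤ k t) {d : ℝ → E} (hd : ContinuousOn d (Icc 0 1))
    (h : ∀ x ∈ Icc (0:ℝ) 1, ‖d x‖ ≤ ∫ t in (0:ℝ)..x, k t * ‖d t‖) :
    ∀ x ∈ Icc (0:ℝ) 1, d x = 0 := by
  set K : ℝ → ℝ := fun x => ∫ s in (0:ℝ)..x, 2 * k s with hK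
  have hKc : Continuous K := cont_prim (hk.const_mul 2)
  have hfc : ContinuousOn (fun x => Real.exp (-K x) * ‖d x‖) (Icc 0 1) :=
    (Real.continuous_exp.comp hKc.neg).continuousOn.mul hd.norm
  obtain ⟨x0, hx0, hmax⟩ := isCompact_Icc.exists_isMaxOn (nonempty_Icc.2 zero_le_one) hfc
  set m := Real.exp (-K x0) * ‖d x0‖ with hm
  have hb : ∀ t ∈ Icc (0:ℝ) 1, ‖d t‖ ≤ m * Real.exp (K t) := by
    intro t ht
    have h1 : Real.exp (-K t) * ‖d t‖ ≤ m := hmax ht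
    calc ‖d t‖ = (Real.exp (-K t) * ‖d t‖) * Real.exp (K t) := by
          rw [Real.exp_neg]; field_simp
      _ ≤ _ := by gcongr
  have hx0i : ∫ t in (0:ℝ)..x0, k t * ‖d t‖ ≤ ∫ t in (0:ℝ)..x0, m * (k t * Real.exp (K t)) := by
    apply intervalIntegral.integral_mono_on hx0.1
    · refine hk.intervalIntegrable.mul_continuousOn (hd.norm.mono ?_)
      rw [uIcc_of_le hx0.1]; exact Icc_subset_Icc le_rfl hx0.2
    · exact (hk.intervalIntegrable.mul_continuousOn
        (Real.continuous_exp.comp hKc).continuousOn).const_mul m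
    · intro t ht
      have := hb t ⟨ht.1, ht.2.trans hx0.2⟩
      calc k t * ‖d t‖ ≤ k t * (m * Real.exp (K t)) := mul_le_mul_of_nonneg_left this (hk0 t)
        _ = _ := by ring
  rw [intervalIntegral.integral_const_mul, two_k_exp hk] at hx0i
  have h1 := h x0 hx0
  have h2 : ‖d x0‖ = m * Real.exp (K x0) := by
    rw [hm, Real.exp_neg]; field_simp
  have hm0 : 0 ≤ m := by positivity
  have h3 : m * Real.exp (K x0) ≤ m * ((Real.exp (K x0) - 1) / 2) := by
    rw [← h2]; exact h1.trans hx0i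
  have h4 : m ≤ 0 := by
    nlinarith [Real.exp_pos (K x0), mul_nonneg hm0 (Real.exp_pos (K x0)).le]
  have h5 : m = 0 := le_antisymm h4 hm0
  intro x hx
  have := hb x hx
  rw [h5, zero_mul] at this
  exact norm_le_zero_iff.1 this

/-- Existence for Volterra equations with integrable Lipschitz constants, with invariants. -/
lemma caratheodory {E : Type*} [NormedAddCommGroup E] [NormedSpace ℝ E] [CompleteSpace E]
    {k : ℝ → ℝ} (hk : Integrable k) (hk0 : ∀ t, 0 ≤ k t) (F : ℝ → E → E)
    (hLip : ∀ t u v, ‖F t u - F t v‖ ≤ k t * ‖u - v‖)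
    (hintg : ∀ f : ℝ → E, Continuous f → Integrable (fun t => F t (f t)))
    (f0 : ℝ → E) (hf0 : Continuous f0) (S : ℝ → Set E) (hScl : ∀ t, IsClosed (S t))
    (hS0 : ∀ t, 0 ∈ S t) (hSs : ∀ t, ∀ c : ℝ, ∀ u ∈ S t, c • u ∈ S t)
    (hST : ∀ f : ℝ → E, Continuous f → (∀ t ∈ Icc (0:ℝ) 1, f t ∈ S t) →
      ∀ x ∈ Icc (0:ℝ) 1, f0 x + ∫ t in (0:ℝ)..x, F t (f t) ∈ S x) :
    ∃ f : ℝ → E, Continuous f ∧ (∀ x ∈ Icc (0:ℝ) 1, f x = f0 x + ∫ t in (0:ℝ)..x, F t (f t)) ∧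
      ∀ x ∈ Icc (0:ℝ) 1, f x ∈ S x := by
  set K : ℝ → ℝ := fun x => ∫ s in (0:ℝ)..x, 2 * k s with hK
  have hKc : Continuous K := cont_prim (hk.const_mul 2)
  let ext : C(Icc (0:ℝ) 1, E) → ℝ → E := fun g t =>
    Real.exp (K t) • g (projIcc 0 1 zero_le_one t)
  have hext : ∀ g, Continuous (ext g) := fun g =>
    (Real.continuous_exp.comp hKc).smul (g.continuous.comp continuous_projIcc)
  let T : C(Icc (0:ℝ) 1, E) → C(Icc (0:ℝ) 1, E) := fun g =>
    ⟨fun x => Real.exp (-K x) • (f0 x + ∫ t in (0:ℝ)..x, F t (ext g t)), by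
      have h1 : Continuous (fun x : ℝ => Real.exp (-K x) •
          (f0 x + ∫ t in (0:ℝ)..x, F t (ext g t))) :=
        (Real.continuous_exp.comp hKc.neg).smul (hf0.add (cont_prim (hintg _ (hext g))))
      exact h1.comp continuous_subtype_val⟩
  have hTapp : ∀ g (x : Icc (0:ℝ) 1), T g x =
      Real.exp (-K x) • (f0 x + ∫ t in (0:ℝ)..x, F t (ext g t)) := fun _ _ => rfl
  have hT : ContractingWith (1/2) T := by
    refine ⟨by rw [← NNReal.coe_lt_coe]; norm_num, LipschitzWith.of_dist_le_mul fun g g' => ?_⟩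
    rw [ContinuousMap.dist_le (by positivity)]
    intro x
    rw [hTapp, hTapp, dist_eq_norm, ← smul_sub, add_sub_add_left_eq_sub,
      ← intervalIntegral.integral_sub (hintg _ (hext g)).intervalIntegrable
        (hintg _ (hext g')).intervalIntegrable, norm_smul, Real.norm_of_nonneg (Real.exp_pos _).le]
    have h1 : ‖∫ t in (0:ℝ)..x, (F t (ext g t) - F t (ext g' t))‖ ≤
        ∫ t in (0:ℝ)..x, dist g g' * (k t * Real.exp (K t)) := by
      apply intervalIntegral.norm_integral_le_of_norm_le x.2.1
      · filter_upwards with t ht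
        refine (hLip t _ _).trans ?_
        have : ‖ext g t - ext g' t‖ ≤ Real.exp (K t) * dist g g' := by
          simp only [ext]
          rw [← smul_sub, norm_smul, Real.norm_of_nonneg (Real.exp_pos _).le, ← dist_eq_norm]
          gcongr
          exact ContinuousMap.dist_apply_le_dist _
        calc _ ≤ k t * (Real.exp (K t) * dist g g') := mul_le_mul_of_nonneg_left this (hk0 t)
          _ = _ := by ring
      · exact (hk.intervalIntegrable.mul_continuousOn
          (Real.continuous_exp.comp hKc).continuousOn).const_mul _
    rw [intervalIntegral.integral_const_mul, two_k_exp hk] at h1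
    calc _ ≤ Real.exp (-K x) * (dist g g' * ((Real.exp (K x) - 1) / 2)) := by gcongr
      _ = dist g g' / 2 - Real.exp (-K x) * dist g g' / 2 := by
        rw [Real.exp_neg]; field_simp
      _ ≤ dist g g' / 2 := by
        have : 0 ≤ Real.exp (-K x) * dist g g' / 2 := by positivity
        linarith
      _ = _ := by push_cast; ring
  let g := ContractingWith.fixedPoint T hT
  have hg : T g = g := hT.fixedPoint_isFixedPt
  have hgx : ∀ x : Icc (0:ℝ) 1, ext g x = f0 x + ∫ t in (0:ℝ)..x, F t (ext g t) := by
    intro x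
    have h1 := hTapp g x
    rw [hg] at h1
    simp only [ext]
    rw [projIcc_val, h1, smul_smul, ← Real.exp_add]
    simp [ext]
  have hmem : ∀ g : C(Icc (0:ℝ) 1, E), (∀ x : Icc (0:ℝ) 1, g x ∈ S x) →
      ∀ x : Icc (0:ℝ) 1, T g x ∈ S x := by
    intro g hg x
    rw [hTapp]
    refine hSs _ _ _ (hST _ (hext g) (fun t ht => hSs _ _ _ ?_) x x.2)
    have := hg ⟨t, ht⟩
    rwa [projIcc_of_mem zero_le_one ht]
  have hit : ∀ (n : ℕ) (x : Icc (0:ℝ) 1), (T^[n] 0) x ∈ S x := by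
    intro n
    induction n with
    | zero => intro x; simpa using hS0 x
    | succ n ih => intro x; rw [Function.iterate_succ_apply']; exact hmem _ ih x
  have hgS : ∀ x : Icc (0:ℝ) 1, g x ∈ S x := by
    intro x
    have h1 := hT.tendsto_iterate_fixedPoint 0
    have h2 : Tendsto (fun n => (T^[n] 0) x) atTop (nhds (g x)) :=
      ((continuous_eval_const x).tendsto _).comp h1
    exact (hScl x).mem_of_tendsto h2 (Eventually.of_forall fun n => hit n x)
  refine ⟨ext g, hext g, fun x hx => hgx ⟨x, hx⟩, fun x hx => hSs _ _ _ ?_⟩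
  have := hgS ⟨x, hx⟩
  rwa [projIcc_of_mem zero_le_one hx]

end DP

namespace DP

/-- the phase factor -/
def ph (x : ℝ) : ℂ := Complex.exp (-(2 * x * I))

lemma ph_cont : Continuous ph := by unfold ph; fun_prop

lemma ph_norm (x : ℝ) : ‖ph x‖ = 1 := by
  rw [ph, Complex.norm_exp]; simp

lemma ph_lip (x y : ℝ) : ‖ph x - ph y‖ ≤ 2 * |x - y| := by
  have h : ph x - ph y = ph y * (Complex.exp (I * ((-(2 * (x - y)) : ℝ) : ℂ)) - 1) := by
    rw [mul_sub, ph, ph, ← Complex.exp_add, mul_one]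
    congr 2
    push_cast; ring
  rw [h, norm_mul, ph_norm, one_mul]
  refine (Real.norm_exp_I_mul_ofReal_sub_one_le).trans ?_
  rw [norm_neg, norm_mul]; simp

variable {P : ℝ → ℂ}

lemma int_mul_ph (hP : Integrable P) {f : ℝ → ℝ} (hf : Continuous f) :
    Integrable (fun t => P t * ph (f t)) := by
  refine hP.mul_bdd (c := 1) (ph_cont.comp hf).aestronglyMeasurable ?_
  filter_upwards with t
  exact (ph_norm _).le

lemma pruefer_exists (hP : Integrable P) (l : ℝ) : ∃ θ : ℝ → ℝ, Continuous θ ∧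
    ∀ x ∈ Icc (0:ℝ) 1, θ x = l * x + ∫ t in (0:ℝ)..x, -(P t * ph (θ t)).re := by
  obtain ⟨θ, h1, h2, -⟩ := caratheodory (E := ℝ) (k := fun t => 2 * ‖P t‖) (hP.norm.const_mul 2)
    (fun t => by positivity) (fun t u => -(P t * ph u).re) (fun t u v => by
      have : -(P t * ph u).re - -(P t * ph v).re = -(P t * (ph u - ph v)).re := by
        rw [mul_sub, Complex.sub_re]; ring
      rw [this, norm_neg, Real.norm_eq_abs, Real.norm_eq_abs]
      refine (Complex.abs_re_le_norm _).trans ?_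
      rw [norm_mul]
      have := ph_lip u v
      have h0 := norm_nonneg (P t)
      nlinarith) (fun f hf => (int_mul_ph hP hf).re.neg) (fun x => l * x) (by fun_prop)
    (fun _ => univ) (fun _ => isClosed_univ) (fun _ => mem_univ _) (fun _ _ _ _ => mem_univ _)
    (fun _ _ _ _ _ => mem_univ _)
  exact ⟨θ, h1, h2⟩

/-- the Pruefer angle -/
def th (hP : Integrable P) (l : ℝ) : ℝ → ℝ := (pruefer_exists hP l).choose

lemma th_cont (hP : Integrable P) (l : ℝ) : Continuous (th hP l) :=
  (pruefer_exists hP l).choose_spec.1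

lemma th_eq (hP : Integrable P) (l : ℝ) : ∀ x ∈ Icc (0:ℝ) 1,
    th hP l x = l * x + ∫ t in (0:ℝ)..x, -(P t * ph (th hP l t)).re :=
  (pruefer_exists hP l).choose_spec.2

lemma th_sub_le (hP : Integrable P) (l : ℝ) : |th hP l 1 - l| ≤ ∫ t in (0:ℝ)..1, ‖P t‖ := by
  rw [th_eq hP l 1 (by simp), mul_one, add_sub_cancel_left, ← Real.norm_eq_abs]
  apply intervalIntegral.norm_integral_le_of_norm_le zero_le_one
  · filter_upwards with t _
    rw [norm_neg, Real.norm_eq_abs]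
    refine (Complex.abs_re_le_norm _).trans ?_
    rw [norm_mul, ph_norm, mul_one]
  · exact hP.norm.intervalIntegrable

lemma th_diff (hP : Integrable P) (l l' : ℝ) : ∃ c : ℝ, 0 < c ∧
    c ≤ Real.exp (2 * ∫ t in (0:ℝ)..1, 2 * ‖P t‖) ∧
    th hP l' 1 - th hP l 1 = (l' - l) * c := by
  set d : ℝ → ℝ := fun x => th hP l' x - th hP l x with hd
  have hdc : Continuous d := (th_cont hP l').sub (th_cont hP l)
  set a : ℝ → ℝ := fun t => (-(P t * ph (th hP l' t)).re - -(P t * ph (th hP l t)).re) / d t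
    with ha
  have hi : ∀ l, Integrable (fun t => -(P t * ph (th hP l t)).re) :=
    fun l => (int_mul_ph hP (th_cont hP l)).re.neg
  have hab : ∀ t, ‖a t‖ ≤ 2 * ‖P t‖ := by
    intro t
    have : -(P t * ph (th hP l' t)).re - -(P t * ph (th hP l t)).re =
        -(P t * (ph (th hP l' t) - ph (th hP l t))).re := by
      rw [mul_sub, Complex.sub_re]; ring
    simp only [ha]
    rw [this, norm_div, norm_neg, Real.norm_eq_abs, Real.norm_eq_abs]
    apply div_le_of_le_mul₀ (abs_nonneg _) (by positivity)
    refine (Complex.abs_re_le_norm _).trans ?_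
    rw [norm_mul]
    have := ph_lip (th hP l' t) (th hP l t)
    have h0 := norm_nonneg (P t)
    calc _ ≤ ‖P t‖ * (2 * |th hP l' t - th hP l t|) := by gcongr
      _ = _ := by simp only [hd]; ring
  have had : ∀ t, a t * d t = -(P t * ph (th hP l' t)).re - -(P t * ph (th hP l t)).re := by
    intro t
    by_cases h : d t = 0
    · have h' : th hP l' t = th hP l t := sub_eq_zero.1 h
      rw [h, h']; simp
    · simp only [ha]; field_simp
  have hai : Integrable a := by
    refine (hP.norm.const_mul 2).mono' ?_ (Eventually.of_forall hab)
    exact (((hi l').sub (hi l)).aestronglyMeasurable.aemeasurable.div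
      hdc.measurable.aemeasurable).aestronglyMeasurable
  set c := l' - l with hc
  have hdx : ∀ x ∈ Icc (0:ℝ) 1, d x = c * x + ∫ t in (0:ℝ)..x, a t * d t := by
    intro x hx
    have h1 : ∫ t in (0:ℝ)..x, a t * d t =
        (∫ t in (0:ℝ)..x, -(P t * ph (th hP l' t)).re) -
          ∫ t in (0:ℝ)..x, -(P t * ph (th hP l t)).re := by
      rw [← intervalIntegral.integral_sub (hi l').intervalIntegrable (hi l).intervalIntegrable]
      exact intervalIntegral.integral_congr fun t _ => had t
    rw [h1]; simp only [hd]
    rw [th_eq hP l' x hx, th_eq hP l x hx]; ring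
  -- the integrating factor
  set A : ℝ → ℝ := fun x => ∫ t in (0:ℝ)..x, -a t with hA
  have hAc : Continuous A := cont_prim hai.neg
  set f : ℝ → ℝ := (Icc (0:ℝ) 1).indicator (fun t => c + a t * d t) with hf
  have hadi : IntegrableOn (fun t => a t * d t) (Icc 0 1) :=
    hai.integrableOn.mul_continuousOn hdc.continuousOn isCompact_Icc
  have hfi : Integrable f := by
    rw [hf, integrable_indicator_iff measurableSet_Icc]
    exact (integrable_const c).add hadi
  set g : ℝ → ℝ := (Icc (0:ℝ) 1).indicator (fun t => -a t * Real.exp (A t)) with hg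
  have hgi : Integrable g := by
    rw [hg, integrable_indicator_iff measurableSet_Icc]
    exact hai.neg.integrableOn.mul_continuousOn (Real.continuous_exp.comp hAc).continuousOn
      isCompact_Icc
  have hF : ∀ x ∈ Icc (0:ℝ) 1, 0 + ∫ t in (0:ℝ)..x, f t = d x := by
    intro x hx
    have h1 : ∫ t in (0:ℝ)..x, f t = ∫ t in (0:ℝ)..x, (c + a t * d t) := by
      apply intervalIntegral.integral_congr
      intro t ht
      rw [uIcc_of_le hx.1] at ht
      simp only [hf]
      rw [indicator_of_mem (show t ∈ Icc (0:ℝ) 1 from ⟨ht.1, ht.2.trans hx.2⟩)]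
    rw [h1, intervalIntegral.integral_add (by simp), hdx x hx]
    · simp; ring
    · exact hai.intervalIntegrable.mul_continuousOn hdc.continuousOn
  have hG : ∀ x ∈ Icc (0:ℝ) 1, 1 + ∫ t in (0:ℝ)..x, g t = Real.exp (A x) := by
    intro x hx
    have h1 : ∫ t in (0:ℝ)..x, g t = ∫ t in (0:ℝ)..x, -a t * Real.exp (A t) := by
      apply intervalIntegral.integral_congr
      intro t ht
      rw [uIcc_of_le hx.1] at ht
      simp only [hg]
      rw [indicator_of_mem (show t ∈ Icc (0:ℝ) 1 from ⟨ht.1, ht.2.trans hx.2⟩)]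
    rw [h1]; exact (exp_prim_real hai.neg).symm
  have hprod := mul_prim hfi hgi 0 1 (b := 1)
  rw [hF 1 (by simp), hG 1 (by simp)] at hprod
  have h2 : ∫ t in (0:ℝ)..1, (f t * (1 + ∫ s in (0:ℝ)..t, g s) +
        (0 + ∫ s in (0:ℝ)..t, f s) * g t) = ∫ t in (0:ℝ)..1, c * Real.exp (A t) := by
    apply intervalIntegral.integral_congr
    intro t ht
    rw [uIcc_of_le zero_le_one] at ht
    simp only
    rw [hF t ht, hG t ht]
    simp only [hf, hg]
    rw [indicator_of_mem ht, indicator_of_mem ht]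
    ring
  rw [h2, intervalIntegral.integral_const_mul, zero_mul, zero_add] at hprod
  set N := ∫ t in (0:ℝ)..1, 2 * ‖P t‖ with hN
  have hAb : ∀ x ∈ Icc (0:ℝ) 1, |A x| ≤ N := by
    intro x hx
    have h1 : ‖A x‖ ≤ ∫ t in (0:ℝ)..x, 2 * ‖P t‖ := by
      apply intervalIntegral.norm_integral_le_of_norm_le hx.1
      · filter_upwards with t _
        rw [norm_neg]; exact hab t
      · exact (hP.norm.const_mul 2).intervalIntegrable
    refine h1.trans ?_
    exact intervalIntegral.integral_mono_interval le_rfl hx.1 hx.2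
      (Eventually.of_forall fun t => by positivity) (hP.norm.const_mul 2).intervalIntegrable
  have hEi : IntervalIntegrable (fun t => Real.exp (A t)) volume 0 1 :=
    (Real.continuous_exp.comp hAc).intervalIntegrable _ _
  have hpos : 0 < ∫ t in (0:ℝ)..1, Real.exp (A t) :=
    intervalIntegral.intervalIntegral_pos_of_pos hEi (fun t => Real.exp_pos _) zero_lt_one
  have hle : ∫ t in (0:ℝ)..1, Real.exp (A t) ≤ Real.exp N := by
    have := intervalIntegral.integral_mono_on zero_le_one hEi (intervalIntegrable_const (c := Real.exp N))
      (fun t ht => Real.exp_le_exp.2 ((le_abs_self _).trans (hAb t ht)))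
    simpa using this
  refine ⟨(∫ t in (0:ℝ)..1, Real.exp (A t)) * Real.exp (-A 1), by positivity, ?_, ?_⟩
  · calc _ ≤ Real.exp N * Real.exp N := by
          gcongr
          exact (neg_le_abs _).trans (hAb 1 (by simp))
      _ = _ := by rw [← Real.exp_add]; ring_nf
  · have : d 1 = (d 1 * Real.exp (A 1)) * Real.exp (-A 1) := by
      rw [mul_assoc, ← Real.exp_add]; simp
    change d 1 = _
    rw [this, hprod]; ring

lemma th_strictMono (hP : Integrable P) : StrictMono (fun l => th hP l 1) := by
  intro l l' h
  obtain ⟨c, hc, -, he⟩ := th_diff hP l l'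
  have : 0 < (l' - l) * c := mul_pos (sub_pos.2 h) hc
  simp only
  linarith

lemma th_continuous (hP : Integrable P) : Continuous (fun l => th hP l 1) := by
  refine (LipschitzWith.of_dist_le_mul (K := ⟨Real.exp (2 * ∫ t in (0:ℝ)..1, 2 * ‖P t‖),
    (Real.exp_pos _).le⟩) fun l' l => ?_).continuous
  obtain ⟨c, hc, hc2, he⟩ := th_diff hP l l'
  rw [Real.dist_eq, Real.dist_eq, he, abs_mul, abs_of_pos hc, mul_comm]
  exact mul_le_mul_of_nonneg_right hc2 (abs_nonneg _)

lemma th_surj (hP : Integrable P) (y : ℝ) : ∃ l, th hP l 1 = y := by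
  set C := ∫ t in (0:ℝ)..1, ‖P t‖
  have h1 := abs_le.1 (th_sub_le hP (y - C))
  have h2 := abs_le.1 (th_sub_le hP (y + C))
  exact mem_range_of_exists_le_of_exists_ge (th_continuous hP) ⟨y - C, by linarith [h1.2]⟩
    ⟨y + C, by linarith [h2.1]⟩

end DP

namespace DP

variable {P : ℝ → ℂ}

lemma conj_exp_ph (w : ℂ) : (starRingEnd ℂ) (Complex.exp w) = Complex.exp w * ph w.im := by
  rw [← Complex.exp_conj, ph, ← Complex.exp_add]
  congr 1
  apply Complex.ext <;> simp
  ring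

/-- the reduced solution -/
def zz (hP : Integrable P) (l : ℝ) (x : ℝ) : ℂ :=
  Complex.exp (∫ t in (0:ℝ)..x, -(I * (P t * ph (th hP l t))))

lemma zz_int (hP : Integrable P) (l : ℝ) :
    Integrable (fun t => -(I * (P t * ph (th hP l t)))) :=
  ((int_mul_ph hP (th_cont hP l)).const_mul I).neg

lemma zz_im (hP : Integrable P) (l : ℝ) {x : ℝ} (hx : x ∈ Icc (0:ℝ) 1) :
    (∫ t in (0:ℝ)..x, -(I * (P t * ph (th hP l t)))).im = th hP l x - l * x := by
  have h := th_eq hP l x hx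
  have h2 := Complex.imCLM.intervalIntegral_comp_comm (a := 0) (b := x)
    (zz_int hP l).intervalIntegrable
  simp only [Complex.imCLM_apply] at h2
  rw [← h2, h]
  ring_nf
  apply intervalIntegral.integral_congr
  intro t _
  simp
  ring

lemma zz_cont (hP : Integrable P) (l : ℝ) : Continuous (zz hP l) :=
  Complex.continuous_exp.comp (cont_prim (zz_int hP l))

lemma zz_conj (hP : Integrable P) (l : ℝ) {x : ℝ} (hx : x ∈ Icc (0:ℝ) 1) :
    (starRingEnd ℂ) (zz hP l x) = zz hP l x * ph (th hP l x - l * x) := by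
  rw [zz, conj_exp_ph, zz_im hP l hx]

lemma zz_eq (hP : Integrable P) (l : ℝ) {x : ℝ} (hx : x ∈ Icc (0:ℝ) 1) :
    zz hP l x = 1 + ∫ t in (0:ℝ)..x, -(I * (P t * (ph (l * t) * (starRingEnd ℂ) (zz hP l t)))) := by
  have h := exp_prim (w := fun t => -(I * (P t * ph (th hP l t))))
    (fun a b => (zz_int hP l).intervalIntegrable) (b := x)
  rw [zz, h]
  congr 1
  apply intervalIntegral.integral_congr
  intro t ht
  rw [uIcc_of_le hx.1] at ht
  have ht' : t ∈ Icc (0:ℝ) 1 := ⟨ht.1, ht.2.trans hx.2⟩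
  simp only
  rw [zz_conj hP l ht']
  have : ph (th hP l t) = ph (l * t) * ph (th hP l t - l * t) := by
    rw [ph, ph, ph, ← Complex.exp_add]; congr 1; push_cast; ring
  rw [this]
  simp only [zz]
  ring

lemma zz_polar (hP : Integrable P) (l : ℝ) {x : ℝ} (hx : x ∈ Icc (0:ℝ) 1) :
    ∃ r : ℝ, 0 < r ∧ zz hP l x = r * Complex.exp ((th hP l x - l * x : ℝ) * I) := by
  refine ⟨Real.exp (∫ t in (0:ℝ)..x, -(I * (P t * ph (th hP l t)))).re, Real.exp_pos _, ?_⟩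
  rw [zz, ← zz_im hP l hx, Complex.ofReal_exp, ← Complex.exp_add, Complex.re_add_im]

/-- the full solution -/
def yy (hP : Integrable P) (l : ℝ) (x : ℝ) : ℂ :=
  Complex.exp (∫ t in (0:ℝ)..x, (I * l - I * (P t * ph (th hP l t))))

lemma yy_int (hP : Integrable P) (l : ℝ) (a b : ℝ) :
    IntervalIntegrable (fun t => I * l - I * (P t * ph (th hP l t))) volume a b :=
  (intervalIntegrable_const).sub ((int_mul_ph hP (th_cont hP l)).const_mul I).intervalIntegrable

lemma yy_eq_zz (hP : Integrable P) (l : ℝ) (x : ℝ) :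
    yy hP l x = Complex.exp (l * x * I) * zz hP l x := by
  rw [yy, zz, ← Complex.exp_add]
  congr 1
  simp only [sub_eq_add_neg]
  rw [intervalIntegral.integral_add intervalIntegrable_const (zz_int hP l).intervalIntegrable]
  simp
  ring

lemma yy_cont (hP : Integrable P) (l : ℝ) : Continuous (yy hP l) := by
  have : yy hP l = fun x : ℝ => Complex.exp (l * x * I) * zz hP l x := funext (yy_eq_zz hP l)
  rw [this]
  have := zz_cont hP l
  fun_prop

lemma yy_polar (hP : Integrable P) (l : ℝ) {x : ℝ} (hx : x ∈ Icc (0:ℝ) 1) :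
    ∃ r : ℝ, 0 < r ∧ yy hP l x = r * Complex.exp ((th hP l x : ℝ) * I) := by
  obtain ⟨r, h1, h2⟩ := zz_polar hP l hx
  refine ⟨r, h1, ?_⟩
  rw [yy_eq_zz, h2, mul_left_comm, ← Complex.exp_add]
  congr 2; push_cast; ring

lemma yy_conj (hP : Integrable P) (l : ℝ) {x : ℝ} (hx : x ∈ Icc (0:ℝ) 1) :
    (starRingEnd ℂ) (yy hP l x) = yy hP l x * ph (th hP l x) := by
  obtain ⟨r, h1, h2⟩ := yy_polar hP l hx
  rw [h2, map_mul, conj_exp_ph]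
  simp
  ring

lemma yy_eq (hP : Integrable P) (l : ℝ) {x : ℝ} (hx : x ∈ Icc (0:ℝ) 1) :
    yy hP l x = 1 + ∫ t in (0:ℝ)..x,
      (I * l * yy hP l t - I * (P t * (starRingEnd ℂ) (yy hP l t))) := by
  have h := exp_prim (yy_int hP l) (b := x)
  rw [yy, h]
  congr 1
  apply intervalIntegral.integral_congr
  intro t ht
  rw [uIcc_of_le hx.1] at ht
  have ht' : t ∈ Icc (0:ℝ) 1 := ⟨ht.1, ht.2.trans hx.2⟩
  simp only
  rw [yy_conj hP l ht']
  simp only [yy]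
  ring

lemma yy_der_int (hP : Integrable P) (l : ℝ) (a b : ℝ) :
    IntervalIntegrable (fun t => I * l * yy hP l t - I * (P t * (starRingEnd ℂ) (yy hP l t)))
      volume a b := by
  have hc := yy_cont hP l
  refine IntervalIntegrable.sub ?_ ?_
  · exact Continuous.intervalIntegrable (by fun_prop) _ _
  · exact (hP.intervalIntegrable.mul_continuousOn
      (Complex.continuous_conj.comp hc).continuousOn).const_mul I

/-- real embedding of `ℂ` into `ℂ²` -/
def LL : ℂ →L[ℝ] (Fin 2 → ℂ) :=
  ContinuousLinearMap.pi ![Complex.ofRealCLM.comp Complex.reCLM, Complex.ofRealCLM.comp Complex.imCLM]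

lemma LL_0 (w : ℂ) : LL w 0 = (w.re : ℂ) := rfl
lemma LL_1 (w : ℂ) : LL w 1 = (w.im : ℂ) := rfl

variable {Q : ℝ → M2} {q1 q2 : ℝ → ℝ}

lemma sol_iff (hQ : ∀ x, Q x = !![(q1 x : ℂ), (q2 x : ℂ); (q2 x : ℂ), -(q1 x : ℂ)]) (l : ℂ) (x : ℝ)
    (w v : Fin 2 → ℂ) : Bmat.mulVec w + (Q x).mulVec v = l • v ↔
      w 0 = -l * v 1 + q2 x * v 0 - q1 x * v 1 ∧ w 1 = l * v 0 - q1 x * v 0 - q2 x * v 1 := by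
  rw [hQ, Bmat]
  constructor
  · intro h
    have h0 := congrFun h 0
    have h1 := congrFun h 1
    simp [dotProduct, Fin.sum_univ_two] at h0 h1
    constructor
    · linear_combination -h1
    · linear_combination h0
  · rintro ⟨h0, h1⟩
    ext i
    fin_cases i <;> simp [dotProduct, Fin.sum_univ_two]
    · linear_combination h1
    · linear_combination -h0

lemma sol_yy (hP : Integrable P)
    (hQ : ∀ x, Q x = !![(q1 x : ℂ), (q2 x : ℂ); (q2 x : ℂ), -(q1 x : ℂ)])
    (hPq : ∀ t ∈ Ioo (0:ℝ) 1, P t = q1 t + I * q2 t) (l : ℝ) :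
    IsVecSolution Q l (fun x => LL (yy hP l x)) := by
  refine ⟨fun t => LL (I * l * yy hP l t - I * (P t * (starRingEnd ℂ) (yy hP l t))), ?_, ?_, ?_⟩
  · have := (intervalIntegrable_iff_integrableOn_Ioo_of_le zero_le_one).1 (yy_der_int hP l 0 1)
    exact LL.integrable_comp this
  · intro x hx
    rw [LL.intervalIntegral_comp_comm (yy_der_int hP l 0 x), ← map_add]
    change LL (yy hP l x) = _
    congr 1
    have hy0 : yy hP l 0 = 1 := by rw [yy]; simp
    rw [yy_eq hP l hx, hy0]
  · refine ae_restrict_of_forall_mem measurableSet_Ioo fun t ht => ?_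
    rw [sol_iff hQ]
    simp only [LL_0, LL_1, hPq t ht]
    constructor
    · simp
      ring
    · simp
      ring

lemma sol_unique (hP : Integrable P)
    (hQ : ∀ x, Q x = !![(q1 x : ℂ), (q2 x : ℂ); (q2 x : ℂ), -(q1 x : ℂ)])
    (hPq : ∀ t ∈ Ioo (0:ℝ) 1, P t = q1 t + I * q2 t) (l : ℝ) {v : ℝ → Fin 2 → ℂ}
    (hv : IsVecSolution Q l v) (hv0 : v 0 = 0) : ∀ x ∈ Icc (0:ℝ) 1, v x = 0 := by
  obtain ⟨v', h1, h2, h3⟩ := hv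
  have hvi : IntervalIntegrable v' volume 0 1 :=
    (intervalIntegrable_iff_integrableOn_Ioo_of_le zero_le_one).2 h1
  set k : ℝ → ℝ := fun t => (Icc (0:ℝ) 1).indicator (fun _ => |l|) t + 2 * ‖P t‖ with hk
  have hki : Integrable k := by
    refine Integrable.add ?_ (hP.norm.const_mul 2)
    rw [integrable_indicator_iff measurableSet_Icc]
    exact integrable_const _
  have hk0 : ∀ t, 0 ≤ k t := fun t => by
    have : 0 ≤ (Icc (0:ℝ) 1).indicator (fun _ => |l|) t := indicator_nonneg (fun _ _ => abs_nonneg _) _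
    simp only [hk]; positivity
  have hvc : ContinuousOn v (Icc 0 1) := by
    have := intervalIntegral.continuousOn_primitive_interval (a := 0) (b := 1) (f := v')
      (μ := volume) (by
        rw [uIcc_of_le zero_le_one, integrableOn_Icc_iff_integrableOn_Ioo]; exact h1)
    rw [uIcc_of_le zero_le_one] at this
    refine this.congr fun x hx => ?_
    rw [h2 x hx, hv0, zero_add]
  have hbd : ∀ᵐ t ∂μ01, ‖v' t‖ ≤ k t * ‖v t‖ := by
    have hmem : ∀ᵐ t ∂μ01, t ∈ Ioo (0:ℝ) 1 := ae_restrict_mem measurableSet_Ioo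
    filter_upwards [h3, hmem] with t h ht
    obtain ⟨e0, e1⟩ := (sol_iff hQ _ _ _ _).1 h
    have hkt : k t = |l| + 2 * ‖P t‖ := by
      simp only [hk]; rw [indicator_of_mem (Ioo_subset_Icc_self ht)]
    have hq1 : |q1 t| ≤ ‖P t‖ := by
      have := Complex.abs_re_le_norm (P t); rw [hPq t ht] at this ⊢; simpa using this
    have hq2 : |q2 t| ≤ ‖P t‖ := by
      have := Complex.abs_im_le_norm (P t); rw [hPq t ht] at this ⊢; simpa using this
    have n0 := norm_le_pi_norm (v t) 0
    have n1 := norm_le_pi_norm (v t) 1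
    have hn := norm_nonneg (v t)
    have hkn : k t * ‖v t‖ = |l| * ‖v t‖ + ‖P t‖ * ‖v t‖ + ‖P t‖ * ‖v t‖ := by rw [hkt]; ring
    rw [pi_norm_le_iff_of_nonneg (mul_nonneg (hk0 t) hn), Fin.forall_fin_two, hkn]
    constructor
    · rw [e0]
      refine (norm_sub_le _ _).trans (add_le_add ((norm_add_le _ _).trans (add_le_add ?_ ?_)) ?_)
      · rw [norm_mul]; simp; gcongr
      · rw [norm_mul]; simp; gcongr
      · rw [norm_mul]; simp; gcongr
    · rw [e1]
      refine (norm_sub_le _ _).trans (add_le_add ((norm_sub_le _ _).trans (add_le_add ?_ ?_)) ?_)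
      · rw [norm_mul]; simp; gcongr
      · rw [norm_mul]; simp; gcongr
      · rw [norm_mul]; simp; gcongr
  refine gronwall_zero hki hk0 hvc fun x hx => ?_
  rw [h2 x hx, hv0, zero_add]
  apply intervalIntegral.norm_integral_le_of_norm_le hx.1
  · have h4 : ∀ᵐ t ∂(volume.restrict (Ioc (0:ℝ) 1)), ‖v' t‖ ≤ k t * ‖v t‖ := by
      rw [← Measure.restrict_congr_set Ioo_ae_eq_Ioc]; exact hbd
    have h5 := (ae_restrict_iff' measurableSet_Ioc).1 h4
    filter_upwards [h5] with t h ht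
    exact h ⟨ht.1, ht.2.trans hx.2⟩
  · refine (hki.intervalIntegrable).mul_continuousOn ?_
    rw [uIcc_of_le hx.1]
    exact (hvc.norm).mono (Icc_subset_Icc_right hx.2)

lemma vec_sub {l : ℂ} {u v : ℝ → Fin 2 → ℂ} (hu : IsVecSolution Q l u) (hv : IsVecSolution Q l v)
    (c : ℂ) : IsVecSolution Q l (fun x => u x - c • v x) := by
  obtain ⟨u', a1, a2, a3⟩ := hu
  obtain ⟨v', b1, b2, b3⟩ := hv
  refine ⟨fun x => u' x - c • v' x, a1.sub (b1.smul c), fun x hx => ?_, ?_⟩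
  · have key : ∀ w : ℝ → Fin 2 → ℂ, IntegrableOn w (Ioo 0 1) → IntervalIntegrable w volume 0 x := by
      intro w hw
      refine ((intervalIntegrable_iff_integrableOn_Ioo_of_le zero_le_one).2 hw).mono_set ?_
      rw [uIcc_of_le hx.1, uIcc_of_le zero_le_one]
      exact Icc_subset_Icc_right hx.2
    have hs : IntervalIntegrable (fun t => c • v' t) volume 0 x := (key _ b1).smul c
    simp only
    rw [intervalIntegral.integral_sub (key _ a1) hs, intervalIntegral.integral_smul,
      a2 x hx, b2 x hx, smul_add]
    abel
  · filter_upwards [a3, b3] with t h1 h2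
    rw [Matrix.mulVec_sub, Matrix.mulVec_sub, Matrix.mulVec_smul, Matrix.mulVec_smul, smul_sub, ← h1,
      smul_comm l c, ← h2, smul_add]
    abel

lemma eig_aux (hP : Integrable P)
    (hQ : ∀ x, Q x = !![(q1 x : ℂ), (q2 x : ℂ); (q2 x : ℂ), -(q1 x : ℂ)])
    (hPq : ∀ t ∈ Ioo (0:ℝ) 1, P t = q1 t + I * q2 t) (l : ℝ) (j : Fin 2) :
    IsEigenvalue Q j l ↔ LL (yy hP l 1) j = 0 := by
  have hy := sol_yy hP hQ hPq l
  have hy0 : yy hP l 0 = 1 := by rw [yy]; simp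
  constructor
  · rintro ⟨u, h1, ⟨x, hx, hux⟩, h0, h2⟩
    have h3 := vec_sub h1 hy (u 0 0)
    have h4 := sol_unique hP hQ hPq l h3 (by
      ext i
      fin_cases i
      · simp [hy0, LL_0]
      · simp [hy0, LL_1, h0])
    have hc : u 0 0 ≠ 0 := by
      intro hc
      have := h4 x hx
      simp only [hc, zero_smul, sub_zero] at this
      exact hux this
    have := congrFun (h4 1 (by simp)) j
    simp [h2] at this
    exact this.resolve_left hc
  · intro h
    refine ⟨_, hy, ⟨0, by simp, ?_⟩, ?_, h⟩
    · intro h'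
      have := congrFun h' 0
      simp [hy0, LL_0] at this
    · simp [hy0, LL_1]

lemma eig0 (hP : Integrable P)
    (hQ : ∀ x, Q x = !![(q1 x : ℂ), (q2 x : ℂ); (q2 x : ℂ), -(q1 x : ℂ)])
    (hPq : ∀ t ∈ Ioo (0:ℝ) 1, P t = q1 t + I * q2 t) (l : ℝ) :
    IsEigenvalue Q 0 l ↔ ∃ n : ℤ, th hP l 1 = Real.pi * n + Real.pi / 2 := by
  rw [eig_aux hP hQ hPq, LL_0]
  obtain ⟨r, h1, h2⟩ := yy_polar hP l (x := 1) (by simp)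
  rw [h2, Complex.ofReal_eq_zero, Complex.re_ofReal_mul, Complex.exp_ofReal_mul_I_re, mul_eq_zero,
    or_iff_right h1.ne', Real.cos_eq_zero_iff]
  refine exists_congr fun n => ?_
  constructor <;> intro h <;> rw [h] <;> ring

lemma eig1 (hP : Integrable P)
    (hQ : ∀ x, Q x = !![(q1 x : ℂ), (q2 x : ℂ); (q2 x : ℂ), -(q1 x : ℂ)])
    (hPq : ∀ t ∈ Ioo (0:ℝ) 1, P t = q1 t + I * q2 t) (l : ℝ) :
    IsEigenvalue Q 1 l ↔ ∃ n : ℤ, th hP l 1 = Real.pi * n := by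
  rw [eig_aux hP hQ hPq, LL_1]
  obtain ⟨r, h1, h2⟩ := yy_polar hP l (x := 1) (by simp)
  rw [h2, Complex.ofReal_eq_zero, Complex.im_ofReal_mul, Complex.exp_ofReal_mul_I_im, mul_eq_zero,
    or_iff_right h1.ne', Real.sin_eq_zero_iff]
  refine exists_congr fun n => ?_
  constructor <;> intro h
  · rw [← h]; ring
  · rw [h]; ring

end DP

namespace DP

open AddCircle

/-- the circle -/
abbrev T1 := AddCircle (1:ℝ)
/-- normalized Haar measure -/
abbrev nu : Measure T1 := haarAddCircle

lemma nu_eq : nu = (volume : Measure T1) := by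
  rw [volume_eq_smul_haarAddCircle]; simp

/-- representative in `(0,1]` -/
def rep (σ : T1) : ℝ := (AddCircle.measurableEquivIoc 1 0 σ : Ioc (0:ℝ) (0 + 1))

lemma rep_mem (σ : T1) : rep σ ∈ Ioc (0:ℝ) 1 := by
  have := (AddCircle.measurableEquivIoc 1 0 σ).2
  exact ⟨this.1, this.2.trans_eq (zero_add _)⟩

lemma rep_meas : Measurable rep :=
  measurable_subtype_coe.comp (AddCircle.measurableEquivIoc 1 0).measurable

lemma coe_rep (σ : T1) : (rep σ : T1) = σ :=
  (AddCircle.equivIoc 1 0).symm_apply_apply σ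

lemma rep_coe {x : ℝ} (hx : x ∈ Ioc (0:ℝ) 1) : rep (x : T1) = x := by
  have hx' : x ∈ Ioc (0:ℝ) (0+1) := by rwa [zero_add]
  exact AddCircle.equivIoc_coe_of_mem hx'

lemma mk_mp : MeasurePreserving (fun x : ℝ => (x : T1)) (volume.restrict (Ioc (0:ℝ) 1)) nu := by
  have := AddCircle.measurePreserving_mk 1 0
  rw [zero_add, ← nu_eq] at this
  exact this

lemma rep_mp : MeasurePreserving rep nu (volume.restrict (Ioc (0:ℝ) 1)) := by
  refine ⟨rep_meas, ?_⟩
  rw [← mk_mp.map_eq, Measure.map_map rep_meas mk_mp.measurable]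
  have : (rep ∘ fun x : ℝ => (x : T1)) =ᵐ[volume.restrict (Ioc (0:ℝ) 1)] id := by
    refine ae_restrict_of_forall_mem measurableSet_Ioc fun x hx => rep_coe hx
  rw [Measure.map_congr this, Measure.map_id]

lemma integral_nu {E : Type*} [NormedAddCommGroup E] [NormedSpace ℝ E] (f : T1 → E) :
    ∫ σ, f σ ∂nu = ∫ x in (0:ℝ)..1, f (x : T1) := by
  have := AddCircle.intervalIntegral_preimage 1 0 f
  rw [zero_add] at this
  rw [this, nu_eq]

instance : NullSingletonClass nu := by
  refine ⟨fun σ => ?_⟩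
  have h1 : {σ} ⊆ rep ⁻¹' {rep σ} := by simp
  refine measure_mono_null h1 ?_
  rw [rep_mp.measure_preimage (measurableSet_singleton _).nullMeasurableSet]
  simp


section toolkit
variable (p : ℝ≥0∞) [Fact (1 ≤ p)]

/-- the base space -/
abbrev EE := Lp ℂ p nu

/-- contractive multipliers -/
def Wt := {w : T1 → ℂ // Measurable w ∧ ∀ σ, ‖w σ‖ ≤ 1}

variable {p}

lemma mul_memLp (w : Wt) {f : T1 → ℂ} (hf : MemLp f p nu) : MemLp (fun σ => w.1 σ * f σ) p nu := by
  refine hf.mono (w.2.1.aestronglyMeasurable.mul hf.1) (Eventually.of_forall fun σ => ?_)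
  rw [norm_mul]
  have := w.2.2 σ
  have h := norm_nonneg (f σ)
  nlinarith

/-- multiplication operator -/
def mulOp (w : Wt) : EE p →L[ℂ] EE p :=
  LinearMap.mkContinuous
    { toFun := fun f => (mul_memLp w (Lp.memLp f)).toLp _
      map_add' := fun f g => by
        rw [← MemLp.toLp_add]
        apply MemLp.toLp_congr
        filter_upwards [Lp.coeFn_add f g] with σ h
        simp only [h, Pi.add_apply]; ring
      map_smul' := fun c f => by
        rw [RingHom.id_apply, ← MemLp.toLp_const_smul]
        apply MemLp.toLp_congr
        filter_upwards [Lp.coeFn_smul c f] with σ h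
        simp only [h, Pi.smul_apply, smul_eq_mul]; ring } 1 fun f => by
    rw [one_mul]
    apply Lp.norm_le_norm_of_ae_le
    filter_upwards [(mul_memLp w (Lp.memLp f)).coeFn_toLp] with σ h
    simp only [LinearMap.coe_mk, AddHom.coe_mk]
    rw [h, norm_mul]
    have := w.2.2 σ
    have h := norm_nonneg (f σ)
    nlinarith

lemma mulOp_ae (w : Wt) (f : EE p) : mulOp w f =ᵐ[nu] fun σ => w.1 σ * f σ :=
  (mul_memLp w (Lp.memLp f)).coeFn_toLp

lemma mulOp_norm (w : Wt) (f : EE p) : ‖mulOp w f‖ ≤ ‖f‖ := by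
  have := (mulOp w).le_of_opNorm_le (LinearMap.mkContinuous_norm_le _ zero_le_one _) f
  rwa [one_mul] at this

lemma EE_int (f : EE p) : Integrable f nu := (Lp.memLp f).integrable (Fact.out : 1 ≤ p)

lemma EE_l1 (f : EE p) : ∫ σ, ‖f σ‖ ∂nu ≤ ‖f‖ := by
  rw [integral_norm_eq_lintegral_enorm (EE_int f).1, ← eLpNorm_one_eq_lintegral_enorm, Lp.norm_def]
  exact ENNReal.toReal_mono (Lp.eLpNorm_ne_top f)
    (eLpNorm_le_eLpNorm_of_exponent_le (Fact.out : 1 ≤ p) (EE_int f).1)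

variable (p) in
/-- integration functional -/
def I0 : EE p →L[ℂ] ℂ :=
  LinearMap.mkContinuous
    { toFun := fun f => ∫ σ, f σ ∂nu
      map_add' := fun f g => by
        rw [← integral_add (EE_int f) (EE_int g)]
        exact integral_congr_ae (Lp.coeFn_add f g)
      map_smul' := fun c f => by
        rw [RingHom.id_apply, smul_eq_mul, ← integral_const_mul]
        exact integral_congr_ae (Lp.coeFn_smul c f) } 1 fun f => by
    rw [one_mul]
    exact (norm_integral_le_integral_norm _).trans (EE_l1 f)

lemma I0_apply (f : EE p) : I0 p f = ∫ σ, f σ ∂nu := rfl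

lemma I0_norm (f : EE p) : ‖I0 p f‖ ≤ ‖f‖ := (norm_integral_le_integral_norm _).trans (EE_l1 f)

/-- exponential multiplier -/
def wph (l : ℝ) : Wt := ⟨fun σ => ph (l * rep σ),
  ph_cont.measurable.comp (rep_meas.const_mul l), fun σ => (ph_norm _).le⟩

variable (p) in
/-- the functionals -/
def ell (l : ℝ) : EE p →L[ℂ] ℂ := (I0 p).comp (mulOp (wph l))

lemma ell_apply (l : ℝ) (f : EE p) : ell p l f = ∫ σ, ph (l * rep σ) * f σ ∂nu := by
  rw [ell, ContinuousLinearMap.comp_apply, I0_apply]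
  exact integral_congr_ae (mulOp_ae _ f)

lemma ell_norm (l : ℝ) (f : EE p) : ‖ell p l f‖ ≤ ‖f‖ :=
  (I0_norm _).trans (mulOp_norm _ _)

variable (p) in
/-- Fourier coefficients -/
def en (n : ℤ) : EE p →L[ℂ] ℂ := ell p (Real.pi * n)

lemma en_norm (n : ℤ) (f : EE p) : ‖en p n f‖ ≤ ‖f‖ := ell_norm _ f

lemma fourier_rep (n : ℤ) (σ : T1) : ph (Real.pi * n * rep σ) = fourier (-n) σ := by
  conv_rhs => rw [← coe_rep σ]
  rw [fourier_coe_apply, ph]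
  congr 1
  push_cast; ring

lemma en_eq_fourierCoeff (n : ℤ) (f : EE p) : en p n f = fourierCoeff f n := by
  rw [en, ell_apply, fourierCoeff]
  simp only [fourier_rep, smul_eq_mul]

lemma en_fourierLp (n m : ℤ) : en p n (fourierLp p m) = if m = n then 1 else 0 := by
  rw [en_eq_fourierCoeff, fourierCoeff_congr_ae (coeFn_fourierLp p m)]
  rw [fourierCoeff_fourier, Pi.single_apply]
  simp only [eq_comm]

/-- every element is a finite trigonometric correction away from a small element -/
lemma small_tail (hp : p ≠ ∞) (d : EE p) {ε : ℝ} (hε : 0 < ε) :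
    ∃ d' : EE p, ‖d'‖ ≤ ε ∧ {n : ℤ | en p n d' ≠ en p n d}.Finite := by
  have h := span_fourierLp_closure_eq_top (T := 1) hp
  have hd : d ∈ (Submodule.span ℂ (range (@fourierLp 1 _ p _))).topologicalClosure := by
    rw [h]; trivial
  obtain ⟨t, ht, hdt⟩ := Metric.mem_closure_iff.1 hd ε hε
  refine ⟨d - t, by rw [← dist_eq_norm]; exact hdt.le, ?_⟩
  simp only [map_sub, ne_eq, sub_eq_self]
  change t ∈ Submodule.span ℂ (range (@fourierLp 1 _ p _)) at ht
  clear hdt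
  induction ht using Submodule.span_induction with
  | mem x hx =>
    obtain ⟨m, rfl⟩ := hx
    refine (finite_singleton m).subset fun n hn => ?_
    by_contra h
    apply hn
    rw [en_fourierLp, if_neg (fun h' => h h'.symm)]
  | zero => simp
  | add x y _ _ hx hy =>
    refine (hx.union hy).subset fun n hn => ?_
    by_contra h
    simp only [mem_union, mem_setOf_eq, not_or, not_not] at h
    apply hn
    rw [map_add, h.1, h.2, add_zero]
  | smul c x _ hx =>
    refine hx.subset fun n hn h => hn ?_
    rw [map_smul, h, smul_zero]

end toolkit

end DP

namespace DP

open AddCircle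

section toolkit2
variable {p : ℝ≥0∞} [Fact (1 ≤ p)]

lemma sub_left_mp (t : T1) : MeasurePreserving (fun σ : T1 => t - σ) nu nu :=
  Measure.measurePreserving_sub_left nu t

lemma sub_right_mp (t : T1) : MeasurePreserving (fun σ : T1 => σ - t) nu nu :=
  measurePreserving_sub_right nu t

/-- conjugation on `EE` -/
def cjL : EE p →L[ℝ] EE p := (Complex.conjCLE : ℂ →L[ℝ] ℂ).compLpL p nu

lemma cjL_ae (f : EE p) : cjL f =ᵐ[nu] fun σ => (starRingEnd ℂ) (f σ) :=
  ContinuousLinearMap.coeFn_compLpL _ f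

lemma cjL_norm (f : EE p) : ‖cjL f‖ ≤ ‖f‖ := by
  apply Lp.norm_le_norm_of_ae_le
  filter_upwards [cjL_ae f] with σ h
  rw [h]; simp

/-- reflected conjugate -/
def RR (t : ℝ) (f : EE p) : EE p :=
  cjL (Lp.compMeasurePreserving (fun σ : T1 => (t : T1) - σ) (sub_left_mp t) f)

lemma RR_ae (t : ℝ) (f : EE p) : RR t f =ᵐ[nu] fun σ => (starRingEnd ℂ) (f ((t : T1) - σ)) := by
  filter_upwards [cjL_ae (Lp.compMeasurePreserving (fun σ : T1 => (t : T1) - σ) (sub_left_mp t) f),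
    Lp.coeFn_compMeasurePreserving f (sub_left_mp t)] with σ h1 h2
  rw [RR, h1, h2]; rfl

lemma RR_sub (t : ℝ) (f g : EE p) : RR t (f - g) = RR t f - RR t g := by
  rw [RR, map_sub, map_sub]; rfl

lemma RR_norm (t : ℝ) (f : EE p) : ‖RR t f‖ ≤ ‖f‖ :=
  (cjL_norm _).trans (Lp.norm_compMeasurePreserving _ _).le

lemma RR_cont (hp : p ≠ ∞) {f : ℝ → EE p} (hf : Continuous f) : Continuous (fun t => RR t (f t)) := by
  refine cjL.continuous.comp ?_
  let g : ℝ → C(T1, T1) := fun t => ⟨fun σ => (t : T1) - σ, by fun_prop⟩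
  have hg : Continuous g := by
    refine ContinuousMap.continuous_of_continuous_uncurry _ ?_
    change Continuous (fun q : ℝ × T1 => ((q.1 : ℝ) : T1) - q.2)
    exact ((AddCircle.continuous_mk' 1).comp continuous_fst).sub continuous_snd
  exact hf.compMeasurePreservingLp hg (fun t => sub_left_mp t) hp

/-- translation -/
def tr (t : T1) (f : EE p) : EE p :=
  Lp.compMeasurePreserving (fun σ : T1 => σ - t) (sub_right_mp t) f

lemma tr_ae (t : T1) (f : EE p) : tr t f =ᵐ[nu] fun σ => f (σ - t) :=
  Lp.coeFn_compMeasurePreserving f (sub_right_mp t)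

lemma tr_norm (t : T1) (f : EE p) : ‖tr t f‖ = ‖f‖ := Lp.norm_compMeasurePreserving _ _

lemma tr_add (t : T1) (f g : EE p) : tr t (f + g) = tr t f + tr t g := map_add _ f g

lemma tr_smul (t : T1) (c : ℂ) (f : EE p) : tr t (c • f) = c • tr t f :=
  (Lp.compMeasurePreservingₗ ℂ _ (sub_right_mp t)).map_smul c f

lemma tr_cont (hp : p ≠ ∞) (f : EE p) : Continuous (fun t => tr t f) := by
  let g : T1 → C(T1, T1) := fun t => ⟨fun σ => σ - t, by fun_prop⟩
  have hg : Continuous g := by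
    refine ContinuousMap.continuous_of_continuous_uncurry _ ?_
    change Continuous (fun q : T1 × T1 => q.2 - q.1)
    fun_prop
  exact (continuous_const (y := f)).compMeasurePreservingLp hg (fun t => sub_right_mp t) hp

lemma en_tr (n : ℤ) (t : T1) (f : EE p) : en p n (tr t f) = fourier (-n) t * en p n f := by
  rw [en_eq_fourierCoeff, en_eq_fourierCoeff, fourierCoeff_congr_ae (tr_ae t f), fourierCoeff,
    fourierCoeff, ← integral_const_mul]
  rw [← (measurePreserving_sub_right nu t).integral_comp (MeasurableEquiv.subRight t).measurableEmbedding
    (fun σ => fourier (-n) t * fourier (-n) σ • f σ)]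
  congr 1; ext σ
  simp only [smul_eq_mul]
  rw [← mul_assoc]
  congr 1
  rw [fourier_apply, fourier_apply, fourier_apply, ← Circle.coe_mul, ← toCircle_add, ← smul_add]
  congr 3; abel

lemma conv_int (hp : p ≠ ∞) (f g : EE p) : Integrable (fun t => f t • tr t g) nu := by
  refine (EE_int f).smul_bdd ‖g‖ ?_ ?_
  · exact (tr_cont hp g).aestronglyMeasurable
  · exact Eventually.of_forall fun t => (tr_norm t g).le

lemma conv_bound (f g : EE p) : ‖∫ t, f t • tr t g ∂nu‖ ≤ 1 * ‖f‖ * ‖g‖ := by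
  refine (norm_integral_le_integral_norm _).trans ?_
  simp only [norm_smul, tr_norm]
  rw [integral_mul_const, one_mul]
  gcongr
  exact EE_l1 f

/-- convolution -/
def conv (hp : p ≠ ∞) : EE p →L[ℂ] EE p →L[ℂ] EE p :=
  LinearMap.mkContinuous₂ (LinearMap.mk₂ ℂ (fun f g : EE p => ∫ t, f t • tr t g ∂nu)
    (fun f f' g => by
      rw [← integral_add (conv_int hp _ _) (conv_int hp _ _)]
      apply integral_congr_ae
      filter_upwards [Lp.coeFn_add f f'] with t h
      rw [h, Pi.add_apply, add_smul])
    (fun c f g => by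
      rw [← integral_smul]
      apply integral_congr_ae
      filter_upwards [Lp.coeFn_smul c f] with t h
      rw [h, Pi.smul_apply, smul_eq_mul, mul_smul])
    (fun f g g' => by
      rw [← integral_add (conv_int hp _ _) (conv_int hp _ _)]
      simp only [tr_add, smul_add])
    (fun c f g => by
      rw [← integral_smul]
      simp only [tr_smul, smul_comm c])) 1 (fun f g => conv_bound f g)

lemma conv_apply (hp : p ≠ ∞) (f g : EE p) : conv hp f g = ∫ t, f t • tr t g ∂nu := rfl

lemma conv_norm (hp : p ≠ ∞) (f g : EE p) : ‖conv hp f g‖ ≤ ‖f‖ * ‖g‖ := by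
  have := conv_bound f g; rwa [one_mul] at this

lemma en_conv (hp : p ≠ ∞) (n : ℤ) (f g : EE p) :
    en p n (conv hp f g) = en p n f * en p n g := by
  rw [conv_apply, ← ContinuousLinearMap.integral_comp_comm _ (conv_int hp f g)]
  simp only [map_smul, en_tr, smul_eq_mul]
  rw [en_eq_fourierCoeff n f, fourierCoeff, ← integral_mul_const]
  congr 1; ext t
  rw [smul_eq_mul]; ring

end toolkit2
end DP

namespace DP

section fixedpoint

variable {E : Type*} [NormedAddCommGroup E] [NormedSpace ℂ E]

/-- the terms of the nonlinear map -/
def fterm (M : E →L[ℂ] E →L[ℂ] E) (c : ℕ → ℂ) (d : ℕ → E) (g : E) (j : ℕ) : E :=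
  ((M g) ^ j) (d j + c (j + 1) • g)

lemma pow_lip {A : Type*} [NormedRing A] [NormOneClass A] {a b : A} {R : ℝ} (ha : ‖a‖ ≤ R) (hb : ‖b‖ ≤ R) (j : ℕ) :
    ‖a ^ (j + 1) - b ^ (j + 1)‖ ≤ (j + 1) * R ^ j * ‖a - b‖ := by
  have hR : 0 ≤ R := (norm_nonneg a).trans ha
  induction j with
  | zero => simp
  | succ j ih =>
    have h1 : a ^ (j + 1 + 1) - b ^ (j + 1 + 1) =
        a * (a ^ (j + 1) - b ^ (j + 1)) + (a - b) * b ^ (j + 1) := by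
      rw [pow_succ' a (j + 1), pow_succ' b (j + 1), mul_sub, sub_mul]; abel
    rw [h1]
    have h2 : ‖b ^ (j + 1)‖ ≤ R ^ (j + 1) := (norm_pow_le _ _).trans (by gcongr)
    calc _ ≤ ‖a‖ * ‖a ^ (j + 1) - b ^ (j + 1)‖ + ‖a - b‖ * ‖b ^ (j + 1)‖ :=
          (norm_add_le _ _).trans (add_le_add (norm_mul_le _ _) (norm_mul_le _ _))
      _ ≤ R * ((j + 1) * R ^ j * ‖a - b‖) + ‖a - b‖ * R ^ (j + 1) := by gcongr
      _ = _ := by push_cast; ring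

variable {M : E →L[ℂ] E →L[ℂ] E} {c : ℕ → ℂ} {d : ℕ → E} {C R ε : ℝ}

lemma fterm_lip (hM : ∀ f g, ‖M f g‖ ≤ ‖f‖ * ‖g‖) (hc1 : c 1 = 0) (hC : 0 ≤ C)
    (hc : ∀ j, ‖c j‖ ≤ C) (hd : ∀ j, ‖d j‖ ≤ C) (hd1 : ‖d 1‖ ≤ ε) (hR0 : 0 ≤ R)
    (hR : R ≤ 1 / 4) (hRC : 400 * C * R ≤ 1) (hε : 40 * ε ≤ 1) {g h : E} (hg : ‖g‖ ≤ R)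
    (hh : ‖h‖ ≤ R) (j : ℕ) :
    ‖fterm M c d g j - fterm M c d h j‖ ≤ 1 / 4 * (1 / 2) ^ j * ‖g - h‖ := by
  have hMn : ∀ f, ‖M f‖ ≤ ‖f‖ := fun f =>
    ContinuousLinearMap.opNorm_le_bound _ (norm_nonneg _) (hM f)
  have hgh : ‖M g - M h‖ ≤ ‖g - h‖ := by rw [← map_sub]; exact hMn _
  rcases j with _ | j
  · simp [fterm, hc1]
  have hap : ∀ (a b : E →L[ℂ] E) (i : ℕ) (v : E), ‖(a ^ (i+1) - b ^ (i+1)) v‖ ≤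
      ‖a ^ (i+1) - b ^ (i+1)‖ * ‖v‖ := fun a b i v => ContinuousLinearMap.le_opNorm _ _
  have e : fterm M c d g (j + 1) - fterm M c d h (j + 1) =
      ((M g) ^ (j + 1) - (M h) ^ (j + 1)) (d (j + 1) + c (j + 2) • g) +
        ((M h) ^ (j + 1)) (c (j + 2) • (g - h)) := by
    simp only [fterm, sub_apply, map_add, smul_sub, map_sub]
    abel
  have n1 : ‖(M g) ^ (j + 1) - (M h) ^ (j + 1)‖ ≤ (j + 1) * R ^ j * ‖g - h‖ := by
    rcases subsingleton_or_nontrivial E with hs | hs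
    · have : (M g) ^ (j + 1) = (M h) ^ (j + 1) := by
        ext v; exact Subsingleton.elim _ _
      rw [this, sub_self, norm_zero]; positivity
    · refine (pow_lip ((hMn g).trans hg) ((hMn h).trans hh) j).trans ?_
      gcongr
  have n2 : ‖((M h) ^ (j + 1)) (c (j + 2) • (g - h))‖ ≤ R ^ (j + 1) * (C * ‖g - h‖) := by
    have : ∀ i v, ‖((M h) ^ i) v‖ ≤ R ^ i * ‖v‖ := by
      intro i
      induction i with
      | zero => intro v; simp
      | succ i ih =>
        intro v
        rw [pow_succ']
        change ‖M h ((M h ^ i) v)‖ ≤ _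
        refine (hM _ _).trans ?_
        calc _ ≤ R * (R ^ i * ‖v‖) := mul_le_mul hh (ih v) (norm_nonneg _) hR0
          _ = _ := by ring
    refine (this _ _).trans ?_
    rw [norm_smul]
    gcongr
    exact hc _
  have n3 : ‖d (j + 1) + c (j + 2) • g‖ ≤ ‖d (j + 1)‖ + C * R := by
    refine (norm_add_le _ _).trans ?_
    rw [norm_smul]
    gcongr
    exact hc _
  have key : (j + 1) * R ^ j * (‖d (j + 1)‖ + C * R) + R ^ (j + 1) * C ≤
      1 / 4 * (1 / 2) ^ (j + 1) := by
    rcases j with _ | j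
    · simp; nlinarith
    · have hd2 := hd (j + 2)
      have h2 : R ^ j ≤ (1 / 4) ^ j := by gcongr
      have h3 : ((j : ℝ) + 2) * (1 / 4) ^ j ≤ 4 * (1 / 2) ^ j := by
        have h4 : ((j : ℝ) + 2) ≤ 4 * 2 ^ j := by
          have : j + 1 ≤ 2 ^ j := Nat.lt_two_pow_self
          have : ((j + 1 : ℕ) : ℝ) ≤ ((2 ^ j : ℕ) : ℝ) := by exact_mod_cast this
          push_cast at this
          linarith
        have h5 : (1 / 4 : ℝ) ^ j = (1 / 2) ^ j * (1 / 2) ^ j := by rw [← mul_pow]; norm_num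
        have h6 : (2 : ℝ) ^ j * (1 / 2) ^ j = 1 := by rw [← mul_pow]; norm_num
        calc _ ≤ (4 * 2 ^ j) * ((1 / 2 : ℝ) ^ j * (1 / 2) ^ j) := by rw [h5]; gcongr
          _ = 4 * (2 ^ j * (1 / 2) ^ j) * (1 / 2) ^ j := by ring
          _ = _ := by rw [h6]; ring
      have h7 : R ^ j ≤ (1 / 2) ^ j := h2.trans (by gcongr; norm_num)
      have hX : (0:ℝ) ≤ (1 / 2) ^ j := by positivity
      have h8 : ((j : ℝ) + 2) * R ^ j ≤ 4 * (1 / 2) ^ j := le_trans (by gcongr) h3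
      calc (((j + 1 : ℕ) : ℝ) + 1) * R ^ (j + 1) * (‖d (j + 1 + 1)‖ + C * R) + R ^ (j + 1 + 1) * C
          ≤ (((j + 1 : ℕ) : ℝ) + 1) * R ^ (j + 1) * (C + C * (1 / 4)) + R ^ (j + 1 + 1) * C := by gcongr
        _ = (((j : ℝ) + 2) * R ^ j) * (R * (C * (5 / 4))) + (R ^ j) * (R * C * R) := by
            push_cast; ring
        _ ≤ (4 * (1 / 2) ^ j) * (R * (C * (5 / 4))) + ((1 / 2) ^ j) * (R * C * (1 / 4)) := by
            gcongr
        _ = (1 / 2) ^ j * ((C * R) * (21 / 4)) := by ring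
        _ ≤ (1 / 2) ^ j * (1 / 16) := by gcongr; nlinarith
        _ = _ := by ring
  rw [e]
  calc _ ≤ (j + 1) * R ^ j * ‖g - h‖ * (‖d (j + 1)‖ + C * R) + R ^ (j + 1) * (C * ‖g - h‖) := by
        refine (norm_add_le _ _).trans (add_le_add ((hap _ _ _ _).trans ?_) n2)
        gcongr
    _ = ((j + 1) * R ^ j * (‖d (j + 1)‖ + C * R) + R ^ (j + 1) * C) * ‖g - h‖ := by ring
    _ ≤ _ := by gcongr

lemma fterm_zero (j : ℕ) : fterm M c d 0 j = if j = 0 then d 0 else 0 := by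
  rcases j with _ | j
  · simp [fterm]
  · simp [fterm, pow_succ]

lemma fterm_summable [CompleteSpace E] (hM : ∀ f g, ‖M f g‖ ≤ ‖f‖ * ‖g‖) (hc1 : c 1 = 0) (hC : 0 ≤ C)
    (hc : ∀ j, ‖c j‖ ≤ C) (hd : ∀ j, ‖d j‖ ≤ C) (hd1 : ‖d 1‖ ≤ ε) (hR0 : 0 ≤ R)
    (hR : R ≤ 1 / 4) (hRC : 400 * C * R ≤ 1) (hε : 40 * ε ≤ 1) {g : E} (hg : ‖g‖ ≤ R) :
    Summable (fterm M c d g) := by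
  have h0 : Summable (fterm M c d 0) := by
    apply summable_of_ne_finset_zero (s := {0})
    intro j hj
    rw [fterm_zero, if_neg (by simpa using hj)]
  have h1 : Summable (fun j => fterm M c d g j - fterm M c d 0 j) := by
    refine Summable.of_norm_bounded (g := fun j => 1 / 4 * (1 / 2 : ℝ) ^ j * ‖g - 0‖) ?_
      (fun j => fterm_lip hM hc1 hC hc hd hd1 hR0 hR hRC hε hg (by simpa using hR0) j)
    exact (summable_geometric_two.mul_left (1 / 4 : ℝ)).mul_right _
  simpa using h1.add h0

lemma fmap_lip [CompleteSpace E] (hM : ∀ f g, ‖M f g‖ ≤ ‖f‖ * ‖g‖) (hc1 : c 1 = 0) (hC : 0 ≤ C)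
    (hc : ∀ j, ‖c j‖ ≤ C) (hd : ∀ j, ‖d j‖ ≤ C) (hd1 : ‖d 1‖ ≤ ε) (hR0 : 0 ≤ R)
    (hR : R ≤ 1 / 4) (hRC : 400 * C * R ≤ 1) (hε : 40 * ε ≤ 1) {g h : E} (hg : ‖g‖ ≤ R)
    (hh : ‖h‖ ≤ R) :
    ‖∑' j, fterm M c d g j - ∑' j, fterm M c d h j‖ ≤ 1 / 2 * ‖g - h‖ := by
  have sg := fterm_summable hM hc1 hC hc hd hd1 hR0 hR hRC hε hg
  have sh := fterm_summable hM hc1 hC hc hd hd1 hR0 hR hRC hε hh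
  rw [← sg.tsum_sub sh]
  have h2 : HasSum (fun j => 1 / 4 * (1 / 2 : ℝ) ^ j * ‖g - h‖) (1 / 4 * 2 * ‖g - h‖) :=
    (hasSum_geometric_two.mul_left (1 / 4 : ℝ)).mul_right _
  refine (tsum_of_norm_bounded h2 fun j =>
    fterm_lip hM hc1 hC hc hd hd1 hR0 hR hRC hε hg hh j).trans ?_
  exact le_of_eq (by ring)

lemma fmap_fixed [CompleteSpace E] (hM : ∀ f g, ‖M f g‖ ≤ ‖f‖ * ‖g‖) (hc1 : c 1 = 0) (hC : 0 ≤ C)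
    (hc : ∀ j, ‖c j‖ ≤ C) (hd : ∀ j, ‖d j‖ ≤ C) (hd1 : ‖d 1‖ ≤ ε) (hR0 : 0 ≤ R)
    (hR : R ≤ 1 / 4) (hRC : 400 * C * R ≤ 1) (hε : 40 * ε ≤ 1) (hd0 : ‖d 0‖ ≤ R / 2) :
    ∃ g : E, ‖g‖ ≤ R ∧ ∑' j, fterm M c d g j = g := by
  have hT0 : ∑' j, fterm M c d 0 j = d 0 := by
    rw [tsum_eq_single 0 (fun j hj => by rw [fterm_zero, if_neg hj]), fterm_zero, if_pos rfl]
  have hmaps : MapsTo (fun g => ∑' j, fterm M c d g j) (Metric.closedBall (0:E) R)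
      (Metric.closedBall (0:E) R) := by
    intro g hg
    rw [mem_closedBall_zero_iff] at hg ⊢
    have h1 := fmap_lip hM hc1 hC hc hd hd1 hR0 hR hRC hε hg (h := 0) (by simpa using hR0)
    rw [hT0, sub_zero] at h1
    have h2 := norm_le_norm_sub_add (∑' j, fterm M c d g j) (d 0)
    linarith
  have hcontr : ContractingWith (1 / 2) (hmaps.restrict _ _ _) := by
    refine ⟨by norm_num, LipschitzWith.of_dist_le_mul fun g h => ?_⟩
    rw [Subtype.dist_eq, Subtype.dist_eq, dist_eq_norm, dist_eq_norm]
    have := fmap_lip hM hc1 hC hc hd hd1 hR0 hR hRC hε (mem_closedBall_zero_iff.1 g.2)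
      (mem_closedBall_zero_iff.1 h.2)
    simpa using this
  obtain ⟨g, hg, h1, -⟩ := hcontr.exists_fixedPoint' Metric.isClosed_closedBall.isComplete hmaps
    (x := 0) (by simpa using hR0) (edist_ne_top _ _)
  exact ⟨g, mem_closedBall_zero_iff.1 hg, h1⟩

end fixedpoint

lemma fixed_main {E : Type*} [NormedAddCommGroup E] [NormedSpace ℂ E] [CompleteSpace E]
    (M : E →L[ℂ] E →L[ℂ] E) (hM : ∀ f g, ‖M f g‖ ≤ ‖f‖ * ‖g‖) (e : ℤ → E →L[ℂ] ℂ)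
    (he : ∀ n f, ‖e n f‖ ≤ ‖f‖) (hem : ∀ n f g, e n (M f g) = e n f * e n g)
    (hsm : ∀ (f : E) (ε : ℝ), 0 < ε → ∃ f', ‖f'‖ ≤ ε ∧ {n | e n f' ≠ e n f}.Finite)
    (δ : ℤ → E) (hδ : ∀ n m, e n (δ m) = if m = n then 1 else 0)
    (c : ℕ → ℂ) (d : ℕ → E) (C : ℝ) (hc0 : c 0 = 0) (hc1 : c 1 = 0)
    (hc : ∀ j, ‖c j‖ ≤ C) (hd : ∀ j, ‖d j‖ ≤ C) (s : ℤ → ℂ) (hs : Tendsto s cofinite (nhds 0))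
    (hss : ∀ n, HasSum (fun j => (c j + e n (d j)) * s n ^ j) (s n)) :
    ∃ g : E, ∀ n, s n = e n g := by
  have hC : 0 ≤ C := (norm_nonneg _).trans (hc 0)
  obtain ⟨R, hR0, hR, hRC⟩ : ∃ R : ℝ, 0 < R ∧ R ≤ 1 / 4 ∧ 400 * (C + 1) * R ≤ 1 := by
    refine ⟨1 / (400 * (C + 1)), by positivity, ?_, ?_⟩
    · rw [div_le_div_iff₀ (by positivity) (by norm_num)]; nlinarith
    · rw [mul_one_div_cancel (by positivity)]
  set ε := R / 40 with hε
  obtain ⟨d0, h01, h02⟩ := hsm (d 0) ε (by positivity)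
  obtain ⟨d1, h11, h12⟩ := hsm (d 1) ε (by positivity)
  set d' : ℕ → E := fun j => if j = 0 then d0 else if j = 1 then d1 else d j with hd'
  have hd'0 : d' 0 = d0 := rfl
  have hd'1 : d' 1 = d1 := rfl
  have hd'C : ∀ j, ‖d' j‖ ≤ C + 1 := by
    intro j
    simp only [hd']
    split_ifs
    · linarith
    · linarith
    · linarith [hd j]
  have hcC : ∀ j, ‖c j‖ ≤ C + 1 := fun j => (hc j).trans (by linarith)
  have hC1 : 0 ≤ C + 1 := by linarith
  obtain ⟨g, hgR, hg⟩ := fmap_fixed hM hc1 hC1 hcC hd'C (ε := ε) h11 hR0.le hR hRC (by linarith)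
    (by rw [hd'0]; linarith)
  have hfin : {n | s n ≠ e n g}.Finite := by
    have h3 : ∀ᶠ n in cofinite, ‖s n‖ < R := by
      have := hs.eventually (Metric.ball_mem_nhds 0 hR0)
      filter_upwards [this] with n hn
      simpa using hn
    have h4 : ∀ᶠ n in cofinite, e n d0 = e n (d 0) := by
      exact Filter.eventually_cofinite.2 h02
    have h5 : ∀ᶠ n in cofinite, e n d1 = e n (d 1) := by
      exact Filter.eventually_cofinite.2 h12
    have h6 : ∀ᶠ n in cofinite, s n = e n g := by
      filter_upwards [h3, h4, h5] with n a0 a1 a2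
      have hed : ∀ j, e n (d' j) = e n (d j) := by
        intro j
        simp only [hd']
        split_ifs with i1 i2
        · rw [a1, i1]
        · rw [a2, i2]
        · rfl
      set D : ℕ → ℂ := fun j => e n (d' j) with hD
      have hDC : ∀ j, ‖D j‖ ≤ C + 1 := fun j => (he _ _).trans (hd'C j)
      have hD1 : ‖D 1‖ ≤ ε := (he _ _).trans h11
      have hMm : ∀ f g : ℂ, ‖ContinuousLinearMap.mul ℂ ℂ f g‖ ≤ ‖f‖ * ‖g‖ := fun f g => by simp
      have hMp : ∀ (x v : ℂ) (j : ℕ), ((ContinuousLinearMap.mul ℂ ℂ x) ^ j) v = x ^ j * v := by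
        intro x v j
        induction j with
        | zero => simp
        | succ j ih =>
          rw [pow_succ']
          change x * ((ContinuousLinearMap.mul ℂ ℂ x ^ j) v) = _
          rw [ih]; ring
      have hegR : ‖e n g‖ ≤ R := (he _ _).trans hgR
      have f1 : ∑' j, fterm (ContinuousLinearMap.mul ℂ ℂ) c D (e n g) j = e n g := by
        have sg := fterm_summable hM hc1 hC1 hcC hd'C (ε := ε) h11 hR0.le hR hRC (by linarith) hgR
        have := (e n).map_tsum sg
        rw [hg] at this
        refine Eq.trans ?_ this.symm
        congr 1; ext j
        rw [fterm, fterm, hMp]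
        have hp : ∀ (j : ℕ) (v : E), e n ((M g ^ j) v) = e n g ^ j * e n v := by
          intro j
          induction j with
          | zero => intro v; simp
          | succ j ih =>
            intro v
            rw [pow_succ']
            change e n (M g ((M g ^ j) v)) = _
            rw [hem, ih]; ring
        rw [hp, map_add, map_smul, smul_eq_mul]
      have f2 : ∑' j, fterm (ContinuousLinearMap.mul ℂ ℂ) c D (s n) j = s n := by
        have hsl : ‖s n‖ < 1 := a0.trans_le (hR.trans (by norm_num))
        have gs : Summable (fun j : ℕ => (C + 1) * ‖s n‖ ^ j) :=
          (summable_geometric_of_lt_one (norm_nonneg _) hsl).mul_left _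
        have s1 : Summable (fun j => c j * s n ^ j) := by
          refine Summable.of_norm_bounded gs fun j => ?_
          rw [norm_mul, norm_pow]; gcongr; exact hcC j
        have s2 : Summable (fun j => D j * s n ^ j) := by
          refine Summable.of_norm_bounded gs fun j => ?_
          rw [norm_mul, norm_pow]; gcongr; exact hDC j
        have t1 : ∑' j, c j * s n ^ j = ∑' j, c (j + 1) * s n ^ (j + 1) := by
          rw [s1.tsum_eq_zero_add, hc0]; simp
        have s3 : Summable (fun j => c (j + 1) * s n ^ (j + 1)) := (summable_nat_add_iff 1).2 s1
        have t2 := (hss n).tsum_eq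
        simp only [← hed] at t2
        have t3 : ∑' j, (c j + e n (d' j)) * s n ^ j = ∑' j, c j * s n ^ j + ∑' j, D j * s n ^ j := by
          rw [← s1.tsum_add s2]; congr 1; ext j; simp only [hD]; ring
        have t4 : ∑' j, c j * s n ^ j + ∑' j, D j * s n ^ j = s n := by rw [← t3]; exact t2
        refine Eq.trans ?_ t4
        rw [t1, ← s3.tsum_add s2]
        congr 1; ext j
        rw [fterm, hMp, smul_eq_mul, pow_succ]; ring
      have f3 := fmap_lip (M := ContinuousLinearMap.mul ℂ ℂ) hMm hc1 hC1 hcC hDC hD1 hR0.le hR hRC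
        (by linarith) a0.le hegR
      rw [f1, f2] at f3
      have : ‖s n - e n g‖ = 0 := le_antisymm (by linarith) (norm_nonneg _)
      exact sub_eq_zero.1 (norm_eq_zero.1 this)
    exact Filter.eventually_cofinite.1 h6
  refine ⟨g + ∑ m ∈ hfin.toFinset, (s m - e m g) • δ m, fun n => ?_⟩
  rw [map_add, map_sum]
  simp only [map_smul, hδ, smul_eq_mul, mul_ite, mul_one, mul_zero, Finset.sum_ite_eq']
  split_ifs with h
  · ring
  · simp only [Finite.mem_toFinset] at h
    rw [add_zero]
    by_contra h'
    exact h h'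

end DP

namespace DP

open AddCircle

section kern
variable {p : ℝ≥0∞} [Fact (1 ≤ p)]

/-- cut-off multiplier -/
def wset (s : Set ℝ) (hs : MeasurableSet s) : Wt :=
  ⟨(rep ⁻¹' s).indicator 1, measurable_one.indicator (rep_meas hs), fun σ => by
    by_cases h : σ ∈ rep ⁻¹' s
    · rw [indicator_of_mem h]; simp
    · rw [indicator_of_notMem h]; simp⟩

lemma wset_ae (s : Set ℝ) (hs : MeasurableSet s) (f : EE p) :
    mulOp (wset s hs) f =ᵐ[nu] (rep ⁻¹' s).indicator f := by
  filter_upwards [mulOp_ae (wset s hs) f] with σ h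
  rw [h, wset]
  by_cases h : σ ∈ rep ⁻¹' s
  · simp only [indicator_of_mem h, Pi.one_apply, one_mul]
  · simp only [indicator_of_notMem h, zero_mul]

/-- subspaces of functions supported in `rep ≤ t` -/
def SS (p : ℝ≥0∞) [Fact (1 ≤ p)] (t : ℝ) : Set (EE p) := {f | mulOp (wset (Ioi t) measurableSet_Ioi) f = 0}

lemma mem_SS {t : ℝ} {f : EE p} : f ∈ SS p t ↔ ∀ᵐ σ ∂nu, t < rep σ → f σ = 0 := by
  rw [SS, mem_ofPred_eq, Lp.eq_zero_iff_ae_eq_zero]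
  constructor
  · intro h
    filter_upwards [h, wset_ae (Ioi t) measurableSet_Ioi f] with σ h1 h2 h3
    rw [h2, indicator_of_mem (by exact h3)] at h1
    exact h1
  · intro h
    filter_upwards [h, wset_ae (Ioi t) measurableSet_Ioi f] with σ h1 h2
    rw [h2]
    by_cases h3 : t < rep σ
    · rw [indicator_of_mem (by exact h3), h1 h3]; rfl
    · rw [indicator_of_notMem (by exact h3)]; rfl

lemma SS_mono {s t : ℝ} (h : s ≤ t) : SS p s ⊆ SS p t := by
  intro f hf
  rw [mem_SS] at hf ⊢
  filter_upwards [hf] with σ h1 h2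
  exact h1 (h.trans_lt h2)

lemma rep_ne (a : ℝ) : ∀ᵐ σ ∂nu, rep σ ≠ a := by
  have h : nu (rep ⁻¹' {a}) = 0 := by
    rw [rep_mp.measure_preimage (measurableSet_singleton _).nullMeasurableSet]
    simp
  rw [ae_iff]
  refine Eq.trans (congrArg nu ?_) h
  ext σ; simp

lemma rep_sub_lt {t : ℝ} (ht : t ∈ Icc (0:ℝ) 1) {σ : T1} (h : rep σ < t) :
    rep ((t : T1) - σ) = t - rep σ := by
  have h1 := rep_mem σ
  conv_lhs => rw [← coe_rep σ, ← AddCircle.coe_sub]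
  exact rep_coe ⟨by linarith, by linarith [h1.1, ht.2]⟩

lemma rep_sub_gt {t : ℝ} (ht : t ∈ Icc (0:ℝ) 1) {σ : T1} (h : t < rep σ) (h' : rep σ ≠ 1) :
    rep ((t : T1) - σ) = t - rep σ + 1 := by
  have h1 := rep_mem σ
  have h2 : rep σ < 1 := lt_of_le_of_ne h1.2 h'
  have : ((t - rep σ + 1 : ℝ) : T1) = (t : T1) - σ := by
    rw [AddCircle.coe_add, AddCircle.coe_sub, coe_rep]
    simp
  rw [← this]
  exact rep_coe ⟨by linarith [ht.1], by linarith [h1.1, ht.2]⟩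

lemma RR_mem {t : ℝ} (ht : t ∈ Icc (0:ℝ) 1) {f : EE p} (hf : f ∈ SS p t) : RR t f ∈ SS p t := by
  rw [mem_SS] at hf ⊢
  filter_upwards [(sub_left_mp (t : T1)).quasiMeasurePreserving.ae hf, RR_ae t f, rep_ne 1]
    with σ h1 h2 h3 h4
  rw [h2, h1, map_zero]
  rw [rep_sub_gt ht h4 h3]
  linarith [lt_of_le_of_ne (rep_mem σ).2 h3]

lemma ph_add (x y : ℝ) : ph (x + y) = ph x * ph y := by
  rw [ph, ph, ph, ← Complex.exp_add]; congr 1; push_cast; ring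

lemma ph_conj (x : ℝ) : (starRingEnd ℂ) (ph x) = ph (-x) := by
  rw [ph, ph, ← Complex.exp_conj]
  congr 1
  simp [show (starRingEnd ℂ) (2:ℂ) = 2 from map_ofNat _ 2]

lemma ell_RR {t : ℝ} (ht : t ∈ Icc (0:ℝ) 1) {f : EE p} (hf : f ∈ SS p t) (l : ℝ) :
    ell p l (RR t f) = ph (l * t) * (starRingEnd ℂ) (ell p l f) := by
  rw [ell_apply, ell_apply, ← integral_conj, ← integral_const_mul]
  have e1 : ∫ σ, ph (l * rep σ) * RR t f σ ∂nu =
      ∫ σ, (fun τ => ph (l * rep ((t : T1) - τ)) * (starRingEnd ℂ) (f τ)) ((t : T1) - σ) ∂nu := by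
    apply integral_congr_ae
    filter_upwards [RR_ae t f] with σ h
    simp only [h, sub_sub_cancel]
  rw [e1]
  refine ((sub_left_mp (t : T1)).integral_comp (MeasurableEquiv.subLeft (t : T1)).measurableEmbedding
    (fun τ => ph (l * rep ((t : T1) - τ)) * (starRingEnd ℂ) (f τ))).trans ?_
  apply integral_congr_ae
  rw [mem_SS] at hf
  filter_upwards [hf, rep_ne t] with σ h1 h2
  rcases lt_or_gt_of_ne h2 with h3 | h3
  · rw [rep_sub_lt ht h3, map_mul, ph_conj, ← mul_assoc, ← ph_add]
    congr 2; ring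
  · rw [h1 h3]; simp

lemma cut_cont (hp : p ≠ ∞) (f : EE p) :
    Continuous (fun x : ℝ => mulOp (wset (Iic x) measurableSet_Iic) f) := by
  rw [Metric.continuous_iff]
  intro x ε hε
  obtain ⟨δ, hδ, h⟩ := (Lp.memLp f).eLpNorm_indicator_le (Fact.out : 1 ≤ p) hp (half_pos hε)
  refine ⟨δ, hδ, fun y hy => ?_⟩
  rw [dist_eq_norm, Lp.norm_def]
  set s := rep ⁻¹' (uIoc x y) with hs
  have h1 : eLpNorm (mulOp (wset (Iic y) measurableSet_Iic) f - mulOp (wset (Iic x) measurableSet_Iic) f : EE p) p nu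
      ≤ eLpNorm (s.indicator f) p nu := by
    apply eLpNorm_mono_ae
    filter_upwards [Lp.coeFn_sub (mulOp (wset (Iic y) measurableSet_Iic) f)
      (mulOp (wset (Iic x) measurableSet_Iic) f), wset_ae (Iic x) measurableSet_Iic f,
      wset_ae (Iic y) measurableSet_Iic f] with σ a1 a2 a3
    rw [a1, Pi.sub_apply, a2, a3]
    simp only [indicator, hs, mem_preimage, mem_Iic, mem_uIoc]
    split_ifs <;> first | (simp; done) | (exfalso; grind)
  have h2 : nu s ≤ ENNReal.ofReal δ := by
    rw [hs, rep_mp.measure_preimage measurableSet_uIoc.nullMeasurableSet]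
    refine (Measure.restrict_apply_le _ _).trans ?_
    rw [Real.volume_uIoc]
    apply ENNReal.ofReal_le_ofReal
    rw [← Real.dist_eq]; exact hy.le
  have h3 := h1.trans (h s (rep_meas measurableSet_uIoc) h2)
  calc _ ≤ (ENNReal.ofReal (ε / 2)).toReal := ENNReal.toReal_mono ENNReal.ofReal_ne_top h3
    _ = ε / 2 := ENNReal.toReal_ofReal (half_pos hε).le
    _ < ε := half_lt_self hε

variable {P : ℝ → ℂ}

lemma smul_int (hP : Integrable P) (hP0 : ∀ t, t ∉ Ioo (0:ℝ) 1 → P t = 0) {E : Type*} [NormedAddCommGroup E]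
    [NormedSpace ℂ E] {g : ℝ → E} (hg : Continuous g) : Integrable (fun t => P t • g t) := by
  set c : ℝ → ℝ := fun t => (projIcc (0:ℝ) 1 zero_le_one t : ℝ)
  have hc : Continuous c := continuous_subtype_val.comp continuous_projIcc
  obtain ⟨C, hC⟩ := isCompact_Icc.exists_bound_of_continuousOn (hg.continuousOn (s := Icc (0:ℝ) 1))
  have h1 : Integrable (fun t => P t • g (c t)) :=
    hP.smul_bdd C (hg.comp hc).aestronglyMeasurable
      (Eventually.of_forall fun t => hC _ (projIcc (0:ℝ) 1 zero_le_one t).2)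
  refine h1.congr (Eventually.of_forall fun t => ?_)
  by_cases ht : t ∈ Ioo (0:ℝ) 1
  · simp only [c]
    rw [projIcc_of_mem zero_le_one (Ioo_subset_Icc_self ht)]
  · simp only [hP0 t ht, zero_smul]

lemma kernel_exists (hp : p ≠ ∞) (hP : Integrable P) (hP0 : ∀ t, t ∉ Ioo (0:ℝ) 1 → P t = 0)
    (hPp : MemLp P p (volume.restrict (Ioc (0:ℝ) 1))) :
    ∃ H : ℝ → EE p, Continuous H ∧ (∀ x ∈ Icc (0:ℝ) 1, H x ∈ SS p x) ∧
      ∀ l : ℝ, ∀ x ∈ Icc (0:ℝ) 1, zz hP l x = 1 + ell p l (H x) := by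
  have hPr : MemLp (fun σ => -(I * P (rep σ))) p nu :=
    ((hPp.comp_measurePreserving rep_mp).const_mul I).neg
  set Ph : EE p := hPr.toLp _ with hPh
  set f0 : ℝ → EE p := fun x => mulOp (wset (Iic x) measurableSet_Iic) Ph with hf0
  set F : ℝ → EE p → EE p := fun t f => P t • (-I • RR t f) with hF
  have hFint : ∀ f : ℝ → EE p, Continuous f → Integrable (fun t => F t (f t)) := fun f hf =>
    smul_int hP hP0 ((RR_cont hp hf).const_smul (-I))
  obtain ⟨H, hHc, hHe, hHS⟩ := caratheodory hP.norm (fun t => norm_nonneg _) F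
    (fun t u v => by
      simp only [hF]
      rw [← smul_sub, ← smul_sub, ← RR_sub, norm_smul, norm_smul]
      simp only [norm_neg, Complex.norm_I, one_mul]
      gcongr
      exact RR_norm _ _) hFint f0 (cut_cont hp Ph) (SS p)
    (fun t => isClosed_eq (mulOp _).continuous continuous_const)
    (fun t => by simp [SS]) (fun t c u hu => by
      rw [mem_SS] at hu ⊢
      filter_upwards [hu, Lp.coeFn_smul c u] with σ h1 h2 h3
      rw [h2, Pi.smul_apply, h1 h3, smul_zero])
    (fun f hf hfS x hx => by
      rw [SS, mem_ofPred_eq, map_add]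
      have e1 : f0 x ∈ SS p x := by
        rw [mem_SS]
        filter_upwards [wset_ae (Iic x) measurableSet_Iic Ph] with σ h1 h2
        rw [hf0]
        simp only [h1]
        rw [indicator_of_notMem]
        simpa using h2
      have e2 : mulOp (wset (Ioi x) measurableSet_Ioi) (f0 x) = 0 := e1
      rw [e2, zero_add, ← ContinuousLinearMap.intervalIntegral_comp_comm _ (hFint f hf).intervalIntegrable]
      refine Eq.trans (intervalIntegral.integral_congr (g := fun _ => 0) ?_) intervalIntegral.integral_zero
      intro t ht
      rw [uIcc_of_le hx.1] at ht
      have ht' : t ∈ Icc (0:ℝ) 1 := ⟨ht.1, ht.2.trans hx.2⟩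
      have e3 : mulOp (wset (Ioi x) measurableSet_Ioi) (RR t (f t)) = 0 :=
        SS_mono ht.2 (RR_mem ht' (hfS t ht'))
      simp only [hF, map_smul, e3, smul_zero])
  refine ⟨H, hHc, hHS, fun l => ?_⟩
  set Y : ℝ → ℂ := fun x => 1 + ell p l (H x) with hY
  have hYc : Continuous Y := continuous_const.add ((ell p l).continuous.comp hHc)
  have hint1 : ∀ g : ℝ → ℂ, Continuous g →
      Integrable (fun t => -(I * (P t * (ph (l * t) * (starRingEnd ℂ) (g t))))) := fun g hg =>
    ((smul_int hP hP0 ((ph_cont.comp (continuous_const.mul continuous_id)).mul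
      (Complex.continuous_conj.comp hg))).const_mul I).neg
  have hYe : ∀ x ∈ Icc (0:ℝ) 1, Y x = 1 + ∫ t in (0:ℝ)..x,
      -(I * (P t * (ph (l * t) * (starRingEnd ℂ) (Y t)))) := by
    intro x hx
    have a1 : ell p l (f0 x) = ∫ t in (0:ℝ)..x, -(I * (P t * (ph (l * t) * (starRingEnd ℂ) (1:ℂ)))) := by
      rw [ell_apply]
      have b1 : ∫ σ, ph (l * rep σ) * f0 x σ ∂nu =
          ∫ σ, (fun t => (Iic x).indicator (fun t => -(I * (P t * (ph (l * t) * (starRingEnd ℂ) (1:ℂ))))) t)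
            (rep σ) ∂nu := by
        apply integral_congr_ae
        filter_upwards [wset_ae (Iic x) measurableSet_Iic Ph, hPr.coeFn_toLp] with σ h1 h2
        simp only [hf0, h1]
        by_cases h3 : rep σ ∈ Iic x
        · rw [indicator_of_mem h3, indicator_of_mem (by exact h3), hPh, h2, map_one]; ring
        · rw [indicator_of_notMem h3, indicator_of_notMem (by exact h3), mul_zero]
      rw [b1, integral_nu, intervalIntegral.integral_of_le hx.1, intervalIntegral.integral_of_le zero_le_one]
      have b2 : ∫ t in Ioc (0:ℝ) 1, (fun t => (Iic x).indicator (fun t => -(I * (P t * (ph (l * t) * (starRingEnd ℂ) (1:ℂ))))) t)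
            (rep (t : T1)) = ∫ t in Ioc (0:ℝ) 1, (Iic x).indicator (fun t => -(I * (P t * (ph (l * t) * (starRingEnd ℂ) (1:ℂ))))) t :=
        setIntegral_congr_fun measurableSet_Ioc fun t ht => by simp only [rep_coe ht]
      rw [b2, setIntegral_indicator measurableSet_Iic, Ioc_inter_Iic, min_eq_right hx.2]
    have a2 : ell p l (∫ t in (0:ℝ)..x, F t (H t)) =
        ∫ t in (0:ℝ)..x, -(I * (P t * (ph (l * t) * (starRingEnd ℂ) (ell p l (H t))))) := by
      rw [← ContinuousLinearMap.intervalIntegral_comp_comm _ (hFint H hHc).intervalIntegrable]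
      apply intervalIntegral.integral_congr
      intro t ht
      rw [uIcc_of_le hx.1] at ht
      have ht' : t ∈ Icc (0:ℝ) 1 := ⟨ht.1, ht.2.trans hx.2⟩
      simp only [hF, map_smul, ell_RR ht' (hHS t ht'), smul_eq_mul]
      ring
    rw [hY]
    simp only
    conv_lhs => rw [hHe x hx, map_add, a1, a2]
    rw [← intervalIntegral.integral_add (hint1 (fun _ => 1) continuous_const).intervalIntegrable
      (hint1 (fun t => ell p l (H t)) ((ell p l).continuous.comp hHc)).intervalIntegrable]
    congr 1
    congr 1; ext t
    rw [map_add]; ring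
  have hz := gronwall_zero hP.norm (fun t => norm_nonneg _) (d := fun x => zz hP l x - Y x)
    ((zz_cont hP l).sub hYc).continuousOn (fun x hx => by
      rw [zz_eq hP l hx, hYe x hx, add_sub_add_left_eq_sub, ← intervalIntegral.integral_sub
        (hint1 _ (zz_cont hP l)).intervalIntegrable (hint1 _ hYc).intervalIntegrable]
      refine (intervalIntegral.norm_integral_le_integral_norm hx.1).trans (le_of_eq ?_)
      apply intervalIntegral.integral_congr
      intro t ht
      simp only
      rw [show -(I * (P t * (ph (l * t) * (starRingEnd ℂ) (zz hP l t)))) -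
        -(I * (P t * (ph (l * t) * (starRingEnd ℂ) (Y t)))) =
        -(I * (P t * (ph (l * t) * (starRingEnd ℂ) (zz hP l t - Y t)))) by rw [map_sub]; ring]
      rw [norm_neg, norm_mul, norm_mul, norm_mul, ph_norm, RCLike.norm_conj, Complex.norm_I]; ring)
  exact fun x hx => sub_eq_zero.1 (hz x hx)

end kern

end DP

namespace DP

open AddCircle

section asym
variable {p : ℝ≥0∞} [Fact (1 ≤ p)] {P : ℝ → ℂ}

lemma ell_tendsto (f : EE p) : Tendsto (fun l => ell p l f) (cocompact ℝ) (nhds 0) := by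
  have h := Real.tendsto_integral_exp_smul_cocompact
    ((Ioc (0:ℝ) 1).indicator (fun x => f (x : T1)))
  have h2 : Tendsto (fun l : ℝ => l / Real.pi) (cocompact ℝ) (cocompact ℝ) :=
    (Homeomorph.mulRight₀ (Real.pi⁻¹) (inv_ne_zero Real.pi_ne_zero)).isClosedEmbedding.tendsto_cocompact
  refine (h.comp h2).congr fun l => ?_
  rw [ell_apply, integral_nu, intervalIntegral.integral_of_le zero_le_one,
    ← integral_indicator measurableSet_Ioc]
  simp only [Function.comp]
  congr 1; ext x
  by_cases hx : x ∈ Ioc (0:ℝ) 1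
  · rw [indicator_of_mem hx, indicator_of_mem hx, rep_coe hx, Circle.smul_def, Real.fourierChar_apply,
      smul_eq_mul, ph]
    congr 2
    push_cast
    have : (Real.pi : ℂ) ≠ 0 := by exact_mod_cast Real.pi_ne_zero
    field_simp
  · rw [indicator_of_notMem hx, indicator_of_notMem hx, smul_zero]

lemma ell_unif {H : ℝ → EE p} (hH : Continuous H) {ε : ℝ} (hε : 0 < ε) :
    ∀ᶠ l in cocompact ℝ, ∀ x ∈ Icc (0:ℝ) 1, ‖ell p l (H x)‖ < ε := by
  have hK : IsCompact (H '' Icc (0:ℝ) 1) := isCompact_Icc.image hH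
  obtain ⟨t, -, ht, hc⟩ := hK.finite_cover_balls (half_pos hε)
  have h1 : ∀ᶠ l in cocompact ℝ, ∀ y ∈ t, ‖ell p l y‖ < ε / 2 := by
    rw [eventually_all_finite ht]
    intro y _
    have := (ell_tendsto y).norm
    rw [norm_zero] at this
    exact this.eventually (gt_mem_nhds (half_pos hε))
  filter_upwards [h1] with l hl x hx
  obtain ⟨y, hy, hxy⟩ := mem_iUnion₂.1 (hc (mem_image_of_mem H hx))
  have h2 := hl y hy
  rw [mem_ball_iff_norm] at hxy
  have h3 : ell p l (H x) = ell p l (H x - y) + ell p l y := by rw [map_sub]; ring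
  have h4 := ell_norm l (H x - y)
  rw [h3]
  have h5 := norm_add_le (ell p l (H x - y)) (ell p l y)
  linarith

lemma phi_tendsto (hp : p ≠ ∞) (hP : Integrable P) (hP0 : ∀ t, t ∉ Ioo (0:ℝ) 1 → P t = 0)
    (hPp : MemLp P p (volume.restrict (Ioc (0:ℝ) 1))) :
    Tendsto (fun l => th hP l 1 - l) (cocompact ℝ) (nhds 0) := by
  obtain ⟨H, hHc, -, hHz⟩ := kernel_exists hp hP hP0 hPp
  rw [Metric.tendsto_nhds]
  intro ε hε
  set η := min (1 / 2) (ε / 8) with hη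
  have hη0 : 0 < η := by positivity
  have hη1 : η ≤ 1 / 2 := min_le_left _ _
  have hη2 : η ≤ ε / 8 := min_le_right _ _
  filter_upwards [ell_unif hHc hη0] with l hl
  rw [Real.dist_eq, sub_zero]
  set φ : ℝ → ℝ := fun x => th hP l x - l * x with hφ
  have hφc : Continuous φ := (th_cont hP l).sub (by fun_prop)
  have hφ0 : φ 0 = 0 := by simp only [hφ]; rw [th_eq hP l 0 (by simp)]; simp
  have hcos : ∀ x ∈ Icc (0:ℝ) 1, 0 < Real.cos (φ x) := by
    intro x hx
    obtain ⟨r, hr, hz⟩ := zz_polar hP l hx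
    rw [hHz l x hx] at hz
    have h1 : (1 + ell p l (H x)).re = r * Real.cos (φ x) := by
      rw [hz, Complex.re_ofReal_mul, Complex.exp_ofReal_mul_I_re]
    have h2 := Complex.abs_re_le_norm (ell p l (H x))
    have h3 := hl x hx
    rw [Complex.add_re, Complex.one_re] at h1
    have h4 : 0 < r * Real.cos (φ x) := by
      rw [← h1]; linarith [neg_abs_le (ell p l (H x)).re]
    exact (pos_iff_pos_of_mul_pos h4).1 hr
  have hlt : |φ 1| < Real.pi / 2 := by
    by_contra hcon
    rw [not_lt] at hcon
    have hc' : ContinuousOn (fun x => |φ x|) (Icc 0 1) := hφc.abs.continuousOn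
    have h1 := intermediate_value_Icc zero_le_one hc'
    obtain ⟨x, hx, hx2⟩ := h1 (show Real.pi / 2 ∈ _ from
      ⟨by simp only [hφ0, abs_zero]; positivity, hcon⟩)
    have h2 := hcos x hx
    rw [← Real.cos_abs] at h2
    simp only at hx2
    rw [hx2, Real.cos_pi_div_two] at h2
    exact lt_irrefl _ h2
  have h1m : (1:ℝ) ∈ Icc (0:ℝ) 1 := by simp
  obtain ⟨r, hr, hz⟩ := zz_polar hP l h1m
  rw [hHz l 1 h1m] at hz
  have him : (ell p l (H 1)).im = r * Real.sin (φ 1) := by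
    have : (1 + ell p l (H 1)).im = r * Real.sin (φ 1) := by
      rw [hz, Complex.im_ofReal_mul, Complex.exp_ofReal_mul_I_im]
    rwa [Complex.add_im, Complex.one_im, zero_add] at this
  have hnorm : ‖1 + ell p l (H 1)‖ = r := by
    rw [hz, norm_mul, Complex.norm_exp_ofReal_mul_I, mul_one, Complex.norm_real, Real.norm_eq_abs,
      abs_of_pos hr]
  have hl1 := hl 1 h1m
  have hr2 : 1 / 2 ≤ r := by
    have := norm_sub_le_norm_add (1:ℂ) (ell p l (H 1))
    rw [norm_one, hnorm] at this
    linarith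
  have hsin : r * |Real.sin (φ 1)| < η := by
    have := Complex.abs_im_le_norm (ell p l (H 1))
    rw [him, abs_mul, abs_of_pos hr] at this
    linarith
  have hj := Real.mul_abs_le_abs_sin hlt.le
  have hφ1 : φ 1 = th hP l 1 - l := by simp [hφ]
  rw [← hφ1]
  have hpi := Real.pi_lt_four
  have h5 : 1 / 2 * |φ 1| ≤ |Real.sin (φ 1)| := by
    refine le_trans ?_ hj
    gcongr ?_ * _
    rw [div_le_div_iff₀ (by norm_num) Real.pi_pos]; linarith
  have h6 : 1 / 2 * |Real.sin (φ 1)| ≤ r * |Real.sin (φ 1)| := by gcongr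
  linarith

/-- the multiplier `1 - 2 rep` -/
def wD : Wt := ⟨fun σ => ((1 - 2 * rep σ : ℝ) : ℂ),
  Complex.measurable_ofReal.comp ((rep_meas.const_mul 2).const_sub 1), fun σ => by
    rw [Complex.norm_real, Real.norm_eq_abs, abs_le]
    have := rep_mem σ
    exact ⟨by linarith [this.2], by linarith [this.1]⟩⟩

lemma wD_pow (k : EE p) (j : ℕ) : ((mulOp wD) ^ j) k =ᵐ[nu] fun σ => (wD.1 σ) ^ j * k σ := by
  induction j with
  | zero => simp
  | succ j ih =>
    rw [pow_succ']
    change mulOp wD (((mulOp wD) ^ j) k) =ᵐ[nu] _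
    filter_upwards [ih, mulOp_ae wD (((mulOp wD) ^ j) k)] with σ h1 h2
    rw [h2, h1]; ring

lemma wD_norm (k : EE p) (j : ℕ) : ‖((mulOp wD) ^ j) k‖ ≤ ‖k‖ := by
  induction j with
  | zero => simp
  | succ j ih =>
    rw [pow_succ']
    change ‖mulOp wD (((mulOp wD) ^ j) k)‖ ≤ _
    exact (mulOp_norm _ _).trans ih

lemma exp_hasSum (z : ℂ) : HasSum (fun j : ℕ => z ^ j / (j.factorial : ℂ)) (Complex.exp z) := by
  rw [Complex.exp_eq_exp_ℂ]
  exact NormedSpace.expSeries_div_hasSum_exp z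

lemma ell_expand (n : ℤ) (c s : ℝ) (k : EE p) :
    HasSum (fun j : ℕ => (I * s) ^ j / (j.factorial : ℂ) * en p n (((mulOp wD) ^ j) (mulOp (wph c) k)))
      (Complex.exp (I * s) * ell p (Real.pi * n + c + s) k) := by
  set k' := mulOp (wph c) k with hk'
  set F : ℕ → T1 → ℂ := fun j σ => (I * s) ^ j / (j.factorial : ℂ) *
    (ph (Real.pi * n * rep σ) * (((mulOp wD) ^ j) k') σ) with hF
  have hphm : ∀ a : ℝ, AEStronglyMeasurable (fun σ => ph (a * rep σ)) nu := fun a =>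
    (wph a).2.1.aestronglyMeasurable
  have hFint : ∀ j, Integrable (F j) nu := fun j =>
    ((EE_int _).bdd_mul (hphm _) (Eventually.of_forall fun σ => (ph_norm _).le)).const_mul _
  have hFn : ∀ j, ∫ σ, ‖F j σ‖ ∂nu ≤ ‖(I * (s:ℂ)) ^ j / (j.factorial : ℂ)‖ * ‖k'‖ := by
    intro j
    simp only [hF, norm_mul, ph_norm, one_mul]
    rw [integral_const_mul]
    gcongr
    exact (EE_l1 _).trans (wD_norm _ _)
  have hs : Summable (fun j => ∫ σ, ‖F j σ‖ ∂nu) := by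
    refine Summable.of_nonneg_of_le (fun j => integral_nonneg fun σ => norm_nonneg _) hFn ?_
    exact ((exp_hasSum (I * s)).summable.norm).mul_right _
  have h := hasSum_integral_of_summable_integral_norm hFint hs
  have e1 : ∀ j, ∫ σ, F j σ ∂nu =
      (I * s) ^ j / (j.factorial : ℂ) * en p n (((mulOp wD) ^ j) k') := by
    intro j
    simp only [hF]
    rw [integral_const_mul, en, ell_apply]
  have e2 : ∫ σ, ∑' j, F j σ ∂nu = Complex.exp (I * s) * ell p (Real.pi * n + c + s) k := by
    rw [ell_apply, ← integral_const_mul]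
    apply integral_congr_ae
    have ha : ∀ᵐ σ ∂nu, ∀ j, (((mulOp wD) ^ j) k') σ = (wD.1 σ) ^ j * k' σ :=
      ae_all_iff.2 fun j => wD_pow k' j
    filter_upwards [ha, mulOp_ae (wph c) k] with σ h1 h2
    have h3 : HasSum (fun j => F j σ)
        (Complex.exp (I * s * wD.1 σ) * (ph (Real.pi * n * rep σ) * k' σ)) := by
      refine ((exp_hasSum (I * s * wD.1 σ)).mul_right _).congr_fun ?_ |> fun h => h
      intro j
      simp only [hF, h1]
      rw [mul_pow]; ring
    rw [h3.tsum_eq, hk', h2]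
    simp only [wph, wD]
    rw [show (Real.pi * n + c + s) * rep σ = Real.pi * n * rep σ + c * rep σ + s * rep σ by ring,
      ph_add, ph_add]
    have h4 : Complex.exp (I * s * ((1 - 2 * rep σ : ℝ) : ℂ)) = Complex.exp (I * s) * ph (s * rep σ) := by
      rw [ph, ← Complex.exp_add]; congr 1; push_cast; ring
    rw [h4]; ring
  rw [e2] at h
  simp only [e1] at h
  exact h

/-- Taylor coefficients of `s - sin s` -/
def cc (j : ℕ) : ℂ := (if j = 1 then 1 else 0) - (I ^ j - (-I) ^ j) / (2 * I) / (j.factorial : ℂ)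

lemma cc_zero : cc 0 = 0 := by simp [cc]

lemma cc_one : cc 1 = 0 := by
  have : (2 * I) ≠ 0 := by simp
  simp only [cc, if_true, pow_one, Nat.factorial_one, Nat.cast_one, div_one]
  field_simp; ring

lemma cc_norm (j : ℕ) : ‖cc j‖ ≤ 2 := by
  rw [cc]
  refine (norm_sub_le _ _).trans ?_
  have h1 : ‖(if j = 1 then (1:ℂ) else 0)‖ ≤ 1 := by split_ifs <;> simp
  have hf : (1:ℝ) ≤ j.factorial := by exact_mod_cast Nat.factorial_pos j
  have h2 : ‖(I ^ j - (-I) ^ j) / (2 * I) / (j.factorial : ℂ)‖ ≤ 1 := by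
    rw [norm_div, norm_div, Complex.norm_natCast, div_le_one (by linarith)]
    refine le_trans ?_ hf
    rw [div_le_one (by simp)]
    refine (norm_sub_le _ _).trans ?_
    simp; norm_num
  linarith

lemma cc_hasSum (s : ℂ) : HasSum (fun j => cc j * s ^ j) (s - Complex.sin s) := by
  have h1 : HasSum (fun j : ℕ => (if j = 1 then (1:ℂ) else 0) * s ^ j) s := by
    have := hasSum_single (f := fun j : ℕ => (if j = 1 then (1:ℂ) else 0) * s ^ j) 1
      (fun j hj => by simp [hj])
    simpa using this
  have h2 := (((exp_hasSum (I * s)).sub (exp_hasSum (-I * s))).div_const (2 * I))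
  have h3 := h1.sub h2
  have e : s - (Complex.exp (I * s) - Complex.exp (-I * s)) / (2 * I) = s - Complex.sin s := by
    rw [Complex.sin, show I * s = s * I by ring, show -I * s = -s * I by ring]
    congr 1
    have : I ≠ 0 := Complex.I_ne_zero
    rw [div_eq_div_iff (by simp) (by simp)]
    linear_combination (-2 * Complex.exp (-s * I) + 2 * Complex.exp (s * I)) * (Complex.I_mul_I)
  rw [e] at h3
  refine h3.congr_fun ?_ |> fun h => h
  intro j
  rw [cc, mul_pow, mul_pow]; ring

lemma asymp (hp : p ≠ ∞) (hP : Integrable P) (hP0 : ∀ t, t ∉ Ioo (0:ℝ) 1 → P t = 0)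
    (hPp : MemLp P p (volume.restrict (Ioc (0:ℝ) 1))) (c : ℝ) (lam : ℤ → ℝ)
    (hlam : ∀ n, th hP (lam n) 1 = Real.pi * n + c) :
    ∃ g : EE p, ∀ n, (lam n : ℂ) = Real.pi * n + c + en p n g := by
  set s : ℤ → ℝ := fun n => lam n - (Real.pi * n + c) with hs
  have hsφ : ∀ n, s n = -(th hP (lam n) 1 - lam n) := fun n => by rw [hlam, hs]; ring
  have hlt : Tendsto lam cofinite (cocompact ℝ) := by
    rw [← Metric.cobounded_eq_cocompact, ← tendsto_norm_atTop_iff_cobounded]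
    have h1 : Tendsto (fun n : ℤ => ‖(n : ℝ)‖) cofinite atTop :=
      tendsto_norm_cocompact_atTop.comp Int.tendsto_coe_cofinite
    set C := ∫ t in (0:ℝ)..1, ‖P t‖
    have h2 : Tendsto (fun n : ℤ => ‖(n : ℝ)‖ + (-(C + |c|))) cofinite atTop :=
      tendsto_atTop_add_const_right _ _ h1
    refine tendsto_atTop_mono (fun n => ?_) h2
    have h3 := th_sub_le hP (lam n)
    rw [hlam] at h3
    rw [Real.norm_eq_abs, Real.norm_eq_abs]
    have h4 : |Real.pi * n| ≤ |Real.pi * n + c - lam n| + |c| + |lam n| := by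
      calc |Real.pi * n| = |(Real.pi * n + c - lam n) - c + lam n| := by congr 1; ring
        _ ≤ |(Real.pi * n + c - lam n) - c| + |lam n| := abs_add_le _ _
        _ ≤ _ := by gcongr; exact abs_sub _ _
    rw [abs_mul, abs_of_pos Real.pi_pos] at h4
    have h5 : |(n:ℝ)| ≤ Real.pi * |(n:ℝ)| := by
      nlinarith [Real.pi_gt_three, abs_nonneg (n:ℝ)]
    linarith
  have hst : Tendsto (fun n => (s n : ℂ)) cofinite (nhds 0) := by
    have h1 := ((phi_tendsto hp hP hP0 hPp).comp hlt).neg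
    rw [neg_zero] at h1
    have h2 : Tendsto s cofinite (nhds 0) := h1.congr fun n => (hsφ n).symm
    have h3 := (Complex.continuous_ofReal.tendsto 0).comp h2
    rw [Complex.ofReal_zero] at h3
    exact h3
  obtain ⟨H, hHc, hHS, hHz⟩ := kernel_exists hp hP hP0 hPp
  have h1m : (1:ℝ) ∈ Icc (0:ℝ) 1 := by simp
  set h := H 1 with hh
  set k0 : EE p := (2 * I)⁻¹ • (h - Complex.exp (2 * I * c) • RR 1 h) with hk0
  have hmain : ∀ n, Complex.sin (s n) + Complex.exp (I * s n) * ell p (Real.pi * n + c + s n) k0 = 0 := by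
    intro n
    have hl : Real.pi * n + c + s n = lam n := by rw [hs]; ring
    rw [hl]
    obtain ⟨r, hr, hz⟩ := zz_polar hP (lam n) h1m
    rw [hHz (lam n) 1 h1m, mul_one, show th hP (lam n) 1 - lam n = -(s n) by rw [hsφ]; ring] at hz
    set a := ell p (lam n) h with ha
    have hb := ell_RR h1m (hHS 1 h1m) (lam n)
    rw [mul_one] at hb
    have hE : ell p (lam n) k0 = (2 * I)⁻¹ * (a - Complex.exp (2 * I * c) *
        (ph (lam n) * (starRingEnd ℂ) a)) := by
      rw [hk0, map_smul, map_sub, map_smul, hb, smul_eq_mul, smul_eq_mul]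
    set E := Complex.exp (s n * I) with hEdef
    set E' := Complex.exp (-(s n * I)) with hE'def
    have hEE : E * E' = 1 := by rw [hEdef, hE'def, ← Complex.exp_add]; simp
    have hcE : (starRingEnd ℂ) E' = E := by
      rw [hEdef, hE'def, ← Complex.exp_conj]; congr 1; simp
    have hza : a = r * E' - 1 := by
      have : ((-s n : ℝ) : ℂ) * I = -(s n * I) := by push_cast; ring
      rw [this] at hz
      linear_combination hz
    have hzc : (starRingEnd ℂ) a = r * E - 1 := by
      rw [hza, map_sub, map_mul, hcE, map_one, Complex.conj_ofReal]
    have hph : Complex.exp (2 * I * c) * ph (lam n) = E' * E' := by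
      rw [ph, hE'def, ← Complex.exp_add, ← Complex.exp_add, ← hl]
      have h1 : 2 * I * (c:ℂ) + -(2 * ((Real.pi * n + c + s n : ℝ) : ℂ) * I) =
          (-(s n * I) + -(s n * I)) + ((-n : ℤ) : ℂ) * (2 * Real.pi * I) := by push_cast; ring
      rw [h1, Complex.exp_add, Complex.exp_int_mul_two_pi_mul_I, mul_one]
    have hI : (2 * I)⁻¹ * (2 * I) = 1 := inv_mul_cancel₀ (by simp)
    have hsin : Complex.sin (s n) = (2 * I)⁻¹ * (E - E') := by
      have h2 : (2 * I) * Complex.sin (s n) = E - E' := by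
        rw [Complex.sin, hEdef, hE'def, neg_mul]
        linear_combination (Complex.exp (-(s n * I)) - Complex.exp (s n * I)) * Complex.I_mul_I
      rw [← h2, ← mul_assoc, hI, one_mul]
    rw [hE, hsin, hzc, ← mul_assoc (Complex.exp (2 * I * c)), hph, hza, mul_comm I (s n : ℂ), ← hEdef]
    linear_combination (2 * I)⁻¹ * (E' - r * E * E') * hEE
  set kk := mulOp (wph c) k0 with hkk
  set d : ℕ → EE p := fun j => -((I ^ j / (j.factorial : ℂ)) • ((mulOp wD) ^ j) kk) with hd
  obtain ⟨g, hg⟩ := fixed_main (conv hp) (conv_norm hp) (en p) en_norm (en_conv hp)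
    (fun f ε hε => small_tail hp f hε) (fourierLp p) en_fourierLp cc d (2 + ‖kk‖) cc_zero cc_one
    (fun j => (cc_norm j).trans (by linarith [norm_nonneg kk]))
    (fun j => by
      have hf : (1:ℝ) ≤ j.factorial := by exact_mod_cast Nat.factorial_pos j
      simp only [hd]
      rw [norm_neg, norm_smul, norm_div, norm_pow, Complex.norm_I, one_pow, Complex.norm_natCast]
      calc _ ≤ 1 * ‖kk‖ := by
            gcongr
            · rw [div_le_one (by linarith)]; exact hf
            · exact wD_norm _ _
        _ ≤ _ := by linarith) (fun n => (s n : ℂ)) hst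
    (fun n => by
      have a1 := (cc_hasSum (s n)).sub (ell_expand n c (s n) k0)
      rw [show (s n : ℂ) - Complex.sin (s n) - Complex.exp (I * s n) * ell p (Real.pi * n + c + s n) k0
        = s n by linear_combination -(hmain n)] at a1
      refine a1.congr_fun ?_ |> fun h => h
      intro j
      simp only [hd]
      rw [map_neg, map_smul, smul_eq_mul, mul_pow]; ring)
  refine ⟨g, fun n => ?_⟩
  rw [← hg n, hs]
  push_cast; ring

end asym

end DP

namespace DP

open AddCircle

lemma fc_exists {p : ℝ≥0∞} [Fact (1 ≤ p)] (g : EE p) :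
    ∃ g' : ℝ → ℂ, MemLp g' p μ01 ∧ ∀ n, fc g' n = en p n g := by
  refine ⟨fun x => g (x : T1), ?_, fun n => ?_⟩
  · have h := (Lp.memLp g).comp_measurePreserving mk_mp
    rw [μ01, restrict_Ioo_eq_restrict_Ioc]
    exact h
  · rw [en, ell_apply, integral_nu, fc, intervalIntegral.integral_of_le zero_le_one,
      intervalIntegral.integral_of_le zero_le_one]
    refine setIntegral_congr_fun measurableSet_Ioc fun x hx => ?_
    simp only [rep_coe hx, ph]
    congr 2; push_cast; ring

lemma entry_memLp {p : ℝ≥0∞} {Q : ℝ → M2} (hQp : MemLp Q p μ01) (i j : Fin 2) :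
    MemLp (fun x => Q x i j) p μ01 := by
  have := (LinearMap.toContinuousLinearMap (Matrix.entryLinearMap ℂ ℂ i j : M2 →ₗ[ℂ] ℂ)).comp_memLp' hQp
  exact this

end DP

/-- The spectra of `A₁` and `A₂` can be enumerated as strictly increasing
interlacing sequences `(λ_n)`, `(μ_n)` with `λ_n = π(n+1/2) + e_n(g₁)`,
`μ_n = πn + e_n(g₂)` for some `g₁, g₂ ∈ L_p(0,1)`. -/
theorem statement5 (p : ℝ≥0∞) (hp : 1 ≤ p) (hp' : p ≠ ∞)
    (Q : ℝ → M2) (hQform : IsRealDiracForm Q) (hQp : MemLp Q p μ01) :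
    ∃ lam mu : ℤ → ℝ,
      StrictMono lam ∧ StrictMono mu ∧
      (∀ l : ℝ, IsEigenvalue Q 0 l ↔ ∃ n : ℤ, lam n = l) ∧
      (∀ l : ℝ, IsEigenvalue Q 1 l ↔ ∃ n : ℤ, mu n = l) ∧
      (∀ n : ℤ, lam (n - 1) < mu n ∧ mu n < lam n) ∧
      LamAsymp p lam ∧ MuAsymp p mu := by
  haveI : Fact (1 ≤ p) := ⟨hp⟩
  obtain ⟨q1, q2, hQ⟩ := hQform
  set P : ℝ → ℂ := (Ioo (0:ℝ) 1).indicator (fun t => (q1 t : ℂ) + I * q2 t) with hPdef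
  have hPmem : MemLp (fun t => (q1 t : ℂ) + I * q2 t) p μ01 := by
    have h := (DP.entry_memLp hQp 0 0).add ((DP.entry_memLp hQp 0 1).const_mul I)
    have e : (fun t => (q1 t : ℂ) + I * q2 t) = (fun x => Q x 0 0) + fun x => I * Q x 0 1 := by
      ext t
      simp [hQ]
    rw [e]; exact h
  have hPp0 : MemLp P p volume := (memLp_indicator_iff_restrict measurableSet_Ioo).2 hPmem
  have hP : Integrable P := by
    rw [hPdef, integrable_indicator_iff measurableSet_Ioo]
    haveI : IsFiniteMeasure μ01 := by rw [μ01]; infer_instance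
    exact hPmem.integrable hp
  have hP0 : ∀ t, t ∉ Ioo (0:ℝ) 1 → P t = 0 := fun t ht => indicator_of_notMem ht _
  have hPp : MemLp P p (volume.restrict (Ioc (0:ℝ) 1)) := hPp0.restrict _
  have hPq : ∀ t ∈ Ioo (0:ℝ) 1, P t = q1 t + I * q2 t := fun t ht => indicator_of_mem ht _
  choose lam hlam using fun n : ℤ => DP.th_surj hP (Real.pi * n + Real.pi / 2)
  choose mu hmu using fun n : ℤ => DP.th_surj hP (Real.pi * n)
  have hmono := DP.th_strictMono hP
  have hlt : ∀ {a b : ℝ}, DP.th hP a 1 < DP.th hP b 1 → a < b := fun h => hmono.lt_iff_lt.1 h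
  have hpi := Real.pi_pos
  refine ⟨lam, mu, fun m n hmn => ?_, fun m n hmn => ?_, fun l => ?_, fun l => ?_, fun n => ⟨?_, ?_⟩,
    ?_, ?_⟩
  · apply hlt
    rw [hlam, hlam]
    have : (m : ℝ) < n := by exact_mod_cast hmn
    gcongr
  · apply hlt
    rw [hmu, hmu]
    have : (m : ℝ) < n := by exact_mod_cast hmn
    gcongr
  · rw [DP.eig0 hP hQ hPq]
    constructor
    · rintro ⟨n, hn⟩
      exact ⟨n, hmono.injective (by simp only [hlam, hn])⟩
    · rintro ⟨n, rfl⟩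
      exact ⟨n, hlam n⟩
  · rw [DP.eig1 hP hQ hPq]
    constructor
    · rintro ⟨n, hn⟩
      exact ⟨n, hmono.injective (by simp only [hmu, hn])⟩
    · rintro ⟨n, rfl⟩
      exact ⟨n, hmu n⟩
  · apply hlt
    rw [hlam, hmu]; push_cast; linarith
  · apply hlt
    rw [hlam, hmu]; linarith
  · obtain ⟨g, hg⟩ := DP.asymp hp' hP hP0 hPp (Real.pi / 2) lam hlam
    obtain ⟨g', h1, h2⟩ := DP.fc_exists g
    refine ⟨g', h1, fun n => ?_⟩
    rw [hg, h2]; push_cast; ring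
  · obtain ⟨g, hg⟩ := DP.asymp hp' hP hP0 hPp 0 mu (fun n => by rw [hmu, add_zero])
    obtain ⟨g', h1, h2⟩ := DP.fc_exists g
    refine ⟨g', h1, fun n => ?_⟩
    rw [hg, h2]; push_cast; ring
end
end

section
/- Let p ∈ [1,∞), let Q be a Dirac-form potential with real-valued q₁, q₂ ∈ L_p(0,1), and let (λ_n)_{n∈ℤ} be the eigenvalues of A₁ enumerated so that λ_n = π(n+1/2) + e_n(g₁) for some g₁ ∈ L_p(0,1). Then the norming constants α_n := ‖c(·,λ_n)‖_ℍ^{−2} satisfy α_n = 1 + e_n(g) for all n ∈ ℤ, for some g ∈ L_p(0,1). -/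
open MeasureTheory Complex Filter Set
open scoped Matrix.Norms.L2Operator ENNReal

noncomputable section

set_option linter.unusedSectionVars false

section Circle

open AddCircle

abbrev Xp (p : ℝ≥0∞) := Lp ℂ p (haarAddCircle (T := (1:ℝ)))

/-- the fundamental-domain map from the circle to `(0,1]`. -/
def phiC (θ : UnitAddCircle) : ℝ := (AddCircle.measurableEquivIoc 1 0 θ : ℝ)

lemma mu01_eq : μ01 = volume.restrict (Set.Ioc (0:ℝ) 1) := by
  unfold μ01
  exact Measure.restrict_congr_set Ioo_ae_eq_Ioc

lemma haar_eq_vol : (haarAddCircle (T := (1:ℝ))) = volume := by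
  rw [AddCircle.volume_eq_smul_haarAddCircle]; simp

lemma phiC_emb : MeasurableEmbedding phiC :=
  (MeasurableEmbedding.subtype_coe measurableSet_Ioc).comp
    (AddCircle.measurableEquivIoc (1:ℝ) 0).measurableEmbedding

lemma phiC_mem (θ : UnitAddCircle) : phiC θ ∈ Set.Ioc (0:ℝ) 1 := by
  have := (AddCircle.measurableEquivIoc (1:ℝ) 0 θ).2
  simpa [phiC] using this

lemma coe_phiC (θ : UnitAddCircle) : ((phiC θ : ℝ) : UnitAddCircle) = θ :=
  (AddCircle.measurableEquivIoc (1:ℝ) 0).symm_apply_apply θ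

lemma coe_mp : MeasurePreserving ((↑) : ℝ → UnitAddCircle) μ01 (haarAddCircle (T := (1:ℝ))) := by
  rw [mu01_eq, haar_eq_vol]
  simpa using AddCircle.measurePreserving_mk (1:ℝ) 0

lemma phiC_coe {x : ℝ} (hx : x ∈ Set.Ioc (0:ℝ) 1) : phiC (x : UnitAddCircle) = x := by
  have : AddCircle.equivIoc (1:ℝ) 0 (x : AddCircle (1:ℝ)) = ⟨x, by simpa using hx⟩ :=
    AddCircle.equivIoc_coe_eq _
  show ((AddCircle.equivIoc (1:ℝ) 0 (x : AddCircle (1:ℝ)) : Set.Ioc (0:ℝ) (0+1)) : ℝ) = x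
  rw [this]

lemma phiC_mp : MeasurePreserving phiC (haarAddCircle (T := (1:ℝ))) μ01 := by
  refine ⟨phiC_emb.measurable, ?_⟩
  rw [← coe_mp.map_eq, Measure.map_map phiC_emb.measurable coe_mp.measurable]
  have : (phiC ∘ ((↑) : ℝ → UnitAddCircle)) =ᵐ[μ01] id := by
    rw [mu01_eq]
    filter_upwards [ae_restrict_mem measurableSet_Ioc] with x hx
    exact phiC_coe hx
  rw [Measure.map_congr this, Measure.map_id]

instance : IsFiniteMeasure μ01 := by unfold μ01; infer_instance

variable {p : ℝ≥0∞} [h1 : Fact (1 ≤ p)] [h2 : Fact (p ≠ ∞)]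

lemma norm_fourier_one (n : ℤ) (t : UnitAddCircle) : ‖fourier (T := (1:ℝ)) n t‖ = 1 := by
  rw [fourier_apply]; exact Circle.norm_coe _

lemma Xp_int (f : Xp p) : Integrable f haarAddCircle :=
  (Lp.memLp f).integrable h1.out

lemma Xp_int_mul (n : ℤ) (f : Xp p) : Integrable (fun t => fourier (-n) t * f t) (haarAddCircle (T := (1:ℝ))) := by
  refine (Xp_int f).bdd_mul (c := 1) ?_ ?_
  · exact (map_continuous _).aestronglyMeasurable
  · exact Eventually.of_forall fun t => (norm_fourier_one _ _).le

lemma Xp_norm_one (f : Xp p) : ∫ t, ‖f t‖ ∂haarAddCircle ≤ ‖f‖ := by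
  rw [Lp.norm_def, integral_norm_eq_lintegral_enorm (Xp_int f).1]
  refine ENNReal.toReal_mono (Lp.memLp f).2.ne ?_
  rw [← eLpNorm_one_eq_lintegral_enorm]
  exact eLpNorm_le_eLpNorm_of_exponent_le h1.out (Xp_int f).1

/-- The Fourier coefficient functional. -/
def eC (n : ℤ) : Xp p →L[ℂ] ℂ :=
  LinearMap.mkContinuous
    { toFun := fun f => ∫ t, fourier (-n) t * f t ∂haarAddCircle
      map_add' := fun f g => by
        rw [← integral_add (Xp_int_mul n f) (Xp_int_mul n g)]
        refine integral_congr_ae ?_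
        filter_upwards [Lp.coeFn_add f g] with t ht
        rw [ht]; simp [mul_add]
      map_smul' := fun c f => by
        rw [RingHom.id_apply, smul_eq_mul, ← integral_const_mul]
        refine integral_congr_ae ?_
        filter_upwards [Lp.coeFn_smul c f] with t ht
        rw [ht]; simp; ring } 1 (fun f => by
          rw [one_mul]
          refine le_trans (norm_integral_le_integral_norm _) (le_trans (le_of_eq ?_) (Xp_norm_one f))
          simp only [norm_mul, norm_fourier_one, one_mul])

lemma eC_apply (n : ℤ) (f : Xp p) : eC n f = ∫ t, fourier (-n) t * f t ∂haarAddCircle := rfl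

lemma eC_norm_le (n : ℤ) (f : Xp p) : ‖eC n f‖ ≤ ‖f‖ := by
  rw [eC_apply]
  refine le_trans (norm_integral_le_integral_norm _) (le_trans (le_of_eq ?_) (Xp_norm_one f))
  simp only [norm_mul, norm_fourier_one, one_mul]

lemma fourier_coe (n : ℤ) (x : ℝ) : fourier (T := (1:ℝ)) (-n) (x : AddCircle (1:ℝ)) =
    Complex.exp (-2 * Real.pi * Complex.I * n * x) := by
  rw [fourier_coe_apply]; congr 1; push_cast; ring

lemma fc_eq (g : ℝ → ℂ) (n : ℤ) : fc g n = ∫ x, Complex.exp (-2 * Real.pi * Complex.I * n * x) * g x ∂μ01 := by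
  rw [fc, intervalIntegral.integral_of_le zero_le_one, mu01_eq]

lemma fc_congr {g h : ℝ → ℂ} (hgh : g =ᵐ[μ01] h) (n : ℤ) : fc g n = fc h n := by
  rw [fc_eq, fc_eq]
  refine integral_congr_ae ?_
  filter_upwards [hgh] with x hx
  rw [hx]

/-- Transfer from `L_p(0,1)` to the circle. -/
def Jc : Lp ℂ p μ01 →ₗᵢ[ℂ] Xp p := Lp.compMeasurePreservingₗᵢ ℂ phiC phiC_mp

lemma eC_Jc (f : Lp ℂ p μ01) (n : ℤ) : eC n (Jc f) = fc f n := by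
  rw [fc_eq, ← phiC_mp.integral_comp phiC_emb, eC_apply]
  refine integral_congr_ae ?_
  filter_upwards [Lp.coeFn_compMeasurePreserving f phiC_mp] with t ht
  have : (Jc f : UnitAddCircle → ℂ) t = f (phiC t) := ht
  rw [this, ← fourier_coe, coe_phiC]

lemma exists_fc (G : Xp p) : ∃ g : ℝ → ℂ, MemLp g p μ01 ∧ ∀ n, fc g n = eC n G := by
  refine ⟨fun x => G (x : UnitAddCircle), (Lp.memLp G).comp_measurePreserving coe_mp, fun n => ?_⟩
  rw [fc_eq, eC_apply, ← phiC_mp.integral_comp phiC_emb]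
  refine integral_congr_ae (Eventually.of_forall fun t => ?_)
  simp only
  rw [← fourier_coe, coe_phiC]

lemma exists_Xp (g : ℝ → ℂ) (hg : MemLp g p μ01) : ∃ G : Xp p, ∀ n, eC n G = fc g n :=
  ⟨Jc (hg.toLp g), fun n => by rw [eC_Jc]; exact fc_congr hg.coeFn_toLp n⟩

/-- translation -/
def tau (t : UnitAddCircle) (f : Xp p) : Xp p := (DomAddAct.mk (-t)) +ᵥ f

lemma tau_cont : Continuous (fun q : UnitAddCircle × Xp p => tau q.1 q.2) := by
  have h : Continuous (fun q : UnitAddCircle × Xp p => DomAddAct.mk (-q.1)) :=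
    Continuous.comp (g := fun t : UnitAddCircle => DomAddAct.mk t) DomAddAct.continuous_mk
      (continuous_fst.neg)
  exact h.vadd continuous_snd

lemma tau_norm (t : UnitAddCircle) (f : Xp p) : ‖tau t f‖ = ‖f‖ := DomAddAct.norm_vadd_Lp _ _

lemma tau_add (t : UnitAddCircle) (f g : Xp p) : tau t (f + g) = tau t f + tau t g :=
  DomAddAct.vadd_Lp_add _ _ _

lemma tau_sub (t : UnitAddCircle) (f g : Xp p) : tau t (f - g) = tau t f - tau t g :=
  DomAddAct.vadd_Lp_sub _ _ _

lemma tau_smul (t : UnitAddCircle) (c : ℂ) (f : Xp p) : tau t (c • f) = c • tau t f :=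
  (Lp.compMeasurePreservingₗᵢ ℂ (fun s : UnitAddCircle => -t +ᵥ s) (measurePreserving_vadd _ _)).map_smul c f

lemma eC_tau (n : ℤ) (t : UnitAddCircle) (f : Xp p) : eC n (tau t f) = fourier (-n) t * eC n f := by
  rw [eC_apply, eC_apply, ← integral_const_mul, ← integral_add_right_eq_self _ t]
  refine integral_congr_ae ?_
  have h := (measurePreserving_add_right (haarAddCircle (T := (1:ℝ))) t).quasiMeasurePreserving.ae (DomAddAct.vadd_Lp_ae_eq (DomAddAct.mk (-t)) f)
  filter_upwards [h] with s hs
  have : (tau t f : UnitAddCircle → ℂ) (s + t) = f s := by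
    refine hs.trans ?_
    simp
  rw [this]
  simp only [fourier_apply, smul_add, AddCircle.toCircle_add, Circle.coe_mul]
  ring

/-- reflection -/
def Rf : Xp p →ₗᵢ[ℂ] Xp p := Lp.compMeasurePreservingₗᵢ ℂ (fun t => -t) (Measure.measurePreserving_neg _)

lemma eC_Rf (n : ℤ) (f : Xp p) : eC n (Rf f) = eC (-n) f := by
  rw [eC_apply, eC_apply, ← integral_neg_eq_self]
  refine integral_congr_ae ?_
  have h := (Measure.measurePreserving_neg (haarAddCircle (T := (1:ℝ)))).quasiMeasurePreserving.ae (Lp.coeFn_compMeasurePreserving f (Measure.measurePreserving_neg (haarAddCircle (T := (1:ℝ)))))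
  filter_upwards [h] with s hs
  have : (Rf f : UnitAddCircle → ℂ) (-s) = f s := by
    refine hs.trans ?_
    simp
  rw [this]
  simp [fourier_apply]

lemma conv_int (f g : Xp p) : Integrable (fun t => f t • tau t g) (haarAddCircle (T := (1:ℝ))) := by
  have h3 : AEStronglyMeasurable (fun t => tau t g) (haarAddCircle (T := (1:ℝ))) :=
    (tau_cont.comp (Continuous.prodMk_left g)).aestronglyMeasurable
  refine ((Xp_int f).norm.mul_const ‖g‖).mono' ((Xp_int f).1.smul h3) ?_
  exact Eventually.of_forall fun t => by simp [norm_smul, tau_norm]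

/-- convolution -/
def conv : Xp p →L[ℂ] Xp p →L[ℂ] Xp p :=
  LinearMap.mkContinuous₂
    (LinearMap.mk₂ ℂ (fun f g : Xp p => ∫ t, f t • tau t g ∂haarAddCircle)
      (fun f f' g => by
        rw [← integral_add (conv_int f g) (conv_int f' g)]
        refine integral_congr_ae ?_
        filter_upwards [Lp.coeFn_add f f'] with t ht
        rw [ht]; simp [add_smul])
      (fun c f g => by
        rw [← integral_smul]
        refine integral_congr_ae ?_
        filter_upwards [Lp.coeFn_smul c f] with t ht
        rw [ht]; simp [smul_smul])
      (fun f g g' => by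
        rw [← integral_add (conv_int f g) (conv_int f g')]
        simp only [tau_add, smul_add])
      (fun c f g => by
        rw [← integral_smul]
        simp only [tau_smul, smul_comm c])) 1
    (fun f g => by
      rw [one_mul]
      show ‖∫ t, f t • tau t g ∂haarAddCircle‖ ≤ _
      refine le_trans (norm_integral_le_integral_norm _) ?_
      simp only [norm_smul, tau_norm]
      rw [integral_mul_const]
      gcongr
      exact Xp_norm_one f)

lemma conv_apply (f g : Xp p) : conv f g = ∫ t, f t • tau t g ∂haarAddCircle := rfl

lemma conv_norm_le (f g : Xp p) : ‖conv f g‖ ≤ ‖f‖ * ‖g‖ := by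
  rw [conv_apply]
  refine le_trans (norm_integral_le_integral_norm _) ?_
  simp only [norm_smul, tau_norm]
  rw [integral_mul_const]
  gcongr
  exact Xp_norm_one f

lemma eC_conv (n : ℤ) (f g : Xp p) : eC n (conv f g) = eC n f * eC n g := by
  rw [conv_apply, ← ContinuousLinearMap.integral_comp_comm _ (conv_int f g), eC_apply n f,
    ← integral_mul_const]
  refine integral_congr_ae (Eventually.of_forall fun t => ?_)
  simp only [map_smul, smul_eq_mul, eC_tau]
  ring

lemma eC_fourierLp (n m : ℤ) : eC n (fourierLp (T := (1:ℝ)) p m) = if n = m then 1 else 0 := by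
  have h : eC n (fourierLp (T := (1:ℝ)) p m) =
      ∫ t, fourier (m - n) t ∂(haarAddCircle (T := (1:ℝ))) := by
    rw [eC_apply]
    refine integral_congr_ae ?_
    filter_upwards [coeFn_fourierLp (T := (1:ℝ)) p m] with t ht
    rw [ht, ← fourier_add]
    congr 1; ring_nf
  rw [h]
  have h3 := fourierCoeff_fourier (T := (1:ℝ)) m
  have h4 := congrFun h3 n
  rw [fourierCoeff] at h4
  rw [show (∫ t, fourier (m - n) t ∂(haarAddCircle (T := (1:ℝ)))) = ∫ t, fourier (-n) t • fourier m t ∂(haarAddCircle (T := (1:ℝ))) from ?_, h4]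
  · simp [Pi.single_apply]
  · refine integral_congr_ae (Eventually.of_forall fun t => ?_)
    simp only [smul_eq_mul]
    rw [← fourier_add]
    congr 1; ring_nf

lemma wiener (h : Xp p) :
    ∃ r : Xp p, ∀ n, (1 + eC n h)⁻¹ = 1 + eC n r := by
  -- trigonometric approximation
  have hdense : h ∈ closure (Submodule.span ℂ (Set.range (fourierLp (T := (1:ℝ)) p)) : Set (Xp p)) := by
    rw [← Submodule.topologicalClosure_coe, span_fourierLp_closure_eq_top h2.out]
    trivial
  obtain ⟨P, hP, hPd⟩ := Metric.mem_closure_iff.1 hdense 1 one_pos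
  have hfin : {n : ℤ | eC n P ≠ 0}.Finite := by
    refine Submodule.span_induction (p := fun P _ => {n : ℤ | eC n P ≠ 0}.Finite) ?_ ?_ ?_ ?_ hP
    · rintro _ ⟨m, rfl⟩
      refine (Set.finite_singleton m).subset fun n hn => ?_
      simp only [Set.mem_ofPred_eq, eC_fourierLp] at hn
      by_contra hc
      simp at hc
      simp [hc] at hn
    · simp
    · intro x y _ _ hx hy
      refine (hx.union hy).subset fun n hn => ?_
      simp only [Set.mem_ofPred_eq, map_add, Set.mem_union] at hn ⊢
      by_contra hc
      push Not at hc
      simp [hc.1, hc.2] at hn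
    · intro a x _ hx
      refine hx.subset fun n hn => ?_
      simp only [Set.mem_ofPred_eq, map_smul] at hn ⊢
      exact fun hc => hn (by simp [hc])
  set k : Xp p := h - P with hk
  have hk1 : ‖k‖ < 1 := by rwa [dist_eq_norm] at hPd
  have hC : ‖-(conv k)‖ < 1 := by
    rw [norm_neg]
    refine lt_of_le_of_lt ?_ hk1
    exact ContinuousLinearMap.opNorm_le_bound _ (norm_nonneg _) (conv_norm_le k)
  set u := Units.oneSub (-(conv k)) hC with hu
  set r0 : Xp p := (↑u⁻¹ : Xp p →L[ℂ] Xp p) (-k) with hr0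
  have hr : r0 + conv k r0 = -k := by
    have h5 : (↑u * ↑u⁻¹ : Xp p →L[ℂ] Xp p) (-k) = -k := by
      rw [Units.mul_inv]; rfl
    have h6 : (↑u : Xp p →L[ℂ] Xp p) r0 = -k := h5
    rw [hu, Units.val_oneSub] at h6
    simpa using h6
  have hcoef : ∀ n, (1 + eC n k)⁻¹ = 1 + eC n r0 := by
    intro n
    have h7 := congrArg (eC n) hr
    rw [map_add, eC_conv, map_neg] at h7
    have h8 : 1 + eC n k ≠ 0 := by
      intro h9
      have h10 : eC n k = -1 := by linear_combination h9
      have := eC_norm_le n k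
      rw [h10] at this
      simp at this
      linarith
    exact inv_eq_of_mul_eq_one_right (by linear_combination h7)
  refine ⟨r0 + ∑ m ∈ hfin.toFinset, ((1 + eC m h)⁻¹ - (1 + eC m r0)) • fourierLp p m, fun n => ?_⟩
  rw [map_add, map_sum]
  simp only [map_smul, eC_fourierLp, smul_eq_mul, mul_ite, mul_one, mul_zero]
  rw [Finset.sum_ite_eq]
  split_ifs with hn
  · ring
  · simp only [Set.Finite.mem_toFinset, Set.mem_ofPred_eq, not_not] at hn
    rw [add_zero, ← hcoef n, hk, map_sub, hn, sub_zero]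

/-- the primitive `U(x)` -/
lemma exists_U (v : ℝ → ℂ) (hv : MemLp v p μ01) : ∃ U : ℝ → Xp p, Continuous U ∧
    ∀ x ∈ Set.Icc (0:ℝ) 1, ∀ n : ℤ, eC n (U x) =
      ∫ t in (0:ℝ)..x, Complex.exp (-2 * Real.pi * Complex.I * n * t) * v t := by
  have hm : ∀ x, MemLp ((Set.Iic x).indicator v) p μ01 := fun x => hv.indicator measurableSet_Iic
  refine ⟨fun x => Jc ((hm x).toLp _), ?_, ?_⟩
  · refine Jc.continuous.comp ?_
    rw [Metric.continuous_iff]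
    intro x ε hε
    obtain ⟨δ, hδ, hb⟩ := hv.eLpNorm_indicator_le h1.out h2.out (half_pos hε)
    refine ⟨δ, hδ, fun y hy => ?_⟩
    rw [dist_eq_norm, ← MemLp.toLp_sub, Lp.norm_toLp]
    have key : ∀ a b : ℝ, b ≤ a → a - b < δ →
      eLpNorm ((Set.Iic a).indicator v - (Set.Iic b).indicator v) p μ01 ≤ ENNReal.ofReal (ε/2) := by
      intro a b hab habd
      have : ((Set.Iic a).indicator v - (Set.Iic b).indicator v) = (Set.Ioc b a).indicator v := by
        ext t
        simp only [Pi.sub_apply, Set.indicator_apply, Set.mem_Iic, Set.mem_Ioc]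
        split_ifs <;> first | (exfalso; grind) | simp
      rw [this]
      refine hb _ measurableSet_Ioc ?_
      unfold μ01
      refine (Measure.restrict_apply_le _ _).trans ?_
      rw [Real.volume_Ioc]
      exact ENNReal.ofReal_le_ofReal habd.le
    have h3 : eLpNorm ((Set.Iic y).indicator v - (Set.Iic x).indicator v) p μ01 ≤ ENNReal.ofReal (ε/2) := by
      rw [Real.dist_eq, abs_lt] at hy
      rcases le_total x y with hxy | hxy
      · exact key y x hxy hy.2
      · rw [eLpNorm_sub_comm]
        exact key x y hxy (by linarith)
    refine lt_of_le_of_lt (ENNReal.toReal_mono ENNReal.ofReal_ne_top h3) ?_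
    rw [ENNReal.toReal_ofReal (by linarith)]
    linarith
  · intro x hx n
    rw [eC_Jc, fc_congr (hm x).coeFn_toLp, fc_eq, mu01_eq, intervalIntegral.integral_of_le hx.1]
    have : ∀ t : ℝ, Complex.exp (-2 * Real.pi * Complex.I * n * t) * (Set.Iic x).indicator v t =
      (Set.Iic x).indicator (fun t : ℝ => Complex.exp (-2 * Real.pi * Complex.I * n * t) * v t) t := by
      intro t
      simp only [Set.indicator_apply]; split_ifs <;> simp
    simp only [this]
    rw [integral_indicator measurableSet_Iic, Measure.restrict_restrict measurableSet_Iic]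
    congr 2
    ext t
    simp only [Set.mem_inter_iff, Set.mem_Iic, Set.mem_Ioc]
    exact ⟨fun h => ⟨h.2.1, h.1⟩, fun h => ⟨h.2, h.1, h.2.trans hx.2⟩⟩

end Circle

section Volterra

lemma ac_mul_aux {𝕜 : Type*} [RCLike 𝕜] {P R I f g h : ℝ → 𝕜}
    (acP : AbsolutelyContinuousOnInterval P 0 1) (acR : AbsolutelyContinuousOnInterval R 0 1)
    (acI : AbsolutelyContinuousOnInterval I 0 1)
    (hP : ∀ᵐ x, x ∈ Set.uIcc (0:ℝ) 1 → HasDerivAt P (f x) x)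
    (hR : ∀ᵐ x, x ∈ Set.uIcc (0:ℝ) 1 → HasDerivAt R (g x) x)
    (hI : ∀ᵐ x, x ∈ Set.uIcc (0:ℝ) 1 → HasDerivAt I (h x) x)
    (he : ∀ x ∈ Set.uIcc (0:ℝ) 1, f x * R x + P x * g x = h x) :
    ∃ C, ∀ x ∈ Set.uIcc (0:ℝ) 1, P x * R x - I x = C := by
  have acG : AbsolutelyContinuousOnInterval (fun x => P x * R x - I x) 0 1 :=
    (acP.smul acR).sub acI
  refine acG.const_of_ae_hasDerivAt_zero ?_
  filter_upwards [hP, hR, hI] with x h1 h2 h3 hx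
  have e3 := ((h1 hx).mul (h2 hx)).sub (h3 hx)
  rw [he x hx, sub_self] at e3
  exact e3

lemma ac_prim {𝕜 : Type*} [RCLike 𝕜] {f : ℝ → 𝕜} (P0 : 𝕜)
    (hf : IntervalIntegrable f volume 0 1) :
    AbsolutelyContinuousOnInterval (fun x => P0 + ∫ t in (0:ℝ)..x, f t) 0 1 ∧
    ∀ᵐ x, x ∈ Set.uIcc (0:ℝ) 1 → HasDerivAt (fun x => P0 + ∫ t in (0:ℝ)..x, f t) (f x) x := by
  have h0 : (0:ℝ) ∈ Set.uIcc (0:ℝ) 1 := by simp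
  constructor
  · have hN := hf.norm.absolutelyContinuousOnInterval_intervalIntegral h0
    rw [absolutelyContinuousOnInterval_iff] at hN ⊢
    intro ε hε
    obtain ⟨δ, hδ, H⟩ := hN ε hε
    refine ⟨δ, hδ, fun E hE hs => lt_of_le_of_lt (Finset.sum_le_sum fun i hi => ?_) (H E hE hs)⟩
    obtain ⟨m1, m2⟩ := hE.1 i hi
    have i1 : IntervalIntegrable f volume 0 (E.2 i).1 :=
      hf.mono_set (Set.uIcc_subset_uIcc h0 m1)
    have i2 : IntervalIntegrable f volume 0 (E.2 i).2 :=
      hf.mono_set (Set.uIcc_subset_uIcc h0 m2)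
    rw [dist_eq_norm, dist_eq_norm, add_sub_add_left_eq_sub,
      intervalIntegral.integral_interval_sub_left i1 i2,
      intervalIntegral.integral_interval_sub_left i1.norm i2.norm]
    exact intervalIntegral.norm_integral_le_abs_integral_norm
  · filter_upwards [hf.ae_hasDerivAt_integral] with x h1 hx
    exact (h1 hx 0 h0).const_add P0

lemma ac_mul {𝕜 : Type*} [RCLike 𝕜] {f g P R : ℝ → 𝕜} {P0 R0 : 𝕜}
    (hf : IntervalIntegrable f volume 0 1) (hg : IntervalIntegrable g volume 0 1)
    (hP : ∀ x ∈ Set.Icc (0:ℝ) 1, P x = P0 + ∫ t in (0:ℝ)..x, f t)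
    (hR : ∀ x ∈ Set.Icc (0:ℝ) 1, R x = R0 + ∫ t in (0:ℝ)..x, g t) :
    IntervalIntegrable (fun t => f t * R t + P t * g t) volume 0 1 ∧
    ∀ x ∈ Set.Icc (0:ℝ) 1, P x * R x = P0 * R0 + ∫ t in (0:ℝ)..x, (f t * R t + P t * g t) := by
  have hu : Set.uIcc (0:ℝ) 1 = Set.Icc 0 1 := Set.uIcc_of_le zero_le_one
  obtain ⟨acP, dP⟩ := ac_prim P0 hf
  obtain ⟨acR, dR⟩ := ac_prim R0 hg
  have hPc : ContinuousOn P (Set.uIcc 0 1) :=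
    acP.continuousOn.congr fun x hx => hP x (hu.subset hx)
  have hRc : ContinuousOn R (Set.uIcc 0 1) :=
    acR.continuousOn.congr fun x hx => hR x (hu.subset hx)
  have hI : IntervalIntegrable (fun t => f t * R t + P t * g t) volume 0 1 :=
    (hf.mul_continuousOn hRc).add (hg.continuousOn_mul hPc)
  refine ⟨hI, fun x hx => ?_⟩
  obtain ⟨acI, dI⟩ := ac_prim 0 hI
  obtain ⟨C, hC⟩ := ac_mul_aux acP acR acI dP dR dI (fun x hx => by
    rw [hP x (hu.subset hx), hR x (hu.subset hx)])
  have a1 := hC x (hu.symm.subset hx)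
  have a2 := hC 0 (by simp)
  simp only [intervalIntegral.integral_same, add_zero, sub_zero, zero_add] at a1 a2
  rw [hP x hx, hR x hx, a2, ← a1]
  ring

lemma int_mono {E : Type*} [NormedAddCommGroup E] {f : ℝ → E} (hf : IntervalIntegrable f volume 0 1) {x : ℝ}
    (hx : x ∈ Set.Icc (0:ℝ) 1) : IntervalIntegrable f volume 0 x :=
  hf.mono_set (by rw [Set.uIcc_of_le hx.1, Set.uIcc_of_le zero_le_one]; exact Set.Icc_subset_Icc_right hx.2)

lemma pow_int {m : ℝ → ℝ} (hm : IntervalIntegrable m volume 0 1) (n : ℕ) :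
    IntervalIntegrable (fun t => m t * (∫ s in (0:ℝ)..t, m s) ^ n) volume 0 1 ∧
    ∀ x ∈ Set.Icc (0:ℝ) 1, (∫ s in (0:ℝ)..x, m s) ^ (n + 1) =
      0 + ∫ t in (0:ℝ)..x, (n + 1) * (m t * (∫ s in (0:ℝ)..t, m s) ^ n) := by
  induction n with
  | zero => simpa using hm
  | succ n ih =>
    have h := ac_mul (P := fun x => ∫ s in (0:ℝ)..x, m s)
      (R := fun x => (∫ s in (0:ℝ)..x, m s) ^ (n + 1)) (P0 := 0) (R0 := 0) hm (ih.1.const_mul _)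
      (fun x _ => by simp) ih.2
    have heq : ∀ t, m t * (∫ s in (0:ℝ)..t, m s) ^ (n + 1) +
        (∫ s in (0:ℝ)..t, m s) * ((n + 1) * (m t * (∫ s in (0:ℝ)..t, m s) ^ n)) =
        ((n + 1 : ℕ) + 1) * (m t * (∫ s in (0:ℝ)..t, m s) ^ (n + 1)) := by
      intro t; push_cast; ring
    simp only [heq] at h
    refine ⟨?_, fun x hx => ?_⟩
    · have h3 := h.1.const_mul (((n + 1 : ℕ) + 1 : ℝ)⁻¹)
      refine h3.congr (fun t _ => ?_)
      rw [inv_mul_cancel_left₀]; positivity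
    · have := h.2 x hx
      rw [zero_mul] at this
      rw [← this]; ring

lemma pow_int_fact {m : ℝ → ℝ} (hm : IntervalIntegrable m volume 0 1) (n : ℕ) (C : ℝ) :
    IntervalIntegrable (fun t => m t * (C * (∫ s in (0:ℝ)..t, m s) ^ n / n.factorial)) volume 0 1 ∧
    ∀ x ∈ Set.Icc (0:ℝ) 1, 
      ∫ t in (0:ℝ)..x, m t * (C * (∫ s in (0:ℝ)..t, m s) ^ n / n.factorial) =
       C * (∫ s in (0:ℝ)..x, m s) ^ (n + 1) / (n + 1).factorial := by
  obtain ⟨h1, h2⟩ := pow_int hm n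
  have heq : ∀ t, m t * (C * (∫ s in (0:ℝ)..t, m s) ^ n / n.factorial) =
      (C / (n + 1).factorial) * ((n + 1) * (m t * (∫ s in (0:ℝ)..t, m s) ^ n)) := by
    intro t
    rw [Nat.factorial_succ]
    push_cast
    have : (n.factorial : ℝ) ≠ 0 := by positivity
    have : (n + 1 : ℝ) ≠ 0 := by positivity
    field_simp
  simp only [heq]
  refine ⟨(h1.const_mul _).const_mul _, fun x hx => ?_⟩
  rw [intervalIntegral.integral_const_mul, h2 x hx]
  ring

lemma gronwall {m d : ℝ → ℝ} (hm : IntervalIntegrable m volume 0 1) (hm0 : ∀ t, 0 ≤ m t)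
    (hd : ContinuousOn d (Set.Icc 0 1))
    (h : ∀ x ∈ Set.Icc (0:ℝ) 1, d x ≤ ∫ t in (0:ℝ)..x, m t * d t) :
    ∀ x ∈ Set.Icc (0:ℝ) 1, d x ≤ 0 := by
  obtain ⟨C, hC⟩ := isCompact_Icc.exists_bound_of_continuousOn hd
  have hb : ∀ n : ℕ, ∀ x ∈ Set.Icc (0:ℝ) 1, d x ≤ C * (∫ s in (0:ℝ)..x, m s) ^ n / n.factorial := by
    intro n
    induction n with
    | zero => 
      intro x hx
      simpa using (le_abs_self _).trans (hC x hx)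
    | succ n ih =>
      intro x hx
      obtain ⟨h1, h2⟩ := pow_int_fact hm n C
      rw [← h2 x hx]
      refine (h x hx).trans ?_
      refine intervalIntegral.integral_mono_on hx.1 ?_ (int_mono h1 hx) ?_
      · exact int_mono (hm.mul_continuousOn (by rwa [Set.uIcc_of_le zero_le_one])) hx
      · intro t ht
        exact mul_le_mul_of_nonneg_left (ih t ⟨ht.1, ht.2.trans hx.2⟩) (hm0 t)
  intro x hx
  have ht : Tendsto (fun n : ℕ => C * (∫ s in (0:ℝ)..x, m s) ^ n / n.factorial) atTop (nhds 0) := by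
    have := (FloorSemiring.tendsto_pow_div_factorial_atTop (∫ s in (0:ℝ)..x, m s)).const_mul C
    simpa [mul_div_assoc] using this
  exact ge_of_tendsto' ht (fun n => hb n x hx)

lemma volterra {X : Type*} [NormedAddCommGroup X] [NormedSpace ℝ X] [CompleteSpace X]
    {m : ℝ → ℝ} (hm : IntervalIntegrable m volume 0 1) (hm0 : ∀ t, 0 ≤ m t)
    (A : ℝ → X → X) (hA : ∀ t x y, ‖A t x - A t y‖ ≤ m t * ‖x - y‖)
    (hAi : ∀ w : ℝ → X, Continuous w → IntervalIntegrable (fun t => A t (w t)) volume 0 1)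
    (F : ℝ → X) (hF : Continuous F) :
    ∃ w : ℝ → X, Continuous w ∧
      ∀ x ∈ Set.Icc (0:ℝ) 1, w x = F x + ∫ t in (0:ℝ)..x, A t (w t) := by
  let I := Set.Icc (0:ℝ) 1
  let ext : C(I, X) → ℝ → X := fun w t => w (Set.projIcc 0 1 zero_le_one t)
  have hext : ∀ w, Continuous (ext w) := fun w => w.continuous.comp continuous_projIcc
  let Φ : C(I, X) → C(I, X) := fun w =>
    ⟨fun x => F x + ∫ t in (0:ℝ)..x, A t (ext w t), by
      refine (hF.comp continuous_subtype_val).add ?_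
      have h := intervalIntegral.continuousOn_primitive_interval (f := fun t => A t (ext w t))
        (a := 0) (b := 1) (μ := volume) (by
          rw [Set.uIcc_of_le zero_le_one, ← intervalIntegrable_iff_integrableOn_Icc_of_le zero_le_one]
          exact hAi _ (hext w))
      rw [Set.uIcc_of_le zero_le_one] at h
      exact continuousOn_iff_continuous_domRestrict.1 h⟩
  have hext_app : ∀ (w : C(I, X)) (t : ℝ) (ht : t ∈ I), ext w t = w ⟨t, ht⟩ := by
    intro w t ht
    simp only [ext, Set.projIcc_of_mem _ ht]
  have hiter : ∀ (w w' : C(I, X)) (n : ℕ) (x : I),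
      ‖(Φ^[n] w) x - (Φ^[n] w') x‖ ≤ dist w w' * (∫ s in (0:ℝ)..x, m s) ^ n / n.factorial := by
    intro w w' n
    induction n with
    | zero => 
      intro x
      simp only [Function.iterate_zero, id_eq, pow_zero, mul_one, Nat.factorial_zero, Nat.cast_one, div_one]
      rw [← dist_eq_norm]; exact ContinuousMap.dist_apply_le_dist x
    | succ n ih =>
      intro x
      rw [Function.iterate_succ_apply', Function.iterate_succ_apply']
      obtain ⟨h1, h2⟩ := pow_int_fact hm n (dist w w')
      rw [← h2 x x.2]
      set a := Φ^[n] w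
      set b := Φ^[n] w'
      have e : (Φ a) x - (Φ b) x = ∫ t in (0:ℝ)..x, (A t (ext a t) - A t (ext b t)) := by
        rw [intervalIntegral.integral_sub (int_mono (hAi _ (hext a)) x.2) (int_mono (hAi _ (hext b)) x.2)]
        simp only [Φ, ContinuousMap.coe_mk]
        abel
      rw [e]
      refine intervalIntegral.norm_integral_le_of_norm_le x.2.1 ?_ (int_mono h1 x.2)
      refine Eventually.of_forall fun t ht => ?_
      have ht' : t ∈ I := ⟨ht.1.le, ht.2.trans x.2.2⟩
      refine (hA _ _ _).trans ?_
      refine mul_le_mul_of_nonneg_left ?_ (hm0 t)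
      rw [hext_app a t ht', hext_app b t ht']
      exact ih ⟨t, ht'⟩
  set L := ∫ s in (0:ℝ)..1, m s with hL
  have hL0 : 0 ≤ L := intervalIntegral.integral_nonneg zero_le_one (fun t _ => hm0 t)
  obtain ⟨n, hn⟩ : ∃ n : ℕ, L ^ n / n.factorial < 1 :=
    ((FloorSemiring.tendsto_pow_div_factorial_atTop L).eventually (gt_mem_nhds one_pos)).exists
  obtain ⟨K, hK⟩ : ∃ K : NNReal, (K : ℝ) = L ^ n / n.factorial :=
    ⟨⟨L ^ n / n.factorial, by positivity⟩, rfl⟩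
  have hcon : ContractingWith K (Φ^[n]) := by
    refine ⟨by rw [← hK] at hn; exact_mod_cast hn, LipschitzWith.of_dist_le_mul fun w w' => ?_⟩
    rw [ContinuousMap.dist_le (by positivity)]
    intro x
    rw [dist_eq_norm]
    refine (hiter w w' n x).trans ?_
    rw [hK, mul_comm (L ^ n / _), mul_div_assoc]
    refine mul_le_mul_of_nonneg_left ?_ dist_nonneg
    have hx0 : 0 ≤ ∫ s in (0:ℝ)..x, m s := intervalIntegral.integral_nonneg x.2.1 (fun t _ => hm0 t)
    have hxL : ∫ s in (0:ℝ)..x, m s ≤ L := by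
      refine intervalIntegral.integral_mono_interval le_rfl x.2.1 x.2.2 ?_ hm
      exact Eventually.of_forall hm0
    gcongr
  have hfix := hcon.isFixedPt_fixedPoint_iterate
  set w := ContractingWith.fixedPoint _ hcon
  refine ⟨ext w, hext w, fun x hx => ?_⟩
  rw [hext_app w x hx]
  have : (Φ w) ⟨x, hx⟩ = w ⟨x, hx⟩ := by rw [hfix.eq]
  exact this.symm

end Volterra

section System

open AddCircle

lemma memLp_ii {p : ℝ≥0∞} (hp : 1 ≤ p) {a : ℝ → ℂ} (ha : MemLp a p μ01) :
    IntervalIntegrable a volume 0 1 := by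
  rw [intervalIntegrable_iff_integrableOn_Ioc_of_le zero_le_one]
  have := ha.integrable hp
  rwa [mu01_eq] at this

variable {p : ℝ≥0∞} [hp1 : Fact (1 ≤ p)] [hpt : Fact (p ≠ ∞)]

/-- the right-hand side of the lifted system -/
def sysA (G : Xp p) (a b : ℝ → ℂ) (t : ℝ) (w : Xp p × Xp p) : Xp p × Xp p :=
  (Complex.I • conv G w.1 + a t • tau (t : UnitAddCircle) w.2,
   (-Complex.I) • conv G w.2 + b t • tau (-(t : UnitAddCircle)) w.1)

lemma sysA_lip (G : Xp p) (a b : ℝ → ℂ) (t : ℝ) (w w' : Xp p × Xp p) :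
    ‖sysA G a b t w - sysA G a b t w'‖ ≤ (‖G‖ + ‖a t‖ + ‖b t‖) * ‖w - w'‖ := by
  have h1 : ‖w.1 - w'.1‖ ≤ ‖w - w'‖ := norm_fst_le (w - w')
  have h2 : ‖w.2 - w'.2‖ ≤ ‖w - w'‖ := norm_snd_le (w - w')
  have hn := norm_nonneg (w - w')
  have e1 : (sysA G a b t w - sysA G a b t w').1 =
      Complex.I • conv G (w.1 - w'.1) + a t • tau (t : UnitAddCircle) (w.2 - w'.2) := by
    simp only [sysA, Prod.fst_sub, map_sub, tau_sub, smul_sub]; abel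
  have e2 : (sysA G a b t w - sysA G a b t w').2 =
      (-Complex.I) • conv G (w.2 - w'.2) + b t • tau (-(t : UnitAddCircle)) (w.1 - w'.1) := by
    simp only [sysA, Prod.snd_sub, map_sub, tau_sub, smul_sub]; abel
  refine norm_prod_le_iff.2 ⟨?_, ?_⟩
  · rw [e1]
    refine (norm_add_le _ _).trans ?_
    rw [norm_smul, norm_smul, tau_norm, Complex.norm_I, one_mul]
    have := conv_norm_le G (w.1 - w'.1)
    have k1 := mul_le_mul_of_nonneg_left h1 (norm_nonneg G)
    have k2 := mul_le_mul_of_nonneg_left h2 (norm_nonneg (a t))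
    have k3 := mul_nonneg (norm_nonneg (b t)) hn
    linarith
  · rw [e2]
    refine (norm_add_le _ _).trans ?_
    rw [norm_smul, norm_smul, tau_norm, norm_neg, Complex.norm_I, one_mul]
    have := conv_norm_le G (w.2 - w'.2)
    have k1 := mul_le_mul_of_nonneg_left h2 (norm_nonneg G)
    have k2 := mul_le_mul_of_nonneg_left h1 (norm_nonneg (b t))
    have k3 := mul_nonneg (norm_nonneg (a t)) hn
    linarith

lemma sysA_int (G : Xp p) {a b : ℝ → ℂ} (ha : IntervalIntegrable a volume 0 1)
    (hb : IntervalIntegrable b volume 0 1) (w : ℝ → Xp p × Xp p) (hw : Continuous w) :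
    IntervalIntegrable (fun t => sysA G a b t (w t)) volume 0 1 := by
  have c1 : Continuous (fun t => (w t).1) := continuous_fst.comp hw
  have c2 : Continuous (fun t => (w t).2) := continuous_snd.comp hw
  have cm : Continuous (fun t : ℝ => (t : UnitAddCircle)) := AddCircle.continuous_mk' 1
  have t1 : Continuous (fun t : ℝ => tau (t : UnitAddCircle) (w t).2) :=
    Continuous.comp (g := fun q : UnitAddCircle × Xp p => tau q.1 q.2)
      (f := fun t : ℝ => ((t : UnitAddCircle), (w t).2)) tau_cont (cm.prodMk c2)
  have t2 : Continuous (fun t : ℝ => tau (-(t : UnitAddCircle)) (w t).1) :=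
    Continuous.comp (g := fun q : UnitAddCircle × Xp p => tau q.1 q.2)
      (f := fun t : ℝ => (-(t : UnitAddCircle), (w t).1)) tau_cont (cm.neg.prodMk c1)
  have d1 : Continuous (fun t => Complex.I • conv G (w t).1) :=
    (Complex.I • conv G).continuous.comp c1
  have d2 : Continuous (fun t => (-Complex.I) • conv G (w t).2) :=
    ((-Complex.I) • conv G).continuous.comp c2
  have i1 := (d1.intervalIntegrable (μ := volume) 0 1).add (ha.smul_continuousOn t1.continuousOn)
  have i2 := (d2.intervalIntegrable (μ := volume) 0 1).add (hb.smul_continuousOn t2.continuousOn)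
  exact ⟨i1.1.prodMk i2.1, i1.2.prodMk i2.2⟩

lemma system_exists (G : Xp p) (a b : ℝ → ℂ) (ha : MemLp a p μ01) (hb : MemLp b p μ01) :
    ∃ y z : ℝ → Xp p, Continuous y ∧ Continuous z ∧ ∀ n : ℤ, ∀ x ∈ Set.Icc (0:ℝ) 1,
      (1 + eC n (y x) = 1 + ∫ t in (0:ℝ)..x, (Complex.I * eC n G * (1 + eC n (y t)) +
        Complex.exp (-2 * Real.pi * Complex.I * n * t) * a t * (1 + eC n (z t)))) ∧
      (1 + eC n (z x) = 1 + ∫ t in (0:ℝ)..x, (-Complex.I * eC n G * (1 + eC n (z t)) +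
        Complex.exp (2 * Real.pi * Complex.I * n * t) * b t * (1 + eC n (y t)))) := by
  have ha' := memLp_ii hp1.out ha
  have hb' := memLp_ii hp1.out hb
  obtain ⟨U, hU, hUe⟩ := exists_U (p := p) a ha
  obtain ⟨W, hW, hWe⟩ := exists_U (p := p) b hb
  obtain ⟨w, hw, hwe⟩ := volterra (X := Xp p × Xp p) (m := fun t => ‖G‖ + ‖a t‖ + ‖b t‖)
    ((intervalIntegrable_const.add ha'.norm).add hb'.norm) (fun t => by positivity)
    (sysA G a b) (sysA_lip G a b) (sysA_int G ha' hb')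
    (fun x => (U x + (Complex.I * (x:ℂ)) • G, Rf (W x) + (-Complex.I * (x:ℂ)) • G))
    (by
      have : Continuous (fun x : ℝ => (x:ℂ)) := Complex.continuous_ofReal
      refine Continuous.prodMk ?_ ?_
      · exact hU.add ((continuous_const.mul this).smul continuous_const)
      · exact (Rf.continuous.comp hW).add ((continuous_const.mul this).smul continuous_const))
  have cy : Continuous (fun t => (w t).1) := continuous_fst.comp hw
  have cz : Continuous (fun t => (w t).2) := continuous_snd.comp hw
  refine ⟨fun t => (w t).1, fun t => (w t).2, cy, cz, fun n x hx => ?_⟩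
  have hI := int_mono (sysA_int G ha' hb' w hw) hx
  have ce1 : Continuous (fun t : ℝ => Complex.exp (-2 * Real.pi * Complex.I * n * t)) := by fun_prop
  have ce2 : Continuous (fun t : ℝ => Complex.exp (2 * Real.pi * Complex.I * n * t)) := by fun_prop
  have cny : Continuous (fun t => eC n (w t).1) := (eC n).continuous.comp cy
  have cnz : Continuous (fun t => eC n (w t).2) := (eC n).continuous.comp cz
  have ha'' := int_mono ha' hx
  have hb'' := int_mono hb' hx
  have f2 : ∀ t : ℝ, fourier (-n) (-(t : UnitAddCircle)) =
      Complex.exp (2 * Real.pi * Complex.I * n * t) := by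
    intro t
    have := fourier_coe n (-t)
    rw [AddCircle.coe_neg] at this
    rw [this]
    congr 1; push_cast; ring
  constructor
  · have e := congrArg (fun q : Xp p × Xp p => eC n q.1) (hwe x hx)
    have L := ((eC n).comp (ContinuousLinearMap.fst ℂ (Xp p) (Xp p))).intervalIntegral_comp_comm hI
    simp only [Prod.fst_add, map_add, map_smul, smul_eq_mul, hUe x hx n,
      ContinuousLinearMap.comp_apply, ContinuousLinearMap.coe_fst'] at e L
    rw [← L] at e
    rw [e]
    simp only [sysA, map_add, map_smul, smul_eq_mul, eC_conv, eC_tau, fourier_coe]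
    have k1 : (Complex.I * (x:ℂ)) * eC n G = ∫ t in (0:ℝ)..x, Complex.I * eC n G := by
      rw [intervalIntegral.integral_const, Complex.real_smul]; push_cast; ring
    rw [k1]
    have j1 : IntervalIntegrable (fun t : ℝ => Complex.exp (-2 * Real.pi * Complex.I * n * t) * a t)
      volume 0 x := ha''.continuousOn_mul ce1.continuousOn
    have j2 : IntervalIntegrable (fun t : ℝ => Complex.I * eC n G) volume 0 x :=
      intervalIntegrable_const
    have j3 : IntervalIntegrable (fun t : ℝ => Complex.I * (eC n G * eC n (w t).1) +
        a t * (Complex.exp (-2 * Real.pi * Complex.I * n * t) * eC n (w t).2)) volume 0 x :=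
      (Continuous.intervalIntegrable (by fun_prop) _ _).add
        (ha''.mul_continuousOn (ce1.mul cnz).continuousOn)
    rw [← intervalIntegral.integral_add j1 j2, ← intervalIntegral.integral_add (j1.add j2) j3]
    congr 2
    ext t; ring
  · have e := congrArg (fun q : Xp p × Xp p => eC n q.2) (hwe x hx)
    have L := ((eC n).comp (ContinuousLinearMap.snd ℂ (Xp p) (Xp p))).intervalIntegral_comp_comm hI
    simp only [Prod.snd_add, map_add, map_smul, smul_eq_mul, eC_Rf, hWe x hx (-n),
      ContinuousLinearMap.comp_apply, ContinuousLinearMap.coe_snd'] at e L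
    rw [← L] at e
    rw [e]
    simp only [sysA, map_add, map_smul, smul_eq_mul, eC_conv, eC_tau, f2]
    have k0 : ∀ t : ℝ, Complex.exp (-2 * Real.pi * Complex.I * ((-n : ℤ) : ℂ) * t) =
        Complex.exp (2 * Real.pi * Complex.I * n * t) := by
      intro t; congr 1; push_cast; ring
    simp only [k0]
    have k1 : (-Complex.I * (x:ℂ)) * eC n G = ∫ t in (0:ℝ)..x, -Complex.I * eC n G := by
      rw [intervalIntegral.integral_const, Complex.real_smul]; push_cast; ring
    rw [k1]
    have j1 : IntervalIntegrable (fun t : ℝ => Complex.exp (2 * Real.pi * Complex.I * n * t) * b t)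
      volume 0 x := hb''.continuousOn_mul ce2.continuousOn
    have j2 : IntervalIntegrable (fun t : ℝ => -Complex.I * eC n G) volume 0 x :=
      intervalIntegrable_const
    have j3 : IntervalIntegrable (fun t : ℝ => -Complex.I * (eC n G * eC n (w t).2) +
        b t * (Complex.exp (2 * Real.pi * Complex.I * n * t) * eC n (w t).1)) volume 0 x :=
      (Continuous.intervalIntegrable (by fun_prop) _ _).add
        (hb''.mul_continuousOn (ce2.mul cny).continuousOn)
    rw [← intervalIntegral.integral_add j1 j2, ← intervalIntegral.integral_add (j1.add j2) j3]
    congr 2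
    ext t; ring

end System

section Scalar

lemma cont_of_int {f P : ℝ → ℂ} {P0 : ℂ} (hf : IntervalIntegrable f volume 0 1)
    (hP : ∀ x ∈ Set.Icc (0:ℝ) 1, P x = P0 + ∫ t in (0:ℝ)..x, f t) :
    ContinuousOn P (Set.Icc 0 1) := by
  have h := (ac_prim P0 hf).1.continuousOn
  rw [Set.uIcc_of_le zero_le_one] at h
  exact h.congr hP

lemma diff_bound {k : ℂ} {A Y Z Y2 Z2 : ℝ → ℂ} {Y0 : ℂ} (hA : IntervalIntegrable A volume 0 1)
    (hY : ContinuousOn Y (Set.Icc 0 1)) (hZ : ContinuousOn Z (Set.Icc 0 1))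
    (hY2 : ContinuousOn Y2 (Set.Icc 0 1)) (hZ2 : ContinuousOn Z2 (Set.Icc 0 1))
    (e1 : ∀ x ∈ Set.Icc (0:ℝ) 1, Y x = Y0 + ∫ t in (0:ℝ)..x, (k * Y t + A t * Z t))
    (e2 : ∀ x ∈ Set.Icc (0:ℝ) 1, Y2 x = Y0 + ∫ t in (0:ℝ)..x, (k * Y2 t + A t * Z2 t)) :
    IntervalIntegrable (fun t => ‖k‖ * ‖Y t - Y2 t‖ + ‖A t‖ * ‖Z t - Z2 t‖) volume 0 1 ∧
    ∀ x ∈ Set.Icc (0:ℝ) 1, ‖Y x - Y2 x‖ ≤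
      ∫ t in (0:ℝ)..x, (‖k‖ * ‖Y t - Y2 t‖ + ‖A t‖ * ‖Z t - Z2 t‖) := by
  have hu : Set.uIcc (0:ℝ) 1 = Set.Icc 0 1 := Set.uIcc_of_le zero_le_one
  rw [← hu] at hY hZ hY2 hZ2
  have i1 : IntervalIntegrable (fun t => k * Y t + A t * Z t) volume 0 1 :=
    (hY.intervalIntegrable.const_mul k).add (hA.mul_continuousOn hZ)
  have i2 : IntervalIntegrable (fun t => k * Y2 t + A t * Z2 t) volume 0 1 :=
    (hY2.intervalIntegrable.const_mul k).add (hA.mul_continuousOn hZ2)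
  have i3 : IntervalIntegrable (fun t => ‖k‖ * ‖Y t - Y2 t‖ + ‖A t‖ * ‖Z t - Z2 t‖) volume 0 1 :=
    ((hY.sub hY2).norm.intervalIntegrable.const_mul ‖k‖).add
      (hA.norm.mul_continuousOn (hZ.sub hZ2).norm)
  refine ⟨i3, fun x hx => ?_⟩
  rw [e1 x hx, e2 x hx, add_sub_add_left_eq_sub,
    ← intervalIntegral.integral_sub (int_mono i1 hx) (int_mono i2 hx)]
  refine intervalIntegral.norm_integral_le_of_norm_le hx.1 (Eventually.of_forall fun t _ => ?_)
    (int_mono i3 hx)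
  have : k * Y t + A t * Z t - (k * Y2 t + A t * Z2 t) =
    k * (Y t - Y2 t) + A t * (Z t - Z2 t) := by ring
  rw [this]
  refine (norm_add_le _ _).trans ?_
  rw [norm_mul, norm_mul]

lemma scal_unique {k1 k2 : ℂ} {A B Y Z Y2 Z2 : ℝ → ℂ} {Y0 Z0 : ℂ}
    (hA : IntervalIntegrable A volume 0 1) (hB : IntervalIntegrable B volume 0 1)
    (hY : ContinuousOn Y (Set.Icc 0 1)) (hZ : ContinuousOn Z (Set.Icc 0 1))
    (hY2 : ContinuousOn Y2 (Set.Icc 0 1)) (hZ2 : ContinuousOn Z2 (Set.Icc 0 1))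
    (e1 : ∀ x ∈ Set.Icc (0:ℝ) 1, Y x = Y0 + ∫ t in (0:ℝ)..x, (k1 * Y t + A t * Z t))
    (e2 : ∀ x ∈ Set.Icc (0:ℝ) 1, Y2 x = Y0 + ∫ t in (0:ℝ)..x, (k1 * Y2 t + A t * Z2 t))
    (e3 : ∀ x ∈ Set.Icc (0:ℝ) 1, Z x = Z0 + ∫ t in (0:ℝ)..x, (k2 * Z t + B t * Y t))
    (e4 : ∀ x ∈ Set.Icc (0:ℝ) 1, Z2 x = Z0 + ∫ t in (0:ℝ)..x, (k2 * Z2 t + B t * Y2 t)) :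
    ∀ x ∈ Set.Icc (0:ℝ) 1, Y x = Y2 x ∧ Z x = Z2 x := by
  have hu : Set.uIcc (0:ℝ) 1 = Set.Icc 0 1 := Set.uIcc_of_le zero_le_one
  obtain ⟨i1, b1⟩ := diff_bound hA hY hZ hY2 hZ2 e1 e2
  obtain ⟨i2, b2⟩ := diff_bound hB hZ hY hZ2 hY2 e3 e4
  have hm : IntervalIntegrable (fun t => ‖k1‖ + ‖k2‖ + ‖A t‖ + ‖B t‖) volume 0 1 :=
    (intervalIntegrable_const.add hA.norm).add hB.norm
  have hd : ContinuousOn (fun x => ‖Y x - Y2 x‖ + ‖Z x - Z2 x‖) (Set.Icc 0 1) :=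
    (hY.sub hY2).norm.add (hZ.sub hZ2).norm
  have key := gronwall hm (fun t => by positivity) hd (fun x hx => by
    refine (add_le_add (b1 x hx) (b2 x hx)).trans ?_
    rw [← intervalIntegral.integral_add (int_mono i1 hx) (int_mono i2 hx)]
    refine intervalIntegral.integral_mono_on hx.1 ((int_mono i1 hx).add (int_mono i2 hx))
      (int_mono (hm.mul_continuousOn (by rw [hu]; exact hd)) hx) (fun t _ => ?_)
    have n1 := norm_nonneg (Y t - Y2 t)
    have n2 := norm_nonneg (Z t - Z2 t)
    have p1 := mul_nonneg (norm_nonneg k1) n2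
    have p2 := mul_nonneg (norm_nonneg k2) n1
    have p3 := mul_nonneg (norm_nonneg (A t)) n1
    have p4 := mul_nonneg (norm_nonneg (B t)) n2
    nlinarith)
  intro x hx
  have := key x hx
  have n1 := norm_nonneg (Y x - Y2 x)
  have n2 := norm_nonneg (Z x - Z2 x)
  exact ⟨sub_eq_zero.1 (norm_eq_zero.1 (by linarith)), sub_eq_zero.1 (norm_eq_zero.1 (by linarith))⟩

lemma exp_ac {f P : ℝ → ℂ} {P0 : ℂ} (s : ℂ) (hf : IntervalIntegrable f volume 0 1)
    (hP : ∀ x ∈ Set.Icc (0:ℝ) 1, P x = P0 + ∫ t in (0:ℝ)..x, f t) :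
    IntervalIntegrable (fun t : ℝ => s * Complex.exp (s * t) * P t + Complex.exp (s * t) * f t)
      volume 0 1 ∧
    ∀ x ∈ Set.Icc (0:ℝ) 1, Complex.exp (s * x) * P x =
      P0 + ∫ t in (0:ℝ)..x, (s * Complex.exp (s * t) * P t + Complex.exp (s * t) * f t) := by
  have hc : Continuous (fun t : ℝ => s * Complex.exp (s * t)) := by fun_prop
  have h := ac_mul (P := fun x : ℝ => Complex.exp (s * x)) (P0 := 1)
    (hc.intervalIntegrable 0 1) hf (fun x _ => by
      have hd : ∀ t ∈ Set.uIcc 0 x, HasDerivAt (fun t : ℝ => Complex.exp (s * t))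
          (s * Complex.exp (s * t)) t := by
        intro t _
        have h1 : HasDerivAt (fun t : ℝ => s * (t:ℂ)) (s * 1) t :=
          (Complex.ofRealCLM.hasDerivAt (x := t)).const_mul s
        have h2 := h1.cexp
        rwa [mul_one, mul_comm] at h2
      rw [intervalIntegral.integral_eq_sub_of_hasDerivAt hd (hc.intervalIntegrable 0 x)]
      simp) hP
  simpa using h

lemma sol_system {Q : ℝ → M2} {q1 q2 : ℝ → ℝ}
    (hQ : ∀ x, Q x = !![(q1 x : ℂ), (q2 x : ℂ); (q2 x : ℂ), -(q1 x : ℂ)])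
    {l : ℝ} {c : ℝ → Fin 2 → ℂ} (hc : IsVecSolution Q l c) (h0 : c 0 = ![1, 0]) :
    ∃ f g : ℝ → ℂ, IntervalIntegrable f volume 0 1 ∧ IntervalIntegrable g volume 0 1 ∧
      (∀ x ∈ Set.Icc (0:ℝ) 1, c x 0 + Complex.I * c x 1 = 1 + ∫ t in (0:ℝ)..x, f t) ∧
      (∀ x ∈ Set.Icc (0:ℝ) 1, c x 0 - Complex.I * c x 1 = 1 + ∫ t in (0:ℝ)..x, g t) ∧
      (∀ᵐ x ∂μ01, f x = Complex.I * l * (c x 0 + Complex.I * c x 1) +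
        (q2 x - Complex.I * q1 x) * (c x 0 - Complex.I * c x 1)) ∧
      (∀ᵐ x ∂μ01, g x = -Complex.I * l * (c x 0 - Complex.I * c x 1) +
        (q2 x + Complex.I * q1 x) * (c x 0 + Complex.I * c x 1)) := by
  obtain ⟨u, hu, hcu, heq⟩ := hc
  have hui : IntervalIntegrable u volume 0 1 := by
    rw [intervalIntegrable_iff_integrableOn_Ioc_of_le zero_le_one]
    have h1 : Integrable u μ01 := hu
    rwa [mu01_eq] at h1
  have hj : ∀ j : Fin 2, IntervalIntegrable (fun t => u t j) volume 0 1 := fun j =>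
    ⟨(ContinuousLinearMap.proj (R := ℂ) (φ := fun _ : Fin 2 => ℂ) j).integrable_comp hui.1,
     (ContinuousLinearMap.proj (R := ℂ) (φ := fun _ : Fin 2 => ℂ) j).integrable_comp hui.2⟩
  have hcj : ∀ j : Fin 2, ∀ x ∈ Set.Icc (0:ℝ) 1, c x j = c 0 j + ∫ t in (0:ℝ)..x, u t j := by
    intro j x hx
    have L := (ContinuousLinearMap.proj (R := ℂ) (φ := fun _ : Fin 2 => ℂ)
      j).intervalIntegral_comp_comm (int_mono hui hx)
    simp only [ContinuousLinearMap.proj_apply] at L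
    rw [L]
    exact congrFun (hcu x hx) j
  have e : ∀ᵐ x ∂μ01, u x 1 + (q1 x * c x 0 + q2 x * c x 1) = l * c x 0 ∧
      -u x 0 + (q2 x * c x 0 - q1 x * c x 1) = l * c x 1 := by
    filter_upwards [heq] with x hx
    have a0 := congrFun hx 0
    have a1 := congrFun hx 1
    rw [hQ x] at a0 a1
    simp [Bmat, dotProduct, Fin.sum_univ_two] at a0 a1
    exact ⟨a0, by linear_combination a1⟩
  refine ⟨fun t => u t 0 + Complex.I * u t 1, fun t => u t 0 - Complex.I * u t 1,
    (hj 0).add ((hj 1).const_mul _), (hj 0).sub ((hj 1).const_mul _), ?_, ?_, ?_, ?_⟩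
  · intro x hx
    rw [intervalIntegral.integral_add (int_mono (hj 0) hx) (int_mono ((hj 1).const_mul _) hx),
      intervalIntegral.integral_const_mul, hcj 0 x hx, hcj 1 x hx, h0]
    simp; ring
  · intro x hx
    rw [intervalIntegral.integral_sub (int_mono (hj 0) hx) (int_mono ((hj 1).const_mul _) hx),
      intervalIntegral.integral_const_mul, hcj 0 x hx, hcj 1 x hx, h0]
    simp; ring
  · filter_upwards [e] with x hx
    obtain ⟨a, b⟩ := hx
    linear_combination Complex.I * a - b - (l * c x 1 + q1 x * c x 1) * Complex.I_sq
  · filter_upwards [e] with x hx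
    obtain ⟨a, b⟩ := hx
    linear_combination -Complex.I * a - b - (l * c x 1 + q1 x * c x 1) * Complex.I_sq

lemma ae_ii {f g : ℝ → ℂ} (h : ∀ᵐ x ∂μ01, f x = g x) {x : ℝ} (hx : x ∈ Set.Icc (0:ℝ) 1) :
    ∫ t in (0:ℝ)..x, f t = ∫ t in (0:ℝ)..x, g t := by
  rw [mu01_eq, ae_restrict_iff' measurableSet_Ioc] at h
  refine intervalIntegral.integral_congr_ae ?_
  filter_upwards [h] with t ht hxt
  rw [Set.uIoc_of_le hx.1] at hxt
  exact ht ⟨hxt.1, hxt.2.trans hx.2⟩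

/-- The integral system satisfied by the modulated components of `c(·,λ)`. -/
lemma sol_YZ {Q : ℝ → M2} {q1 q2 : ℝ → ℝ}
    (hQ : ∀ x, Q x = !![(q1 x : ℂ), (q2 x : ℂ); (q2 x : ℂ), -(q1 x : ℂ)])
    {l ε : ℝ} {n : ℤ} (hl : (l : ℂ) = Real.pi * (n + 1/2) + ε)
    {c : ℝ → Fin 2 → ℂ} (hc : IsVecSolution Q l c) (h0 : c 0 = ![1, 0])
    (a b : ℝ → ℂ)
    (ha : ∀ t : ℝ, a t = (q2 t - Complex.I * q1 t) * Complex.exp (-Complex.I * Real.pi * t))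
    (hb : ∀ t : ℝ, b t = (q2 t + Complex.I * q1 t) * Complex.exp (Complex.I * Real.pi * t)) :
    ∃ Y Z : ℝ → ℂ, ContinuousOn Y (Set.Icc 0 1) ∧ ContinuousOn Z (Set.Icc 0 1) ∧
      (∀ x ∈ Set.Icc (0:ℝ) 1, Y x = 1 + ∫ t in (0:ℝ)..x, (Complex.I * ε * Y t +
        Complex.exp (-2 * Real.pi * Complex.I * n * t) * a t * Z t)) ∧
      (∀ x ∈ Set.Icc (0:ℝ) 1, Z x = 1 + ∫ t in (0:ℝ)..x, (-Complex.I * ε * Z t +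
        Complex.exp (2 * Real.pi * Complex.I * n * t) * b t * Y t)) ∧
      (∀ x, ‖c x 0‖ ^ 2 + ‖c x 1‖ ^ 2 = (‖Y x‖ ^ 2 + ‖Z x‖ ^ 2) / 2) := by
  obtain ⟨f, g, hf, hg, hP, hR, ef, eg⟩ := sol_system hQ hc h0
  have hl' : (l : ℂ) = Real.pi * (n + 1/2) + ε := hl
  set σ : ℝ := Real.pi * (n + 1/2) with hσ
  have hσ' : (σ : ℂ) = Real.pi * (n + 1/2) := by rw [hσ]; push_cast; ring
  obtain ⟨i1, e1⟩ := exp_ac (-Complex.I * σ) hf hP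
  obtain ⟨i2, e2⟩ := exp_ac (Complex.I * σ) hg hR
  refine ⟨fun x => Complex.exp (-Complex.I * σ * x) * (c x 0 + Complex.I * c x 1),
    fun x => Complex.exp (Complex.I * σ * x) * (c x 0 - Complex.I * c x 1),
    cont_of_int i1 e1, cont_of_int i2 e2, ?_, ?_, ?_⟩
  · intro x hx
    beta_reduce
    rw [e1 x hx]
    congr 1
    refine ae_ii ?_ hx
    filter_upwards [ef] with t ht
    have hE : Complex.exp (-2 * Real.pi * Complex.I * n * t) *
        Complex.exp (-Complex.I * Real.pi * t) * Complex.exp (Complex.I * σ * t) =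
        Complex.exp (-Complex.I * σ * t) := by
      rw [← Complex.exp_add, ← Complex.exp_add, hσ']; congr 1; ring
    rw [ht, ha t, hl', ← hσ']
    linear_combination -(q2 t - Complex.I * q1 t) * (c t 0 - Complex.I * c t 1) * hE
  · intro x hx
    beta_reduce
    rw [e2 x hx]
    congr 1
    refine ae_ii ?_ hx
    filter_upwards [eg] with t ht
    have hE : Complex.exp (2 * Real.pi * Complex.I * n * t) *
        Complex.exp (Complex.I * Real.pi * t) * Complex.exp (-Complex.I * σ * t) =
        Complex.exp (Complex.I * σ * t) := by
      rw [← Complex.exp_add, ← Complex.exp_add, hσ']; congr 1; ring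
    rw [ht, hb t, hl', ← hσ']
    linear_combination -(q2 t + Complex.I * q1 t) * (c t 0 + Complex.I * c t 1) * hE
  · intro x
    have n1 : ‖Complex.exp (-Complex.I * σ * x)‖ = 1 := by
      rw [Complex.norm_exp]; simp
    have n2 : ‖Complex.exp (Complex.I * σ * x)‖ = 1 := by
      rw [Complex.norm_exp]; simp
    simp only [norm_mul, n1, n2, one_mul]
    rw [← Complex.normSq_eq_norm_sq, ← Complex.normSq_eq_norm_sq, ← Complex.normSq_eq_norm_sq,
      ← Complex.normSq_eq_norm_sq, Complex.normSq_apply, Complex.normSq_apply,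
      Complex.normSq_apply, Complex.normSq_apply]
    simp
    ring

/-- Uniqueness, conjugation symmetry and the value of the norm. -/
lemma sol_value {Q : ℝ → M2} {q1 q2 : ℝ → ℝ}
    (hQ : ∀ x, Q x = !![(q1 x : ℂ), (q2 x : ℂ); (q2 x : ℂ), -(q1 x : ℂ)])
    {l ε : ℝ} {n : ℤ} (hl : (l : ℂ) = Real.pi * (n + 1/2) + ε)
    {c : ℝ → Fin 2 → ℂ} (hc : IsVecSolution Q l c) (h0 : c 0 = ![1, 0])
    (a b : ℝ → ℂ)
    (ha : ∀ t : ℝ, a t = (q2 t - Complex.I * q1 t) * Complex.exp (-Complex.I * Real.pi * t))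
    (hb : ∀ t : ℝ, b t = (q2 t + Complex.I * q1 t) * Complex.exp (Complex.I * Real.pi * t))
    (hai : IntervalIntegrable a volume 0 1) (hbi : IntervalIntegrable b volume 0 1)
    {Y2 Z2 : ℝ → ℂ} (cY2 : Continuous Y2) (cZ2 : Continuous Z2)
    (e2 : ∀ x ∈ Set.Icc (0:ℝ) 1, Y2 x = 1 + ∫ t in (0:ℝ)..x, (Complex.I * ε * Y2 t +
        Complex.exp (-2 * Real.pi * Complex.I * n * t) * a t * Z2 t))
    (e4 : ∀ x ∈ Set.Icc (0:ℝ) 1, Z2 x = 1 + ∫ t in (0:ℝ)..x, (-Complex.I * ε * Z2 t +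
        Complex.exp (2 * Real.pi * Complex.I * n * t) * b t * Y2 t)) :
    ((hnormSq c : ℝ) : ℂ) = ∫ t in (0:ℝ)..1, Y2 t * Z2 t := by
  obtain ⟨Y, Z, cY, cZ, e1, e3, hN⟩ := sol_YZ hQ hl hc h0 a b ha hb
  have ce1 : Continuous (fun t : ℝ => Complex.exp (-2 * Real.pi * Complex.I * n * t)) := by fun_prop
  have ce2 : Continuous (fun t : ℝ => Complex.exp (2 * Real.pi * Complex.I * n * t)) := by fun_prop
  have hA := hai.continuousOn_mul ce1.continuousOn
  have hB := hbi.continuousOn_mul ce2.continuousOn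
  have hu := scal_unique hA hB cY cZ cY2.continuousOn cZ2.continuousOn e1 e2 e3 e4
  have hAB : ∀ t : ℝ, star (Complex.exp (2 * Real.pi * Complex.I * n * t) * b t) =
      Complex.exp (-2 * Real.pi * Complex.I * n * t) * a t := by
    intro t
    rw [ha, hb]
    simp only [star_mul', Complex.star_def, ← Complex.exp_conj, map_add, map_mul, Complex.conj_I,
      Complex.conj_ofReal, map_ofNat, map_intCast]
    have r1 : (2 * (Real.pi:ℂ) * -Complex.I * n * t) = -2 * Real.pi * Complex.I * n * t := by ring
    rw [r1]
    ring
  have hBA : ∀ t : ℝ, star (Complex.exp (-2 * Real.pi * Complex.I * n * t) * a t) =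
      Complex.exp (2 * Real.pi * Complex.I * n * t) * b t := by
    intro t; rw [← hAB, star_star]
  have hstar : ∀ (F : ℝ → ℂ) (x : ℝ), star (∫ t in (0:ℝ)..x, F t) =
      ∫ t in (0:ℝ)..x, star (F t) := fun F x => intervalIntegral.intervalIntegral_conj.symm
  have s1 : ∀ x ∈ Set.Icc (0:ℝ) 1, star (Z x) = 1 + ∫ t in (0:ℝ)..x,
      (Complex.I * ε * star (Z t) +
        Complex.exp (-2 * Real.pi * Complex.I * n * t) * a t * star (Y t)) := by
    intro x hx
    rw [e3 x hx, star_add, star_one, hstar]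
    congr 2
    ext t
    rw [star_add, star_mul', star_mul', star_mul', hAB]
    simp
  have s2 : ∀ x ∈ Set.Icc (0:ℝ) 1, star (Y x) = 1 + ∫ t in (0:ℝ)..x,
      (-Complex.I * ε * star (Y t) +
        Complex.exp (2 * Real.pi * Complex.I * n * t) * b t * star (Z t)) := by
    intro x hx
    rw [e1 x hx, star_add, star_one, hstar]
    congr 2
    ext t
    rw [star_add, star_mul', star_mul', star_mul', hBA]
    simp
  have hs := scal_unique hA hB cY cZ (Y2 := fun x => star (Z x)) (Z2 := fun x => star (Y x))
    (continuous_star.comp_continuousOn cZ) (continuous_star.comp_continuousOn cY) e1 s1 e3 s2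
  unfold hnormSq
  rw [← integral_Ioc_eq_integral_Ioo, ← intervalIntegral.integral_of_le zero_le_one,
    ← intervalIntegral.integral_ofReal]
  refine intervalIntegral.integral_congr (fun x hx => ?_)
  rw [Set.uIcc_of_le zero_le_one] at hx
  have z1 : Z x = star (Y x) := (hs x hx).2
  rw [← (hu x hx).1, ← (hu x hx).2, hN x, z1, norm_star, Complex.star_def, Complex.mul_conj,
    Complex.normSq_eq_norm_sq]
  congr 1
  ring

end Scalar

section Final

lemma entry_memLp {p : ℝ≥0∞} {Q : ℝ → M2} (hQ : MemLp Q p μ01) (i j : Fin 2) :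
    MemLp (fun x => Q x i j) p μ01 :=
  (LinearMap.toContinuousLinearMap (Matrix.entryLinearMap ℂ ℂ i j)).comp_memLp' hQ

lemma memLp_mul_exp {p : ℝ≥0∞} {f e : ℝ → ℂ} (hf : MemLp f p μ01) (he : Continuous e)
    (hn : ∀ t, ‖e t‖ = 1) : MemLp (fun t => f t * e t) p μ01 :=
  hf.of_le (hf.1.mul he.aestronglyMeasurable)
    (Eventually.of_forall fun t => by rw [norm_mul, hn, mul_one])

end Final

/-- The norming constants `α_n = ‖c(·,λ_n)‖_ℍ^{-2}` satisfy
`α_n = 1 + e_n(g)` for some `g ∈ L_p(0,1)`. -/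
theorem statement6 (p : ℝ≥0∞) (hp : 1 ≤ p) (hp' : p ≠ ∞)
    (Q : ℝ → M2) (hQform : IsRealDiracForm Q) (hQp : MemLp Q p μ01)
    (lam : ℤ → ℝ)
    (hlam : ∀ l : ℝ, IsEigenvalue Q 0 l ↔ ∃ n : ℤ, lam n = l)
    (hasymp : LamAsymp p lam) :
    ∃ g : ℝ → ℂ, MemLp g p μ01 ∧
      ∀ n : ℤ, ∀ c : ℝ → Fin 2 → ℂ,
        IsVecSolution Q (lam n) c → c 0 = ![1, 0] →
          (((hnormSq c)⁻¹ : ℝ) : ℂ) = 1 + fc g n := by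
  have : Fact (1 ≤ p) := ⟨hp⟩
  have : Fact (p ≠ ∞) := ⟨hp'⟩
  obtain ⟨q1, q2, hQ⟩ := hQform
  obtain ⟨g1, hg1, hlam1⟩ := hasymp
  obtain ⟨G, hG⟩ := exists_Xp (p := p) g1 hg1
  have hq := entry_memLp hQp
  have h1 : MemLp (fun t => (q1 t : ℂ)) p μ01 := by simpa [hQ] using hq 0 0
  have h2 : MemLp (fun t => (q2 t : ℂ)) p μ01 := by simpa [hQ] using hq 0 1
  obtain ⟨a, ha⟩ : ∃ a : ℝ → ℂ, ∀ t : ℝ, a t =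
    (q2 t - Complex.I * q1 t) * Complex.exp (-Complex.I * Real.pi * t) := ⟨_, fun _ => rfl⟩
  obtain ⟨b, hb⟩ : ∃ b : ℝ → ℂ, ∀ t : ℝ, b t =
    (q2 t + Complex.I * q1 t) * Complex.exp (Complex.I * Real.pi * t) := ⟨_, fun _ => rfl⟩
  have hma : MemLp a p μ01 := by
    rw [funext ha]
    refine memLp_mul_exp (h2.sub (h1.const_mul Complex.I)) (by fun_prop) (fun t => ?_)
    rw [Complex.norm_exp]; simp
  have hmb : MemLp b p μ01 := by
    rw [funext hb]
    refine memLp_mul_exp (h2.add (h1.const_mul Complex.I)) (by fun_prop) (fun t => ?_)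
    rw [Complex.norm_exp]; simp
  obtain ⟨y, z, hy, hz, hyz⟩ := system_exists (p := p) G a b hma hmb
  have hcv : Continuous (fun t => conv (y t) (z t)) :=
    (conv.continuous.comp hy).clm_apply hz
  have hk : Continuous (fun t => y t + z t + conv (y t) (z t)) := (hy.add hz).add hcv
  obtain ⟨r, hr⟩ := wiener (p := p) (∫ t in (0:ℝ)..1, (y t + z t + conv (y t) (z t)))
  obtain ⟨g, hg, hge⟩ := exists_fc (p := p) r
  refine ⟨g, hg, fun n c hc h0 => ?_⟩
  rw [hge n, ← hr n, Complex.ofReal_inv]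
  congr 1
  have hε : ((lam n - Real.pi * (n + 1/2) : ℝ) : ℂ) = eC n G := by
    rw [hG n]
    push_cast
    rw [hlam1 n]; ring
  have cy : Continuous (fun t => 1 + eC n (y t)) :=
    continuous_const.add ((eC n).continuous.comp hy)
  have cz : Continuous (fun t => 1 + eC n (z t)) :=
    continuous_const.add ((eC n).continuous.comp hz)
  have key := sol_value (ε := lam n - Real.pi * (n + 1/2)) (n := n) hQ (by push_cast; ring) hc h0 a b ha hb
    (memLp_ii hp hma) (memLp_ii hp hmb) cy cz
    (fun x hx => by rw [hε]; exact (hyz n x hx).1) (fun x hx => by rw [hε]; exact (hyz n x hx).2)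
  rw [key, ← (eC n).intervalIntegral_comp_comm (hk.intervalIntegrable 0 1)]
  have e1 : ∀ t, (1 + eC n (y t)) * (1 + eC n (z t)) =
      1 + eC n (y t + z t + conv (y t) (z t)) := by
    intro t
    rw [map_add, map_add, eC_conv]; ring
  simp only [e1]
  have ck : Continuous (fun t => eC n (y t + z t + conv (y t) (z t))) :=
    (eC n).continuous.comp hk
  rw [intervalIntegral.integral_add intervalIntegrable_const (ck.intervalIntegrable 0 1)]
  simp
end
end
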